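/- Let n_0 be a positive Borel measure on (0,∞) with ∫ x² n_0(dx) = ∫ x³ n_0(dx) = 1 and μ_4 = ∫ x⁴ n_0(dx) < ∞. Suppose (n(t,·))_{t∈[0,1)} is a weak solution of Smoluchowski's coagulation equation with multiplicative kernel K(x,y) = xy and n(0,·) = n_0, and with τ = log(1−t)^{−1} let F(τ, x̂) = (1−t) ∫_{(0, (1−t)^{−2} x̂]} y² n(t,dy) and F_*(x̂) = ∫_0^{x̂} (2π)^{−1/2} ŷ^{−1/2} e^{−ŷ/2} dŷ. Then there is a constant C depending only on μ_4 such that for all τ ∈ [0,∞), sup_{x̂>0} |F(τ, x̂) − F_*(x̂)| ≤ C(μ_4)(1 + τ) e^{−τ}. -/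

import Mathlib

open MeasureTheory Set

/-- A family `n t` of finite positive Borel measures on `(0,∞)` (here: measures on `ℝ`
giving no mass to `(-∞,0]`) is a weak solution of Smoluchowski's coagulation equation
with kernel `K` on the time interval `I` if for every smooth compactly supported test
function `φ` with support in `(0,∞)`, the map `t ↦ ∫ φ dn(t)` is differentiable with
derivative `(1/2)∫∫ (φ(x+y) - φ(x) - φ(y)) K(x,y) n(t,dy) n(t,dx)`; moreover the moment
identities obtained from the weak form with the polynomial test functions `x^j`, `j ∈ J`,
hold whenever the corresponding moments are finite. -/
def IsWeakSolution (K : ℝ → ℝ → ℝ) (I : Set ℝ) (n : ℝ → Measure ℝ) (J : Set ℕ) : Prop :=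
  (∀ t ∈ I, IsFiniteMeasure (n t)) ∧
  (∀ t ∈ I, n t (Iic 0) = 0) ∧
  (∀ φ : ℝ → ℝ, ContDiff ℝ (⊤ : ℕ∞) φ → HasCompactSupport φ → tsupport φ ⊆ Ioi 0 →
    ∀ t ∈ I, HasDerivWithinAt (fun r => ∫ x, φ x ∂(n r))
      ((1 / 2) * ∫ x, ∫ y, (φ (x + y) - φ x - φ y) * K x y ∂(n t) ∂(n t)) I t) ∧
  (∀ j ∈ J,
    (∀ t ∈ I, Integrable (fun x => x ^ j) (n t)) →
    (∀ t ∈ I, Integrable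
        (fun p : ℝ × ℝ => ((p.1 + p.2) ^ j - p.1 ^ j - p.2 ^ j) * K p.1 p.2)
        ((n t).prod (n t))) →
    ∀ t ∈ I, HasDerivWithinAt (fun r => ∫ x, x ^ j ∂(n r))
      ((1 / 2) * ∫ p : ℝ × ℝ, ((p.1 + p.2) ^ j - p.1 ^ j - p.2 ^ j) * K p.1 p.2
          ∂((n t).prod (n t))) I t)



open MeasureTheory Set

/-- admissible test functions -/
def TF (φ : ℝ → ℝ) : Prop :=
  ContDiff ℝ (⊤ : ℕ∞) φ ∧ HasCompactSupport φ ∧ tsupport φ ⊆ Ioi 0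

lemma TF.add {φ ψ : ℝ → ℝ} (h : TF φ) (h' : TF ψ) : TF (fun x => φ x + ψ x) := by
  refine ⟨h.1.add h'.1, h.2.1.add h'.2.1, ?_⟩
  exact (tsupport_add φ ψ).trans (union_subset h.2.2 h'.2.2)

lemma TF.smul {φ : ℝ → ℝ} (h : TF φ) (c : ℝ) : TF (fun x => c * φ x) := by
  refine ⟨contDiff_const.mul h.1, h.2.1.mul_left, ?_⟩
  exact (tsupport_mul_subset_right (f := fun _ => c) (g := φ)).trans h.2.2

lemma TF.mul_smooth {φ f : ℝ → ℝ} (h : TF φ) (hf : ContDiff ℝ (⊤ : ℕ∞) f) :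
    TF (fun x => f x * φ x) := by
  refine ⟨hf.mul h.1, h.2.1.mul_left, ?_⟩
  exact (tsupport_mul_subset_right (f := f) (g := φ)).trans h.2.2

lemma TF.bdd {φ : ℝ → ℝ} (h : TF φ) : ∃ a R C : ℝ, 0 < a ∧ 0 < R ∧ 0 ≤ C ∧
    (∀ x, |φ x| ≤ C) ∧ (∀ x ≤ a, φ x = 0) ∧ (∀ x ≥ R, φ x = 0) := by
  obtain ⟨C, hC⟩ := h.2.1.exists_bound_of_continuous h.1.continuous
  have hc : IsCompact (tsupport φ) := h.2.1
  have hb := hc.isBounded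
  obtain ⟨R, hR⟩ := hb.subset_ball (0:ℝ)
  have hcl : (tsupport φ)ᶜ ∈ nhds (0:ℝ) := by
    apply (isClosed_tsupport φ).isOpen_compl.mem_nhds
    intro h0
    have h1 : (0:ℝ) < 0 := h.2.2 h0
    exact lt_irrefl _ h1
  obtain ⟨ε, hε, hb⟩ := Metric.mem_nhds_iff.1 hcl
  refine ⟨ε/2, |R|+1, |C|, by positivity, by positivity, by positivity, ?_, ?_, ?_⟩
  · intro x; exact (hC x).trans (le_abs_self _)
  · intro x hx
    by_contra hne
    have hx1 : x ∈ tsupport φ := subset_tsupport _ hne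
    have : 0 < x := h.2.2 hx1
    have : x ∈ Metric.ball (0:ℝ) ε := by
      rw [Metric.mem_ball, Real.dist_eq, sub_zero, abs_of_pos this]; linarith
    exact hb this hx1
  · intro x hx
    by_contra hne
    have hx1 : x ∈ tsupport φ := subset_tsupport _ hne
    have := hR hx1
    rw [Metric.mem_ball, Real.dist_eq, sub_zero] at this
    have h1 := le_abs_self x
    have h2 := le_abs_self R
    linarith

lemma bumpTF (c r R : ℝ) (h1 : 0 < r) (h2 : r < R) (h3 : R < c) :
    ∃ b : ℝ → ℝ, TF b ∧ (∀ x, 0 ≤ b x) ∧ (∀ x, b x ≠ 0 ↔ x ∈ Metric.ball c R) := by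
  let B : ContDiffBump c := ⟨r, R, h1, h2⟩
  refine ⟨B, ⟨B.contDiff, B.hasCompactSupport, ?_⟩, fun x => B.nonneg, ?_⟩
  · rw [B.tsupport_eq]
    intro x hx
    have : |x - c| ≤ R := by simpa [Real.dist_eq] using hx
    have := (abs_le.1 this).1
    simp only [mem_Ioi]; linarith
  · intro x
    rw [← Function.mem_support, B.support_eq]

lemma ae_pos_of {n : Measure ℝ} (h0 : n (Iic 0) = 0) : ∀ᵐ x ∂n, 0 < x := by
  rw [ae_iff]; simpa [not_lt, Iic] using h0

section
variable (n : Measure ℝ)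

/-- the bilinear form -/
noncomputable def JJ (φ : ℝ → ℝ) : ℝ := ∫ x, ∫ y, (φ (x + y) - φ x - φ y) * (x * y) ∂n ∂n

noncomputable def gg (φ : ℝ → ℝ) (x : ℝ) : ℝ := ∫ y, φ (x + y) * y ∂n

variable [IsFiniteMeasure n]

lemma int_ybd (h0 : n (Iic 0) = 0) {φ : ℝ → ℝ} (h : TF φ) {x : ℝ} (hx : 0 ≤ x) :
    Integrable (fun y => φ (x + y) * y) n := by
  obtain ⟨a, R, C, ha, hR, hC0, hC, hl, hr⟩ := h.bdd
  refine Integrable.mono' (g := fun _ => C * R) (integrable_const _) ?_ ?_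
  · have := h.1.continuous
    exact (by fun_prop : Continuous fun y => φ (x+y) * y).aestronglyMeasurable
  · filter_upwards [ae_pos_of h0] with y hy
    rw [norm_mul, Real.norm_eq_abs, Real.norm_eq_abs, abs_of_pos hy]
    by_cases hyR : y ≤ R
    · exact mul_le_mul (hC _) hyR hy.le hC0
    · rw [hr (x+y) (by linarith)]; simp; positivity

lemma gg_bound (h0 : n (Iic 0) = 0) {φ : ℝ → ℝ} (h : TF φ) :
    ∃ R M : ℝ, 0 < R ∧ 0 ≤ M ∧ (∀ x ≥ 0, |gg n φ x| ≤ M) ∧ (∀ x ≥ R, gg n φ x = 0) := by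
  obtain ⟨a, R, C, ha, hR, hC0, hC, hl, hr⟩ := h.bdd
  refine ⟨R, C * R * n.real univ, hR, by positivity, ?_, ?_⟩
  · intro x hx
    have := norm_integral_le_of_norm_le_const (μ := n) (f := fun y => φ (x+y) * y) (C := C * R) ?_
    · exact this
    filter_upwards [ae_pos_of h0] with y hy
    rw [norm_mul, Real.norm_eq_abs, Real.norm_eq_abs, abs_of_pos hy]
    by_cases hyR : y ≤ R
    · exact mul_le_mul (hC _) hyR hy.le hC0
    · rw [hr (x+y) (by linarith)]; simp; positivity
  · intro x hx
    unfold gg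
    rw [integral_eq_zero_of_ae]
    filter_upwards [ae_pos_of h0] with y hy
    simp [hr (x+y) (by linarith)]

lemma gg_meas {φ : ℝ → ℝ} (h : TF φ) : StronglyMeasurable (gg n φ) := by
  have hc := h.1.continuous
  have : StronglyMeasurable (fun p : ℝ × ℝ => φ (p.1 + p.2) * p.2) :=
    (by fun_prop : Continuous fun p : ℝ × ℝ => φ (p.1 + p.2) * p.2).stronglyMeasurable
  exact this.integral_prod_right'

lemma xg_int (h0 : n (Iic 0) = 0) {φ : ℝ → ℝ} (h : TF φ) :
    Integrable (fun x => x * gg n φ x) n := by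
  obtain ⟨R, M, hR, hM, hb, hz⟩ := gg_bound n h0 h
  refine Integrable.mono' (g := fun _ => R * M) (integrable_const _) ?_ ?_
  · exact (stronglyMeasurable_id.mul (gg_meas n h)).aestronglyMeasurable
  · filter_upwards [ae_pos_of h0] with y hy
    rw [norm_mul, Real.norm_eq_abs, Real.norm_eq_abs, abs_of_pos hy]
    by_cases hyR : y ≤ R
    · exact mul_le_mul hyR (hb _ hy.le) (abs_nonneg _) hR.le
    · rw [hz y (by linarith)]; simp; positivity

lemma inner_eq (h0 : n (Iic 0) = 0) (hni : ¬ Integrable (fun x : ℝ => x) n) {φ : ℝ → ℝ} (h : TF φ) :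
    ∀ᵐ x ∂n, (∫ y, (φ (x + y) - φ x - φ y) * (x * y) ∂n)
      = {x | φ x = 0}.indicator (fun x => x * (gg n φ x - gg n φ 0)) x := by
  filter_upwards [ae_pos_of h0] with x hx
  have i1 := int_ybd n h0 h hx.le
  have i2 : Integrable (fun y => φ y * y) n := by simpa using int_ybd n h0 h le_rfl
  by_cases hφ : φ x = 0
  · rw [indicator_of_mem (by simpa using hφ)]
    have : ∀ y, (φ (x + y) - φ x - φ y) * (x * y) = x * (φ (x+y) * y - φ y * y) := by
      intro y; rw [hφ]; ring
    simp_rw [this]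
    rw [integral_const_mul, integral_sub i1 i2]
    simp [gg]
  · rw [indicator_of_notMem (by simpa using hφ)]
    apply integral_undef
    intro hint
    apply hni
    have h1 : Integrable (fun y => (φ x * x)⁻¹ * (x * (φ (x+y) * y - φ y * y) - (φ (x + y) - φ x - φ y) * (x * y))) n :=
      (((i1.sub i2).const_mul x).sub hint).const_mul _
    refine h1.congr (Filter.Eventually.of_forall fun y => ?_)
    simp only
    field_simp
    ring

lemma JJ_zero_of (h0 : n (Iic 0) = 0) (hni : ¬ Integrable (fun x : ℝ => x) n) {φ : ℝ → ℝ} (h : TF φ)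
    (hc : gg n φ 0 ≠ 0) : JJ n φ = 0 := by
  apply integral_undef
  intro hint
  have hint' := hint.congr (inner_eq n h0 hni h)
  obtain ⟨a, R1, C, ha, hR1, hC0, hC, hl, hr⟩ := h.bdd
  obtain ⟨R2, M, hR2, hM, hb, hz⟩ := gg_bound n h0 h
  apply hni
  have h3 : Integrable (fun x => ‖((gg n φ 0)⁻¹ * {x | φ x = 0}.indicator (fun x => x * (gg n φ x - gg n φ 0)) x)‖ + (max R1 R2)) n :=
    (hint'.const_mul _).norm.add (integrable_const _)
  refine Integrable.mono' h3 aestronglyMeasurable_id ?_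
  filter_upwards [ae_pos_of h0] with x hx
  rw [Real.norm_eq_abs, abs_of_pos hx]
  by_cases hxR : x ≤ max R1 R2
  · have := norm_nonneg ((gg n φ 0)⁻¹ * {x | φ x = 0}.indicator (fun x => x * (gg n φ x - gg n φ 0)) x)
    linarith
  · push Not at hxR
    have e1 : φ x = 0 := hr x ((le_max_left _ _).trans hxR.le)
    have e2 := hz x ((le_max_right _ _).trans hxR.le)
    rw [indicator_of_mem (by simpa using e1), e2]
    have : (gg n φ 0)⁻¹ * (x * (0 - gg n φ 0)) = -x := by field_simp; ring
    rw [this, norm_neg, Real.norm_eq_abs, abs_of_pos hx]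
    have : 0 < max R1 R2 := lt_max_of_lt_left hR1
    linarith

lemma JJ_eq_of (h0 : n (Iic 0) = 0) (hni : ¬ Integrable (fun x : ℝ => x) n) {φ : ℝ → ℝ} (h : TF φ)
    (hc : gg n φ 0 = 0) : JJ n φ = ∫ x in {x | φ x = 0}, x * gg n φ x ∂n := by
  unfold JJ
  rw [integral_congr_ae (inner_eq n h0 hni h), integral_indicator]
  · simp [hc]
  · exact h.1.continuous.measurable (measurableSet_singleton 0)

lemma gg_lin (h0 : n (Iic 0) = 0) {φ ψ : ℝ → ℝ} (h : TF φ) (h' : TF ψ) (a b : ℝ) {x : ℝ} (hx : 0 ≤ x) :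
    gg n (fun z => a * φ z + b * ψ z) x = a * gg n φ x + b * gg n ψ x := by
  unfold gg
  rw [← integral_const_mul, ← integral_const_mul, ← integral_add]
  · congr 1; ext y; ring
  · exact (int_ybd n h0 h hx).const_mul _
  · exact (int_ybd n h0 h' hx).const_mul _

lemma bump_pos (h0 : n (Iic 0) = 0) {b : ℝ → ℝ} (hb : TF b) (hn : ∀ x, 0 ≤ b x) {c R : ℝ}
    (hs : ∀ x, b x ≠ 0 ↔ x ∈ Metric.ball c R) (hp : 0 < n (Metric.ball c R)) : 0 < gg n b 0 := by
  have hi := int_ybd n h0 hb le_rfl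
  have hnn : 0 ≤ᵐ[n] fun y => b (0 + y) * y := by
    filter_upwards [ae_pos_of h0] with y hy
    exact mul_nonneg (hn _) hy.le
  unfold gg
  rw [integral_pos_iff_support_of_nonneg_ae hnn hi]
  refine lt_of_lt_of_le hp (measure_mono_ae ?_)
  filter_upwards [ae_pos_of h0] with y hy hyb
  simp only [zero_add]
  exact mul_ne_zero ((hs y).2 hyb) hy.ne'

theorem partA (h0 : n (Iic 0) = 0)
    (hadd : ∀ φ ψ, TF φ → TF ψ → JJ n (fun x => φ x + ψ x) = JJ n φ + JJ n ψ) :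
    Integrable (fun x : ℝ => x) n := by
  by_contra hni
  have hpos : ∀ R, 0 < n (Ioi R) := by
    intro R
    by_contra hcon
    have hz : n (Ioi R) = 0 := by simpa using hcon
    apply hni
    refine Integrable.mono' (g := fun _ => R) (integrable_const _) aestronglyMeasurable_id ?_
    have : ∀ᵐ x ∂n, x ≤ R := by rw [ae_iff]; simp only [not_le]; exact hz
    filter_upwards [ae_pos_of h0, this] with x hx hx2
    rwa [Real.norm_eq_abs, abs_of_pos hx]
  have hsup : ∀ R, ∃ x, R < x ∧ ∀ r > 0, 0 < n (Metric.ball x r) := by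
    intro R
    obtain ⟨x, hx, hx2⟩ := exists_mem_forall_mem_nhdsWithin_pos_measure (hpos R).ne'
    refine ⟨x, hx, fun r hr => hx2 _ (mem_nhdsWithin_of_mem_nhds (Metric.ball_mem_nhds _ hr))⟩
  obtain ⟨x0, hx0, p0⟩ := hsup 0
  obtain ⟨x1, hx1, p1⟩ := hsup (2 * x0)
  obtain ⟨x2, hx2, p2⟩ := hsup (x1 + 10 * x0)
  set r := x0 / 8 with hr
  have hrp : 0 < r := by positivity
  obtain ⟨η, tη, nη, sη⟩ := bumpTF x0 (r/2) r (by linarith) (by linarith) (by linarith)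
  obtain ⟨θ, tθ, nθ, sθ⟩ := bumpTF x1 (r/2) r (by linarith) (by linarith) (by linarith)
  set c := (x1 + 6 * r + (x2 + r)) / 2 with hc
  set ρ := ((x2 + r) - (x1 + 6 * r)) / 2 with hρ
  obtain ⟨ψ, tψ, nψ, sψ⟩ := bumpTF c (ρ/2) ρ (by linarith) (by linarith) (by linarith)
  have bη : ∀ x, η x ≠ 0 ↔ x0 - r < x ∧ x < x0 + r := by
    intro x; rw [sη, Metric.mem_ball, Real.dist_eq, abs_lt]; constructor <;> rintro ⟨h1, h2⟩ <;> constructor <;> linarith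
  have bθ : ∀ x, θ x ≠ 0 ↔ x1 - r < x ∧ x < x1 + r := by
    intro x; rw [sθ, Metric.mem_ball, Real.dist_eq, abs_lt]; constructor <;> rintro ⟨h1, h2⟩ <;> constructor <;> linarith
  have bψ : ∀ x, ψ x ≠ 0 ↔ x1 + 6 * r < x ∧ x < x2 + r := by
    intro x; rw [sψ, Metric.mem_ball, Real.dist_eq, abs_lt]; constructor <;> rintro ⟨h1, h2⟩ <;> constructor <;> linarith
  have gη := bump_pos n h0 tη nη sη (p0 r hrp)
  have gθ := bump_pos n h0 tθ nθ sθ (p1 r hrp)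
  have gψ : 0 < gg n ψ 0 := by
    refine bump_pos n h0 tψ nψ sψ (lt_of_lt_of_le (p2 r hrp) (measure_mono ?_))
    intro x hx
    rw [← sψ, bψ]
    rw [Metric.mem_ball, Real.dist_eq, abs_lt] at hx
    constructor <;> linarith [hx.1, hx.2]
  -- JJ vanishes identically
  have JJ0 : ∀ φ, TF φ → JJ n φ = 0 := by
    intro φ hφ
    by_cases h : gg n φ 0 = 0
    · have e := hadd φ θ hφ tθ
      have e2 := JJ_zero_of n h0 hni tθ gθ.ne'
      have e3 := JJ_zero_of n h0 hni (hφ.add tθ) (by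
        have := gg_lin n h0 hφ tθ 1 1 (le_refl (0:ℝ))
        simp only [one_mul] at this
        rw [this, h]; simpa using gθ.ne')
      linarith
    · exact JJ_zero_of n h0 hni hφ h
  let α : ℝ → ℝ := fun δ => (gg n ψ 0 + δ * gg n θ 0) / gg n η 0
  let φ : ℝ → ℝ → ℝ := fun δ x => 1 * (1 * ψ x + (-α δ) * η x) + δ * θ x
  have tφ : ∀ δ, TF (φ δ) := fun δ => (((tψ.smul 1).add (tη.smul _)).smul 1).add (tθ.smul δ)
  have gφ : ∀ δ, ∀ x ≥ 0, gg n (φ δ) x = gg n ψ x - α δ * gg n η x + δ * gg n θ x := by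
    intro δ x hx
    have e1 := gg_lin n h0 ((tψ.smul 1).add (tη.smul (-α δ))) tθ 1 δ hx
    have e2 := gg_lin n h0 tψ tη 1 (-α δ) hx
    simp only [φ]
    rw [e1, e2]; ring
  have g0 : ∀ δ, gg n (φ δ) 0 = 0 := by
    intro δ; rw [gφ δ 0 le_rfl]; simp only [α]; field_simp; ring
  have hαpos : ∀ δ ≥ 0, 0 < α δ := fun δ hδ => by positivity
  have hint : ∀ δ, ∫ x in {x | φ δ x = 0}, x * gg n (φ δ) x ∂n = 0 := by
    intro δ; rw [← JJ_eq_of n h0 hni (tφ δ) (g0 δ)]; exact JJ0 _ (tφ δ)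
  let Z := {x | ψ x = 0 ∧ η x = 0 ∧ θ x = 0}
  let Z0 := {x | ψ x = 0 ∧ η x = 0}
  have hZ : ∀ δ > 0, {x | φ δ x = 0} = Z := by
    intro δ hδ
    ext x
    simp only [mem_ofPred_eq, Z, φ]
    constructor
    · intro h
      by_cases h1 : η x = 0
      · have a1 := nψ x
        have a2 := nθ x
        rw [h1] at h
        have : 0 ≤ δ * θ x := by positivity
        have e2 : δ * θ x = 0 := by linarith
        refine ⟨by linarith, h1, ?_⟩
        simpa [hδ.ne'] using e2
      · exfalso
        have b1 := (bη x).1 h1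
        have e1 : ψ x = 0 := by
          by_contra hh; have := (bψ x).1 hh; linarith [b1.2, this.1]
        have e2 : θ x = 0 := by
          by_contra hh; have := (bθ x).1 hh; linarith [b1.2, this.1]
        rw [e1, e2] at h
        have := hαpos δ hδ.le
        simp [h1, this.ne'] at h
    · rintro ⟨a1, a2, a3⟩; rw [a1, a2, a3]; ring
  have hZ0 : {x | φ 0 x = 0} = Z0 := by
    ext x
    simp only [mem_ofPred_eq, Z0, φ]
    constructor
    · intro h
      by_cases h1 : η x = 0
      · rw [h1] at h
        exact ⟨by linarith, h1⟩
      · exfalso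
        have b1 := (bη x).1 h1
        have e1 : ψ x = 0 := by
          by_contra hh; have := (bψ x).1 hh; linarith [b1.2, this.1]
        rw [e1] at h
        have := hαpos 0 le_rfl
        simp [h1, this.ne'] at h
    · rintro ⟨a1, a2⟩; rw [a1, a2]; ring
  have mψ : MeasurableSet {x | ψ x = 0} := tψ.1.continuous.measurable (measurableSet_singleton 0)
  have mη : MeasurableSet {x | η x = 0} := tη.1.continuous.measurable (measurableSet_singleton 0)
  have mθ : MeasurableSet {x | θ x = 0} := tθ.1.continuous.measurable (measurableSet_singleton 0)
  have mZ : MeasurableSet Z := mψ.inter (mη.inter mθ)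
  have mZ0 : MeasurableSet Z0 := mψ.inter mη
  have I1 := hint 1
  have I2 := hint 2
  have I0 := hint 0
  rw [hZ 1 one_pos] at I1
  rw [hZ 2 two_pos] at I2
  rw [hZ0] at I0
  have xi := fun δ => xg_int n h0 (tφ δ)
  have hg0 : ∀ x ≥ 0, gg n (φ 0) x = 2 * gg n (φ 1) x - gg n (φ 2) x := by
    intro x hx
    rw [gφ 0 x hx, gφ 1 x hx, gφ 2 x hx]
    simp only [α]; field_simp; ring
  have I3 : ∫ x in Z, x * gg n (φ 0) x ∂n = 0 := by
    have : ∫ x in Z, x * gg n (φ 0) x ∂n = ∫ x in Z, (2 * (x * gg n (φ 1) x) - x * gg n (φ 2) x) ∂n := by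
      apply integral_congr_ae
      filter_upwards [ae_restrict_of_ae (ae_pos_of h0)] with x hx
      rw [hg0 x hx.le]; ring
    rw [this, integral_sub ((xi 1).const_mul 2).integrableOn (xi 2).integrableOn, integral_const_mul, I1, I2]
    ring
  have hsub : Z ⊆ Z0 := fun x hx => ⟨hx.1, hx.2.1⟩
  have I4 : ∫ x in Metric.ball x1 r, x * gg n (φ 0) x ∂n = 0 := by
    have e : Metric.ball x1 r = Z0 \ Z := by
      ext x
      rw [← sθ]
      simp only [mem_sdiff, Z0, Z, mem_ofPred_eq]
      constructor
      · intro h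
        have b1 := (bθ x).1 h
        have e1 : ψ x = 0 := by
          by_contra hh; have := (bψ x).1 hh; linarith [b1.2, this.1]
        have e2 : η x = 0 := by
          by_contra hh; have := (bη x).1 hh; linarith [b1.1, this.2]
        exact ⟨⟨e1, e2⟩, fun hh => h hh.2.2⟩
      · rintro ⟨⟨a, b⟩, cc⟩ h
        exact cc ⟨a, b, h⟩
    rw [e, setIntegral_sdiff mZ (xi 0).integrableOn hsub, I0, I3, sub_zero]
  have I5 : ∀ x ∈ Metric.ball x1 r, x * gg n (φ 0) x = x * gg n ψ x := by
    intro x hx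
    rw [Metric.mem_ball, Real.dist_eq, abs_lt] at hx
    have hx' : 0 ≤ x := by linarith [hx.1]
    rw [gφ 0 x hx']
    have : gg n η x = 0 := by
      unfold gg
      apply integral_eq_zero_of_ae
      filter_upwards [ae_pos_of h0] with y hy
      have : η (x + y) = 0 := by
        by_contra hh; have := (bη _).1 hh; linarith [hx.1, this.2]
      simp [this]
    rw [this]; ring
  rw [setIntegral_congr_fun Metric.isOpen_ball.measurableSet I5] at I4
  have gψn : ∀ x ≥ 0, 0 ≤ gg n ψ x := by
    intro x hx
    apply integral_nonneg_of_ae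
    filter_upwards [ae_pos_of h0] with y hy
    exact mul_nonneg (nψ _) hy.le
  rw [setIntegral_eq_zero_iff_of_nonneg_ae] at I4
  · have hex : ∃ x ∈ Metric.ball x1 r, 0 < x ∧ x * gg n ψ x = 0 := by
      by_contra hcon
      push Not at hcon
      have : ∀ᵐ x ∂(n.restrict (Metric.ball x1 r)), False := by
        filter_upwards [I4, ae_restrict_mem Metric.isOpen_ball.measurableSet, ae_restrict_of_ae (ae_pos_of h0)] with x h1 h2 h3
        exact hcon x h2 h3 h1
      rw [Filter.eventually_false_iff_eq_bot, ae_eq_bot, Measure.restrict_eq_zero] at this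
      exact (p1 r hrp).ne' this
    obtain ⟨x, hxb, hxp, hx⟩ := hex
    rw [Metric.mem_ball, Real.dist_eq, abs_lt] at hxb
    have hgz : gg n ψ x = 0 := by simpa [hxp.ne'] using hx
    unfold gg at hgz
    rw [integral_eq_zero_iff_of_nonneg_ae _ (int_ybd n h0 tψ hxp.le)] at hgz
    · have : n (Metric.ball x0 r) = 0 := by
        rw [← nonpos_iff_eq_zero]
        have hz : n {y | ¬ (ψ (x + y) * y = 0)} = 0 := hgz
        rw [← hz]
        apply measure_mono
        intro y hy
        rw [Metric.mem_ball, Real.dist_eq, abs_lt] at hy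
        have : ψ (x + y) ≠ 0 := (bψ _).2 ⟨by linarith [hy.1, hxb.1], by linarith [hy.2, hxb.2]⟩
        have hy0 : y ≠ 0 := by intro h; rw [h] at hy; linarith [hy.1]
        exact mul_ne_zero this hy0
      exact (p0 r hrp).ne' this
    · filter_upwards [ae_pos_of h0] with y hy
      exact mul_nonneg (nψ _) hy.le
  · filter_upwards [ae_restrict_of_ae (ae_pos_of h0)] with x hx
    exact mul_nonneg hx.le (gψn x hx.le)
  · exact (xg_int n h0 tψ).integrableOn
end

open MeasureTheory Set Filter Topology

/-- symmetrised collision integrand -/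
noncomputable def PP (g : ℝ → ℝ) (p : ℝ × ℝ) : ℝ :=
  (1/2) * ((p.1 + p.2) * g (p.1 + p.2) - p.1 * g p.1 - p.2 * g p.2)

structure Sys (N : ℝ → Measure ℝ) : Prop where
  fin : ∀ t, IsFiniteMeasure (N t)
  pos : ∀ t, N t (Iic 0) = 0
  weak : ∀ g, TF g → ∀ t ∈ Ico (0:ℝ) 1, HasDerivWithinAt (fun r => ∫ x, g x ∂(N r))
    (∫ p, PP g p ∂((N t).prod (N t))) (Ico 0 1) t

noncomputable def mm (N : ℝ → Measure ℝ) (t : ℝ) : ℝ := (N t).real univ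

lemma mm_nonneg (N : ℝ → Measure ℝ) (t : ℝ) : 0 ≤ mm N t := measureReal_nonneg

def RD (g : ℝ → ℝ) : Prop :=
  ContDiff ℝ (⊤ : ℕ∞) g ∧ ∀ k : ℕ, ∃ C, ∀ x > 0, |x ^ k * g x| ≤ C

lemma RD.smul {g : ℝ → ℝ} (h : RD g) (c : ℝ) : RD (fun x => c * g x) := by
  refine ⟨contDiff_const.mul h.1, fun k => ?_⟩
  obtain ⟨C, hC⟩ := h.2 k
  refine ⟨|c| * C, fun x hx => ?_⟩
  rw [mul_left_comm, abs_mul]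
  exact mul_le_mul_of_nonneg_left (hC x hx) (abs_nonneg _)

lemma RD.mulx {g : ℝ → ℝ} (h : RD g) : RD (fun x => x * g x) := by
  refine ⟨contDiff_id.mul h.1, fun k => ?_⟩
  obtain ⟨C, hC⟩ := h.2 (k+1)
  refine ⟨C, fun x hx => ?_⟩
  have := hC x hx
  rwa [pow_succ, mul_assoc] at this

lemma RD.mul_bdd {g f : ℝ → ℝ} (h : RD g) (hf : ContDiff ℝ (⊤ : ℕ∞) f) {B : ℝ} (hB : ∀ x > 0, |f x| ≤ B) :
    RD (fun x => f x * g x) := by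
  refine ⟨hf.mul h.1, fun k => ?_⟩
  obtain ⟨C, hC⟩ := h.2 k
  refine ⟨B * C, fun x hx => ?_⟩
  rw [mul_left_comm, abs_mul]
  exact mul_le_mul (hB x hx) (hC x hx) (abs_nonneg _) ((abs_nonneg _).trans (hB x hx))

lemma contDiff_expneg (a : ℝ) : ContDiff ℝ (⊤ : ℕ∞) (fun x : ℝ => Real.exp (-a * x)) :=
  Real.contDiff_exp.comp (contDiff_const.mul contDiff_id)

lemma expneg_abs_le {a x : ℝ} (ha : 0 ≤ a) (hx : 0 < x) : |Real.exp (-a * x)| ≤ 1 := by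
  rw [Real.abs_exp, Real.exp_le_one_iff]; nlinarith

lemma RD.expmul {g : ℝ → ℝ} (h : RD g) {a : ℝ} (ha : 0 ≤ a) : RD (fun x => Real.exp (-a * x) * g x) :=
  h.mul_bdd (contDiff_expneg a) (B := 1) (fun x hx => expneg_abs_le ha hx)

lemma TF.RD {g : ℝ → ℝ} (h : TF g) : RD g := by
  refine ⟨h.1, fun k => ?_⟩
  obtain ⟨a, R, C, ha, hR, hC0, hC, hl, hr⟩ := h.bdd
  refine ⟨R ^ k * C, fun x hx => ?_⟩
  by_cases hxR : x ≤ R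
  · rw [abs_mul, abs_of_pos (pow_pos hx k)]
    exact mul_le_mul (pow_le_pow_left₀ hx.le hxR k) (hC x) (abs_nonneg _) (by positivity)
  · rw [hr x (by linarith)]; simp; positivity

lemma RD_exp {η : ℝ} (hη : 0 < η) : RD (fun x => Real.exp (-η * x)) := by
  refine ⟨contDiff_expneg η, fun k => ?_⟩
  refine ⟨k.factorial / η ^ k, fun x hx => ?_⟩
  have h1 := Real.pow_div_factorial_le_exp (η * x) (by positivity) k
  beta_reduce
  rw [abs_of_pos (by positivity), neg_mul, Real.exp_neg]
  rw [div_le_iff₀ (by positivity), mul_pow] at h1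
  rw [mul_inv_le_iff₀ (Real.exp_pos _), div_mul_eq_mul_div, le_div_iff₀ (by positivity)]
  nlinarith

/-- smooth cutoff at large x -/
noncomputable def chi (R x : ℝ) : ℝ := Real.smoothTransition (R + 1 - x)
/-- smooth cutoff at small x -/
noncomputable def rho (k x : ℝ) : ℝ := Real.smoothTransition (k * x - 1)

noncomputable def kap (k x : ℝ) : ℝ := rho k x * chi k x

lemma chi_smooth (R : ℝ) : ContDiff ℝ (⊤ : ℕ∞) (chi R) :=
  Real.smoothTransition.contDiff.comp (contDiff_const.sub contDiff_id)
lemma rho_smooth (R : ℝ) : ContDiff ℝ (⊤ : ℕ∞) (rho R) :=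
  Real.smoothTransition.contDiff.comp ((contDiff_const.mul contDiff_id).sub contDiff_const)
lemma kap_smooth (R : ℝ) : ContDiff ℝ (⊤ : ℕ∞) (kap R) := (rho_smooth R).mul (chi_smooth R)
lemma chi_nonneg (R x : ℝ) : 0 ≤ chi R x := Real.smoothTransition.nonneg _
lemma chi_le (R x : ℝ) : chi R x ≤ 1 := Real.smoothTransition.le_one _
lemma rho_nonneg (R x : ℝ) : 0 ≤ rho R x := Real.smoothTransition.nonneg _
lemma rho_le (R x : ℝ) : rho R x ≤ 1 := Real.smoothTransition.le_one _
lemma kap_nonneg (R x : ℝ) : 0 ≤ kap R x := mul_nonneg (rho_nonneg _ _) (chi_nonneg _ _)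
lemma kap_le (R x : ℝ) : kap R x ≤ 1 := mul_le_one₀ (rho_le _ _) (chi_nonneg _ _) (chi_le _ _)
lemma chi_one {R x : ℝ} (h : x ≤ R) : chi R x = 1 := Real.smoothTransition.one_of_one_le (by linarith)
lemma chi_zero {R x : ℝ} (h : R + 1 ≤ x) : chi R x = 0 := Real.smoothTransition.zero_of_nonpos (by linarith)
lemma rho_one {k x : ℝ} (h : 2 ≤ k * x) : rho k x = 1 := Real.smoothTransition.one_of_one_le (by linarith)
lemma rho_zero {k x : ℝ} (h : k * x ≤ 1) : rho k x = 0 := Real.smoothTransition.zero_of_nonpos (by linarith)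
lemma chi_anti (R : ℝ) : Antitone (chi R) := fun x y h => Real.smoothTransition.monotone (by linarith)
lemma kap_one {k x : ℝ} (h : 2 ≤ k * x) (h2 : x ≤ k) : kap k x = 1 := by
  rw [kap, rho_one h, chi_one h2, one_mul]

lemma TF_of_kap {g : ℝ → ℝ} (hg : ContDiff ℝ (⊤ : ℕ∞) g) {k : ℝ} (hk : 0 < k) : TF (fun x => kap k x * g x) := by
  have hs : tsupport (fun x => kap k x * g x) ⊆ Icc (1/k) (k+1) := by
    apply closure_minimal _ isClosed_Icc
    intro x hx
    have hne : kap k x ≠ 0 := fun h => hx (by simp [h])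
    constructor
    · by_contra hcon
      push Not at hcon
      apply hne
      rw [kap, rho_zero, zero_mul]
      rw [lt_div_iff₀ hk] at hcon
      linarith
    · by_contra hcon
      apply hne
      rw [kap, chi_zero (by linarith), mul_zero]
  refine ⟨(kap_smooth k).mul hg, ?_, ?_⟩
  · exact HasCompactSupport.of_support_subset_isCompact isCompact_Icc ((subset_tsupport _).trans hs)
  · exact hs.trans fun x hx => lt_of_lt_of_le (by positivity) hx.1

lemma chi_RD (R : ℝ) : RD (chi R) := by
  refine ⟨chi_smooth R, fun k => ?_⟩
  refine ⟨|R+1| ^ k, fun x hx => ?_⟩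
  by_cases hxR : x ≤ R + 1
  · rw [abs_mul, abs_of_pos (pow_pos hx k), abs_of_nonneg (chi_nonneg _ _)]
    have := pow_le_pow_left₀ hx.le (hxR.trans (le_abs_self _)) k
    have h2 := chi_le R x
    have h3 := pow_pos hx k
    nlinarith
  · rw [chi_zero (by linarith)]; simp

lemma kap_tendsto {x : ℝ} (hx : 0 < x) : Tendsto (fun k : ℕ => kap (k:ℝ) x) atTop (𝓝 1) := by
  apply tendsto_const_nhds.congr'
  filter_upwards [tendsto_natCast_atTop_atTop.eventually_ge_atTop (x:ℝ),
    tendsto_natCast_atTop_atTop.eventually_ge_atTop (2/x)] with k h1 h2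
  rw [kap_one _ h1]
  rwa [div_le_iff₀ hx] at h2

lemma chi_tendsto (x : ℝ) : Tendsto (fun k : ℕ => chi (k:ℝ) x) atTop (𝓝 1) := by
  apply tendsto_const_nhds.congr'
  filter_upwards [tendsto_natCast_atTop_atTop.eventually_ge_atTop (x:ℝ)] with k h1
  rw [chi_one h1]

set_option linter.unusedSectionVars false
set_option linter.unusedVariables false
section basic
variable {μ : Measure ℝ} [IsFiniteMeasure μ] (h0 : μ (Iic 0) = 0)
include h0

lemma int_of_bdd {g : ℝ → ℝ} (hg : Continuous g) {C : ℝ} (hC : ∀ x > 0, |g x| ≤ C) : Integrable g μ := by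
  refine Integrable.mono' (g := fun _ => C) (integrable_const _) hg.aestronglyMeasurable ?_
  filter_upwards [ae_pos_of h0] with x hx
  exact hC x hx

lemma RD.int {g : ℝ → ℝ} (h : RD g) : Integrable g μ := by
  obtain ⟨C, hC⟩ := h.2 0
  exact int_of_bdd h0 h.1.continuous (C := C) (by simpa using hC)

lemma ae_prod_pos : ∀ᵐ p ∂(μ.prod μ), 0 < p.1 ∧ 0 < p.2 := by
  have h1 := Measure.quasiMeasurePreserving_fst (μ := μ) (ν := μ) |>.ae (ae_pos_of h0)
  have h2 := Measure.quasiMeasurePreserving_snd (μ := μ) (ν := μ) |>.ae (ae_pos_of h0)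
  filter_upwards [h1, h2] with p a b
  exact ⟨a, b⟩

lemma int2_of_bdd {g : ℝ × ℝ → ℝ} (hg : Continuous g) {C : ℝ} (hC : ∀ x > 0, ∀ y > 0, |g (x, y)| ≤ C) :
    Integrable g (μ.prod μ) := by
  refine Integrable.mono' (g := fun _ => C) (integrable_const _) hg.aestronglyMeasurable ?_
  filter_upwards [ae_prod_pos h0] with p hp
  exact hC p.1 hp.1 p.2 hp.2

lemma abs_int_le {g : ℝ → ℝ} {C : ℝ} (hC : ∀ x > 0, |g x| ≤ C) : |∫ x, g x ∂μ| ≤ C * μ.real univ := by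
  rw [← Real.norm_eq_abs]
  apply norm_integral_le_of_norm_le_const
  filter_upwards [ae_pos_of h0] with x hx
  exact hC x hx

lemma abs_int2_le {g : ℝ × ℝ → ℝ} {C : ℝ} (hC : ∀ x > 0, ∀ y > 0, |g (x, y)| ≤ C) :
    |∫ p, g p ∂(μ.prod μ)| ≤ C * (μ.real univ) ^ 2 := by
  have : (μ.prod μ).real univ = (μ.real univ)^2 := by
    rw [← univ_prod_univ, measureReal_prod_prod, sq]
  rw [← this]
  rw [← Real.norm_eq_abs]
  apply norm_integral_le_of_norm_le_const
  filter_upwards [ae_prod_pos h0] with p hp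
  exact hC p.1 hp.1 p.2 hp.2

lemma PP_int {g : ℝ → ℝ} (h : RD g) : Integrable (PP g) (μ.prod μ) := by
  obtain ⟨C, hC⟩ := h.2 1
  have hc := h.1.continuous
  refine int2_of_bdd h0 (by unfold PP; fun_prop) (C := (3/2) * C) ?_
  intro x hx y hy
  have h1 := hC (x+y) (by linarith)
  have h2 := hC x hx
  have h3 := hC y hy
  simp only [pow_one] at h1 h2 h3
  simp only [PP]
  rw [abs_le] at *
  constructor <;> linarith [h1.1, h1.2, h2.1, h2.2, h3.1, h3.2]

lemma kap_lim {g : ℝ → ℝ} (h : RD g) :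
    Tendsto (fun k : ℕ => ∫ x, kap k x * g x ∂μ) atTop (𝓝 (∫ x, g x ∂μ)) := by
  refine tendsto_integral_of_dominated_convergence (fun x => |g x|) ?_ (h.int h0).norm ?_ ?_
  · intro k; exact ((kap_smooth k).continuous.mul h.1.continuous).aestronglyMeasurable
  · intro k
    refine Eventually.of_forall fun x => ?_
    rw [norm_mul, Real.norm_eq_abs, Real.norm_eq_abs, abs_of_nonneg (kap_nonneg _ _)]
    exact mul_le_of_le_one_left (abs_nonneg _) (kap_le _ _)
  · filter_upwards [ae_pos_of h0] with x hx
    simpa using (kap_tendsto hx).mul_const (g x)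

lemma kap_lim1 : Tendsto (fun k : ℕ => ∫ x, kap k x ∂μ) atTop (𝓝 (μ.real univ)) := by
  have : μ.real univ = ∫ x, (1:ℝ) ∂μ := by simp
  rw [this]
  refine tendsto_integral_of_dominated_convergence (fun x => 1) ?_ (integrable_const _) ?_ ?_
  · intro k; exact ((kap_smooth k).continuous).aestronglyMeasurable
  · intro k
    refine Eventually.of_forall fun x => ?_
    rw [Real.norm_eq_abs, abs_of_nonneg (kap_nonneg _ _)]
    exact (kap_le _ _)
  · filter_upwards [ae_pos_of h0] with x hx
    exact (kap_tendsto hx)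

lemma chi_lim1 : Tendsto (fun k : ℕ => ∫ x, chi k x ∂μ) atTop (𝓝 (μ.real univ)) := by
  have : μ.real univ = ∫ x, (1:ℝ) ∂μ := by simp
  rw [this]
  refine tendsto_integral_of_dominated_convergence (fun x => 1) ?_ (integrable_const _) ?_ ?_
  · intro k; exact ((chi_smooth k).continuous).aestronglyMeasurable
  · intro k
    refine Eventually.of_forall fun x => ?_
    rw [Real.norm_eq_abs, abs_of_nonneg (chi_nonneg _ _)]
    exact (chi_le _ _)
  · exact Eventually.of_forall fun x => chi_tendsto x

lemma int_le_mass {g : ℝ → ℝ} (hg : Continuous g) (h1 : ∀ x > 0, |g x| ≤ 1) : ∫ x, g x ∂μ ≤ μ.real univ := by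
  have := abs_int_le h0 h1
  rw [one_mul] at this
  exact (le_abs_self _).trans this

end basic

/-- uniform limits of derivatives within a convex set -/
lemma hasDeriv_UL {S : Set ℝ} (hS : Convex ℝ S) {f : ℕ → ℝ → ℝ} {f' : ℕ → ℝ → ℝ} {F F' : ℝ → ℝ} {e : ℕ → ℝ}
    (hf : ∀ k, ∀ t ∈ S, HasDerivWithinAt (f k) (f' k t) S t)
    (hF : ∀ t ∈ S, Tendsto (fun k => f k t) atTop (𝓝 (F t)))
    (he : Tendsto e atTop (𝓝 0)) (hd : ∀ k, ∀ t ∈ S, |f' k t - F' t| ≤ e k) :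
    ∀ t ∈ S, HasDerivWithinAt F (F' t) S t := by
  intro t ht
  have key : ∀ k, ∀ r ∈ S, |(F r - f k r) - (F t - f k t)| ≤ (e k) * |r - t| := by
    intro k r hr
    have h1 : ∀ j, |(f j r - f k r) - (f j t - f k t)| ≤ (e j + e k) * |r - t| := by
      intro j
      refine Convex.norm_image_sub_le_of_norm_hasDerivWithin_le (f := fun x => f j x - f k x)
        (f' := fun x => f' j x - f' k x) (s := S) (fun x hx => (hf j x hx).sub (hf k x hx)) ?_ hS ht hr
      intro x hx
      have a := hd j x hx
      have b := hd k x hx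
      rw [Real.norm_eq_abs]
      rw [abs_le] at *
      constructor <;> linarith [a.1, a.2, b.1, b.2]
    have h2 : Tendsto (fun j => |(f j r - f k r) - (f j t - f k t)|) atTop (𝓝 |(F r - f k r) - (F t - f k t)|) :=
      ((((hF r hr).sub_const _).sub ((hF t ht).sub_const _))).abs
    have h3 : Tendsto (fun j => (e j + e k) * |r - t|) atTop (𝓝 ((0 + e k) * |r-t|)) :=
      (he.add_const _).mul_const _
    rw [zero_add] at h3
    exact le_of_tendsto_of_tendsto' h2 h3 h1
  rw [hasDerivWithinAt_iff_isLittleO, Asymptotics.isLittleO_iff]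
  intro c hc
  obtain ⟨k, hk⟩ := (he.eventually (gt_mem_nhds (show 0 < c/3 by positivity))).exists
  have h4 := (hasDerivWithinAt_iff_isLittleO.1 (hf k t ht))
  rw [Asymptotics.isLittleO_iff] at h4
  filter_upwards [h4 (show 0 < c/3 by positivity), self_mem_nhdsWithin] with r hr hrS
  have a := key k r hrS
  have b := hd k t ht
  simp only [smul_eq_mul, Real.norm_eq_abs] at *
  have e1 : F r - F t - (r - t) * F' t = ((F r - f k r) - (F t - f k t)) + (f k r - f k t - (r - t) * f' k t)
    + (r - t) * (f' k t - F' t) := by ring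
  rw [e1]
  refine (abs_add_three _ _ _).trans ?_
  rw [abs_mul (r - t)]
  have := abs_nonneg (r - t)
  nlinarith

section
variable {N : ℝ → Measure ℝ} (hN : Sys N)
include hN

lemma TF_cont {g : ℝ → ℝ} (hg : TF g) {t : ℝ} (ht : t ∈ Ico (0:ℝ) 1) :
    ContinuousWithinAt (fun r => ∫ x, g x ∂(N r)) (Ico 0 1) t :=
  (hN.weak g hg t ht).continuousWithinAt

lemma lemE {S : Set ℝ} (hS : Convex ℝ S) (hSI : S ⊆ Ico 0 1) {K : ℝ} (hK : ∀ t ∈ S, mm N t ≤ K)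
    {g : ℝ → ℝ} (hg : RD g) :
    ∀ t ∈ S, HasDerivWithinAt (fun r => ∫ x, g x ∂(N r)) (∫ p, PP g p ∂((N t).prod (N t))) S t := by
  have := hN.fin
  obtain ⟨C0, hC0⟩ := hg.2 0
  obtain ⟨C2, hC2⟩ := hg.2 2
  let C := |C0| + |C2|
  have hkg : ∀ k : ℕ, 0 < k → ∀ x > 0, |x * ((1 - kap k x) * g x)| ≤ 2 * C / k := by
    intro k hk x hx
    have hk' : (0:ℝ) < k := by exact_mod_cast hk
    have b1 : |1 - kap k x| ≤ 1 := by
      rw [abs_le]; constructor <;> linarith [kap_nonneg k x, kap_le k x]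
    have c0 := hC0 x hx
    have c2 := hC2 x hx
    rw [pow_zero, one_mul] at c0
    rw [abs_mul, abs_of_pos (by positivity)] at c2
    rw [abs_mul, abs_mul, abs_of_pos hx, le_div_iff₀ hk']
    have a0 := le_abs_self C0
    have a2 := le_abs_self C2
    have n0 := abs_nonneg C0
    have n2 := abs_nonneg C2
    have ng := abs_nonneg (g x)
    have nk := abs_nonneg (1 - kap k x)
    have hle : |1 - kap k x| * |g x| ≤ |g x| := mul_le_of_le_one_left ng b1
    by_cases h1 : 2 ≤ k * x
    · by_cases h2 : x ≤ k
      · rw [kap_one h1 h2]; simp; positivity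
      · push Not at h2
        calc x * (|1 - kap k x| * |g x|) * k ≤ x * |g x| * x := by gcongr
          _ = x^2 * |g x| := by ring
          _ ≤ 2 * C := by simp only [C]; linarith
    · push Not at h1
      calc x * (|1 - kap k x| * |g x|) * k ≤ x * |g x| * k := by gcongr
        _ = (k * x) * |g x| := by ring
        _ ≤ 2 * |g x| := by gcongr
        _ ≤ 2 * C := by simp only [C]; linarith
  let e : ℕ → ℝ := fun k => (3/2) * (2 * C / ((k+1 : ℕ) : ℝ)) * (|K|)^2
  refine hasDeriv_UL hS (f := fun k r => ∫ x, kap ((k+1 : ℕ) : ℝ) x * g x ∂(N r))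
    (f' := fun k t => ∫ p, PP (fun x => kap ((k+1:ℕ):ℝ) x * g x) p ∂((N t).prod (N t))) (e := e) ?_ ?_ ?_ ?_
  · intro k t ht
    exact (hN.weak _ (TF_of_kap hg.1 (by positivity)) t (hSI ht)).mono hSI
  · intro t ht
    exact (tendsto_add_atTop_iff_nat 1).2 (kap_lim (hN.pos t) hg)
  · have h1 : Tendsto (fun k : ℕ => 2 * C / ((k : ℕ) : ℝ)) atTop (𝓝 0) := tendsto_const_div_atTop_nhds_zero_nat _
    have h2 := (tendsto_add_atTop_iff_nat 1).2 h1
    have h3 := (h2.const_mul (3/2)).mul_const (|K|^2)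
    simpa [e] using h3
  · intro k t ht
    have hk := hkg (k+1) (Nat.succ_pos k)
    have i1 := PP_int (hN.pos t) (TF_of_kap hg.1 (show (0:ℝ) < ((k+1:ℕ):ℝ) by positivity)).RD
    have i2 := PP_int (hN.pos t) hg
    rw [← integral_sub i1 i2]
    have hmm : (mm N t)^2 ≤ |K|^2 := by
      apply pow_le_pow_left₀ (mm_nonneg _ _) ((hK t ht).trans (le_abs_self _))
    have hCC : 0 ≤ (3/2) * (2 * C / ((k+1 : ℕ) : ℝ)) := by positivity
    refine (abs_int2_le (hN.pos t) (C := (3/2) * (2 * C / ((k+1 : ℕ) : ℝ))) ?_).trans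
      (mul_le_mul_of_nonneg_left hmm hCC)
    intro x hx y hy
    have a1 := hk x hx
    have a2 := hk y hy
    have a3 := hk (x+y) (by linarith)
    simp only [PP]
    rw [abs_le] at *
    constructor <;> linarith [a1.1, a2.1, a3.1, a1.2, a2.2, a3.2]

end

open MeasureTheory Set Filter Topology

lemma RD.bdd012 {g : ℝ → ℝ} (h : RD g) : ∃ C, 0 ≤ C ∧ ∀ x > 0, |g x| ≤ C ∧ |x * g x| ≤ C ∧ |x^2 * g x| ≤ C := by
  obtain ⟨C0, hC0⟩ := h.2 0
  obtain ⟨C1, hC1⟩ := h.2 1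
  obtain ⟨C2, hC2⟩ := h.2 2
  refine ⟨|C0| + |C1| + |C2|, by positivity, fun x hx => ?_⟩
  have a := hC0 x hx
  have b := hC1 x hx
  have c := hC2 x hx
  simp only [pow_zero, one_mul, pow_one] at a b
  have n0 := abs_nonneg C0
  have n1 := abs_nonneg C1
  have n2 := abs_nonneg C2
  have l0 := le_abs_self C0
  have l1 := le_abs_self C1
  have l2 := le_abs_self C2
  refine ⟨by linarith, by linarith, by linarith⟩

lemma exp_diff1 {u v : ℝ} (hu : u ≤ 0) (hv : v ≤ 0) : |Real.exp u - Real.exp v| ≤ |u - v| := by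
  have h := Convex.norm_image_sub_le_of_norm_hasDerivWithin_le (f := Real.exp) (f' := Real.exp) (s := Iic 0) (C := 1)
    (fun x _ => (Real.hasDerivAt_exp x).hasDerivWithinAt) (fun x hx => by
      rw [Real.norm_eq_abs, Real.abs_exp, Real.exp_le_one_iff]; exact hx) (convex_Iic 0) hv hu
  simpa using h

lemma exp_diff2 {u v : ℝ} (hu : u ≤ 0) (hv : v ≤ 0) :
    |Real.exp u - Real.exp v - (u - v) * Real.exp v| ≤ |u - v|^2 := by
  -- derivative of exp w - w exp v is exp w - exp v
  have h := Convex.norm_image_sub_le_of_norm_hasDerivWithin_le (f := fun w => Real.exp w - w * Real.exp v)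
    (f' := fun w => Real.exp w - 1 * Real.exp v) (s := uIcc v u) (C := |u - v|)
    (fun x _ => ((Real.hasDerivAt_exp x).sub ((hasDerivAt_id x).mul_const _)).hasDerivWithinAt) (fun x hx => by
      have hx0 : x ≤ 0 := by
        rcases Set.mem_uIcc.1 hx with h | h <;> linarith [h.1, h.2]
      rw [Real.norm_eq_abs, one_mul]
      refine (exp_diff1 hx0 hv).trans ?_
      exact Set.abs_sub_left_of_mem_uIcc hx) (convex_uIcc v u) left_mem_uIcc right_mem_uIcc
  simp only [Real.norm_eq_abs] at h
  have e : Real.exp u - Real.exp v - (u - v) * Real.exp v = Real.exp u - u * Real.exp v - (Real.exp v - v * Real.exp v) := by ring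
  rw [e, sq]; exact h

set_option linter.unusedSectionVars false
section
variable {N : ℝ → Measure ℝ} (hN : Sys N)
include hN

lemma lemPR {S : Set ℝ} {s K : ℝ} (hK : ∀ t ∈ S, mm N t ≤ K) (hs : s ∈ S) {θ : ℝ → ℝ} {θ' : ℝ}
    (hθ : ∀ t ∈ S, 0 ≤ θ t) (hd : HasDerivWithinAt θ θ' S s) {φ : ℝ → ℝ} (hφ : RD φ) {d : ℝ}
    (hF : HasDerivWithinAt (fun r => ∫ x, Real.exp (-θ s * x) * φ x ∂(N r)) d S s)
    (hH : ContinuousWithinAt (fun r => ∫ x, x * (Real.exp (-θ s * x) * φ x) ∂(N r)) S s) :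
    HasDerivWithinAt (fun r => ∫ x, Real.exp (-θ r * x) * φ x ∂(N r))
      (d - θ' * ∫ x, x * (Real.exp (-θ s * x) * φ x) ∂(N s)) S s := by
  have := hN.fin
  obtain ⟨C, hC0, hC⟩ := hφ.bdd012
  set F := fun r => ∫ x, Real.exp (-θ s * x) * φ x ∂(N r) with hFd
  set H := fun r => ∫ x, x * (Real.exp (-θ s * x) * φ x) ∂(N r) with hHd
  have hrem : ∀ r ∈ S, |(∫ x, Real.exp (-θ r * x) * φ x ∂(N r)) - F r + (θ r - θ s) * H r|
      ≤ |θ r - θ s|^2 * (C * |K|) := by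
    intro r hr
    have i1 := (hφ.expmul (hθ r hr)).int (hN.pos r)
    have i2 := (hφ.expmul (hθ s hs)).int (hN.pos r)
    have i3 := (hφ.expmul (hθ s hs)).mulx.int (hN.pos r)
    simp only [hFd, hHd]
    have i12 : Integrable (fun x => Real.exp (-θ r * x) * φ x - Real.exp (-θ s * x) * φ x) (N r) := i1.sub i2
    rw [← integral_const_mul, ← integral_sub i1 i2, ← integral_add i12 (i3.const_mul _)]
    refine (abs_int_le (hN.pos r) (C := |θ r - θ s|^2 * C) ?_).trans ?_
    · intro x hx
      have e : Real.exp (-θ r * x) * φ x - Real.exp (-θ s * x) * φ x + (θ r - θ s) * (x * (Real.exp (-θ s * x) * φ x))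
        = (Real.exp (-θ r * x) - Real.exp (-θ s * x) - (-θ r * x - -θ s * x) * Real.exp (-θ s * x)) * φ x := by ring
      have h1 := exp_diff2 (u := -θ r * x) (v := -θ s * x) (by nlinarith [hθ r hr]) (by nlinarith [hθ s hs])
      have e2 : |-θ r * x - -θ s * x| = |θ r - θ s| * x := by
        rw [← abs_of_pos hx, ← abs_mul, ← abs_neg, abs_of_pos hx]; congr 1; ring
      rw [e2] at h1
      rw [e, abs_mul]
      have h2 := (hC x hx).2.2
      rw [abs_mul, abs_of_pos (by positivity)] at h2
      calc _ ≤ (|θ r - θ s| * x)^2 * |φ x| := by gcongr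
        _ = |θ r - θ s|^2 * (x^2 * |φ x|) := by ring
        _ ≤ _ := by gcongr
    · rw [mul_assoc]
      have := (hK r hr).trans (le_abs_self K)
      unfold mm at this
      gcongr
  have hmain : HasDerivWithinAt (fun r => F r - (θ r - θ s) * H r) (d - θ' * H s) S s := by
    refine hF.sub ?_
    have hd0 : HasDerivWithinAt (fun r => (θ r - θ s)) θ' S s := hd.sub_const _
    rw [hasDerivWithinAt_iff_tendsto_slope] at hd0 ⊢
    have : Tendsto (fun r => slope (fun r => (θ r - θ s)) s r * H r) (𝓝[S \ {s}] s) (𝓝 (θ' * H s)) :=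
      hd0.mul (hH.mono_left (nhdsWithin_mono _ sdiff_subset))
    refine this.congr fun r => ?_
    simp only [slope, vsub_eq_sub, smul_eq_mul, sub_self, zero_mul, sub_zero]
    ring
  have hr0 : HasDerivWithinAt (fun r => (∫ x, Real.exp (-θ r * x) * φ x ∂(N r)) - F r + (θ r - θ s) * H r) 0 S s := by
    rw [hasDerivWithinAt_iff_isLittleO]
    have h1 : (fun r => θ r - θ s) =O[𝓝[S] s] (fun r => r - s) := by
      have := hd.hasFDerivWithinAt.isBigO_sub
      exact this
    have h2 : (fun r => (θ r - θ s)) =o[𝓝[S] s] (fun r => (1:ℝ)) := by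
      rw [Asymptotics.isLittleO_one_iff]
      have := hd.continuousWithinAt.tendsto.sub_const (θ s)
      simpa using this
    have h3 := (h2.mul_isBigO h1)
    refine Asymptotics.IsBigO.trans_isLittleO ?_ (h3.congr_right (fun r => by rw [one_mul]))
    refine Asymptotics.IsBigO.of_bound (C * |K|) ?_
    filter_upwards [self_mem_nhdsWithin] with r hr
    have := hrem r hr
    simp only [hFd, hHd, sub_self, zero_mul, add_zero, sub_zero, smul_zero] at this ⊢
    rw [Real.norm_eq_abs, Real.norm_eq_abs, abs_mul, ← sq]
    linarith
  have := hmain.add hr0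
  simp only [add_zero] at this
  refine this.congr_of_eventuallyEq ?_ ?_
  · refine Eventually.of_forall fun r => ?_
    simp only [Pi.add_apply]; ring
  · simp only [Pi.add_apply]; ring

lemma lemPRc {S : Set ℝ} {s K : ℝ} (hK : ∀ t ∈ S, mm N t ≤ K) (hs : s ∈ S) {θ : ℝ → ℝ}
    (hθ : ∀ t ∈ S, 0 ≤ θ t) (hd : ContinuousWithinAt θ S s) {φ : ℝ → ℝ} (hφ : RD φ)
    (hF : ContinuousWithinAt (fun r => ∫ x, Real.exp (-θ s * x) * φ x ∂(N r)) S s) :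
    ContinuousWithinAt (fun r => ∫ x, Real.exp (-θ r * x) * φ x ∂(N r)) S s := by
  have := hN.fin
  obtain ⟨C, hC0, hC⟩ := hφ.bdd012
  set F := fun r => ∫ x, Real.exp (-θ s * x) * φ x ∂(N r) with hFd
  have hrem : ∀ r ∈ S, |(∫ x, Real.exp (-θ r * x) * φ x ∂(N r)) - F r|
      ≤ |θ r - θ s| * (C * |K|) := by
    intro r hr
    have i1 := (hφ.expmul (hθ r hr)).int (hN.pos r)
    have i2 := (hφ.expmul (hθ s hs)).int (hN.pos r)
    simp only [hFd]
    rw [← integral_sub i1 i2]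
    refine (abs_int_le (hN.pos r) (C := |θ r - θ s| * C) ?_).trans ?_
    · intro x hx
      have h1 := exp_diff1 (u := -θ r * x) (v := -θ s * x) (by nlinarith [hθ r hr]) (by nlinarith [hθ s hs])
      have e2 : |-θ r * x - -θ s * x| = |θ r - θ s| * x := by
        rw [← abs_of_pos hx, ← abs_mul, ← abs_neg, abs_of_pos hx]; congr 1; ring
      rw [e2] at h1
      rw [← sub_mul, abs_mul]
      have h2 := (hC x hx).2.1
      rw [abs_mul, abs_of_pos (by positivity)] at h2
      calc _ ≤ (|θ r - θ s| * x) * |φ x| := by gcongr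
        _ = |θ r - θ s| * (x * |φ x|) := by ring
        _ ≤ _ := by gcongr
    · rw [mul_assoc]
      have := (hK r hr).trans (le_abs_self K)
      unfold mm at this
      gcongr
  have h0 : Tendsto (fun r => |θ r - θ s| * (C * |K|)) (𝓝[S] s) (𝓝 0) := by
    have : Tendsto (fun r => θ r - θ s) (𝓝[S] s) (𝓝 0) := by simpa using hd.tendsto.sub_const (θ s)
    simpa using this.abs.mul_const (C * |K|)
  have h1 : Tendsto (fun r => (∫ x, Real.exp (-θ r * x) * φ x ∂(N r)) - F r) (𝓝[S] s) (𝓝 0) := by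
    apply squeeze_zero_norm' _ h0
    filter_upwards [self_mem_nhdsWithin] with r hr
    exact hrem r hr
  have h2 := h1.add hF.tendsto
  simp only [sub_add_cancel, zero_add] at h2
  exact h2

lemma PP_split {g : ℝ → ℝ} (h : RD g) (t : ℝ) :
    ∫ p, PP g p ∂((N t).prod (N t)) = (∫ p : ℝ × ℝ, (1/2) * ((p.1 + p.2) * g (p.1 + p.2)) ∂((N t).prod (N t)))
      - mm N t * ∫ x, x * g x ∂(N t) := by
  have := hN.fin
  have hc := h.1.continuous
  obtain ⟨C, hC0, hC⟩ := h.bdd012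
  have ix := h.mulx.int (hN.pos t)
  have i1 : Integrable (fun p : ℝ × ℝ => (1/2) * ((p.1 + p.2) * g (p.1 + p.2))) ((N t).prod (N t)) := by
    refine int2_of_bdd (hN.pos t) (by fun_prop) (C := (1/2) * C) ?_
    intro x hx y hy
    rw [abs_mul, abs_of_pos (by norm_num : (0:ℝ) < 1/2)]
    have := (hC (x+y) (by linarith)).2.1
    simp only at this ⊢
    linarith
  have i2 : Integrable (fun p : ℝ × ℝ => p.1 * g p.1) ((N t).prod (N t)) := ix.comp_fst _
  have i3 : Integrable (fun p : ℝ × ℝ => p.2 * g p.2) ((N t).prod (N t)) := ix.comp_snd _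
  have e : ∀ p : ℝ × ℝ, PP g p = (1/2) * ((p.1 + p.2) * g (p.1 + p.2)) - (1/2) * (p.1 * g p.1) - (1/2) * (p.2 * g p.2) := by
    intro p; unfold PP; ring
  simp_rw [e]
  have i12 : Integrable (fun p : ℝ × ℝ => (1/2) * ((p.1 + p.2) * g (p.1 + p.2)) - (1/2) * (p.1 * g p.1)) ((N t).prod (N t)) :=
    i1.sub (i2.const_mul _)
  rw [integral_sub i12 (i3.const_mul _), integral_sub i1 (i2.const_mul _),
    integral_const_mul (1/2) (fun p : ℝ × ℝ => p.1 * g p.1), integral_const_mul (1/2) (fun p : ℝ × ℝ => p.2 * g p.2),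
    integral_fun_fst (fun x => x * g x), integral_fun_snd (fun x => x * g x)]
  simp only [smul_eq_mul, mm]
  ring

/-- L1 -/
lemma chi_antitone {S : Set ℝ} (hS : Convex ℝ S) (hSI : S ⊆ Ico 0 1) {K : ℝ} (hK : ∀ t ∈ S, mm N t ≤ K) (R : ℝ) :
    AntitoneOn (fun t => ∫ x, chi R x ∂(N t)) S := by
  have := hN.fin
  have hd := lemE hN hS hSI hK (chi_RD R)
  refine antitoneOn_of_hasDerivWithinAt_nonpos hS (fun t ht => (hd t ht).continuousWithinAt)
    (fun t ht => (hd t (interior_subset ht)).mono interior_subset) ?_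
  intro t ht
  apply integral_nonpos_of_ae
  filter_upwards [ae_prod_pos (hN.pos t)] with p hp
  simp only [PP, Pi.zero_apply]
  have h1 := chi_anti R (show p.1 ≤ p.1 + p.2 by linarith [hp.2])
  have h2 := chi_anti R (show p.2 ≤ p.1 + p.2 by linarith [hp.1])
  nlinarith [hp.1, hp.2]

lemma mm_antitone {S : Set ℝ} (hS : Convex ℝ S) (hSI : S ⊆ Ico 0 1) {K : ℝ} (hK : ∀ t ∈ S, mm N t ≤ K) :
    AntitoneOn (mm N) S := by
  have := hN.fin
  intro a ha b hb hab
  exact le_of_tendsto_of_tendsto' (chi_lim1 (hN.pos b)) (chi_lim1 (hN.pos a))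
    (fun k => chi_antitone hN hS hSI hK k ha hb hab)

lemma kap_TF' {k : ℕ} (hk : 0 < k) : TF (fun x => kap k x) := by
  have := TF_of_kap (g := fun _ => (1:ℝ)) contDiff_const (k := (k:ℝ)) (by exact_mod_cast hk)
  simpa using this

lemma kap_le_mm (k : ℕ) (t : ℝ) : ∫ x, kap k x ∂(N t) ≤ mm N t := by
  have := hN.fin
  exact int_le_mass (hN.pos t) (kap_smooth k).continuous (fun x _ => by
    rw [abs_of_nonneg (kap_nonneg _ _)]; exact kap_le _ _)

/-- lower semicontinuity -/
lemma mm_lsc {t : ℝ} (ht : t ∈ Ico (0:ℝ) 1) {c : ℝ} (hc : c < mm N t) : ∀ᶠ r in 𝓝[Ico 0 1] t, c < mm N r := by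
  have := hN.fin
  obtain ⟨k, hk, hk0⟩ := (((kap_lim1 (hN.pos t)).eventually (lt_mem_nhds hc)).and (eventually_gt_atTop 0)).exists
  have := (TF_cont hN (kap_TF' hN hk0) ht).eventually (lt_mem_nhds hk)
  filter_upwards [this] with r hr
  exact hr.trans_le (kap_le_mm hN k r)

end

open MeasureTheory Set Filter Topology

noncomputable def th (N : ℝ → Measure ℝ) (b s : ℝ) : ℝ := ∫ r in s..b, mm N r

noncomputable def psi (N : ℝ → Measure ℝ) (b : ℝ) (f : ℝ → ℝ) (s : ℝ) : ℝ :=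
  ∫ x, Real.exp (-(th N b s) * x) * f x ∂(N s)

set_option linter.unusedTactic false
set_option linter.unusedVariables false
set_option linter.unusedSectionVars false
section
variable {N : ℝ → Measure ℝ} (hN : Sys N) {a b : ℝ} (ha : 0 ≤ a) (hab : a < b) (hb : b < 1)
  (hloc : ∀ s ∈ Ioc a b, ∃ K, ∀ r ∈ Icc s b, mm N r ≤ K)
include hN ha hab hb hloc

lemma mm_anti_sb {s : ℝ} (hs : s ∈ Ioc a b) : AntitoneOn (mm N) (Icc s b) := by
  obtain ⟨K, hK⟩ := hloc s hs
  refine mm_antitone hN (convex_Icc s b) ?_ hK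
  intro r hr
  exact ⟨by linarith [hs.1, hr.1], by linarith [hr.2]⟩

lemma mm_bd_sb {s : ℝ} (hs : s ∈ Ioc a b) : ∀ r ∈ Icc s b, mm N r ≤ mm N s :=
  fun r hr => mm_anti_sb hN ha hab hb hloc hs ⟨le_rfl, hs.2⟩ hr hr.1

lemma sb_sub {s : ℝ} (hs : s ∈ Ioc a b) : Icc s b ⊆ Ico 0 1 := by
  intro r hr
  exact ⟨by linarith [hs.1, hr.1], by linarith [hr.2]⟩

lemma mm_ii {s : ℝ} (hs : s ∈ Ioc a b) : IntervalIntegrable (mm N) volume s b := by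
  apply AntitoneOn.intervalIntegrable
  rw [uIcc_of_le hs.2]
  exact mm_anti_sb hN ha hab hb hloc hs

lemma th_nonneg {s : ℝ} (hs : s ∈ Ioc a b) : 0 ≤ th N b s :=
  intervalIntegral.integral_nonneg hs.2 (fun u _ => mm_nonneg N u)

lemma th_anti {s s' : ℝ} (hs : s ∈ Ioc a b) (hs' : s' ∈ Ioc a b) (h : s ≤ s') : th N b s' ≤ th N b s := by
  have h1 := mm_ii hN ha hab hb hloc hs
  have h2 := mm_ii hN ha hab hb hloc hs'
  have h3 : IntervalIntegrable (mm N) volume s s' := h1.trans h2.symm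
  have := intervalIntegral.integral_add_adjacent_intervals h3 h2
  have h4 : 0 ≤ ∫ r in s..s', mm N r := intervalIntegral.integral_nonneg h (fun u _ => mm_nonneg N u)
  unfold th
  linarith

lemma th_cont {s : ℝ} (hs : s ∈ Ioc a b) : ContinuousOn (th N b) (Icc s b) := by
  have h := intervalIntegral.continuousOn_primitive_interval_left (f := mm N) (a := s) (b := b) (μ := volume) ?_
  · rw [uIcc_of_le hs.2] at h
    exact h
  · have := (mm_ii hN ha hab hb hloc hs)
    rw [intervalIntegrable_iff_integrableOn_Icc_of_le hs.2] at this
    rwa [uIcc_of_le hs.2]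

lemma mm_rc {s : ℝ} (hs : s ∈ Ioo a b) : ContinuousWithinAt (mm N) (Ioi s) s := by
  have hs' : s ∈ Ioc a b := ⟨hs.1, hs.2.le⟩
  have hsI : s ∈ Ico (0:ℝ) 1 := sb_sub hN ha hab hb hloc hs' ⟨le_rfl, hs.2.le⟩
  have hev : ∀ᶠ r in 𝓝[>] s, r ∈ Icc s b := by
    filter_upwards [Ioo_mem_nhdsGT hs.2] with r hr
    exact ⟨hr.1.le, hr.2.le⟩
  refine tendsto_order.2 ⟨fun c hc => ?_, fun c hc => ?_⟩
  · have h1 := mm_lsc hN hsI hc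
    have h2 : 𝓝[>] s ≤ 𝓝[Ico 0 1] s := by
      apply nhdsWithin_le_iff.2
      filter_upwards [hev] with r hr
      exact sb_sub hN ha hab hb hloc hs' hr
    exact h2 h1
  · filter_upwards [hev] with r hr
    exact lt_of_le_of_lt (mm_bd_sb hN ha hab hb hloc hs' r hr) hc

lemma th_deriv {s : ℝ} (hs : s ∈ Ioo a b) : HasDerivWithinAt (th N b) (-(mm N s)) (Ici s) s := by
  have hs' : s ∈ Ioc a b := ⟨hs.1, hs.2.le⟩
  refine intervalIntegral.integral_hasDerivWithinAt_left (t := Ioi s) (mm_ii hN ha hab hb hloc hs') ?_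
    (mm_rc hN ha hab hb hloc hs)
  refine ⟨Ioc s b, ?_, ?_⟩
  · exact Ioc_mem_nhdsGT hs.2
  · exact ((mm_ii hN ha hab hb hloc hs').1).aestronglyMeasurable

lemma psi_deriv {f : ℝ → ℝ} (hf : RD f) {s : ℝ} (hs : s ∈ Ioo a b) :
    HasDerivWithinAt (psi N b f) (∫ p : ℝ × ℝ, (1/2) * ((p.1 + p.2) * (Real.exp (-(th N b s) * (p.1 + p.2)) * f (p.1 + p.2)))
      ∂((N s).prod (N s))) (Ici s) s := by
  have hs' : s ∈ Ioc a b := ⟨hs.1, hs.2.le⟩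
  have hθ := th_nonneg hN ha hab hb hloc hs'
  have hK := mm_bd_sb hN ha hab hb hloc hs'
  have hsub := sb_sub hN ha hab hb hloc hs'
  have hmem : s ∈ Icc s b := ⟨le_rfl, hs.2.le⟩
  have h1 := lemE hN (convex_Icc s b) hsub hK (hf.expmul hθ) s hmem
  have h2 := (lemE hN (convex_Icc s b) hsub hK (hf.expmul hθ).mulx s hmem).continuousWithinAt
  have h3 := lemPR hN hK hmem (θ := th N b) (fun t ht => th_nonneg hN ha hab hb hloc ⟨by linarith [ht.1, hs.1], ht.2⟩)
    ((th_deriv hN ha hab hb hloc hs).mono Icc_subset_Ici_self) hf h1 h2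
  have h4 := HasDerivWithinAt.mono_of_mem_nhdsWithin (s := Ici s) h3 (Icc_mem_nhdsGE hs.2)
  rw [PP_split hN (hf.expmul hθ)] at h4
  have h5 : HasDerivWithinAt (psi N b f) _ (Ici s) s := h4
  exact h5.congr_deriv (by ring)

lemma psi_cont {f : ℝ → ℝ} (hf : RD f) {s : ℝ} (hs : s ∈ Ioc a b) : ContinuousOn (psi N b f) (Icc s b) := by
  intro r hr
  have hr' : r ∈ Ioc a b := ⟨by linarith [hs.1, hr.1], hr.2⟩
  have hK := mm_bd_sb hN ha hab hb hloc hs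
  have hsub := sb_sub hN ha hab hb hloc hs
  refine lemPRc hN hK hr (θ := th N b) (fun t ht => th_nonneg hN ha hab hb hloc ⟨by linarith [ht.1, hs.1], ht.2⟩)
    (th_cont hN ha hab hb hloc hs r hr) hf ?_
  exact (lemE hN (convex_Icc s b) hsub hK (hf.expmul (th_nonneg hN ha hab hb hloc hr')) r hr).continuousWithinAt

lemma psi_b (f : ℝ → ℝ) : psi N b f b = ∫ x, f x ∂(N b) := by
  simp [psi, th]

lemma psi_le {f : ℝ → ℝ} (hf : RD f) (hf0 : ∀ x > 0, 0 ≤ f x) {s : ℝ} (hs : s ∈ Ioc a b) :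
    psi N b f s ≤ ∫ x, f x ∂(N b) := by
  rw [← psi_b hN ha hab hb hloc f]
  refine image_le_of_deriv_right_le_deriv_boundary (f := fun _ => psi N b f s) (f' := fun _ => 0) (a := s) (b := b)
    (B := psi N b f) continuousOn_const (fun x _ => hasDerivWithinAt_const _ _ _) le_rfl
    (psi_cont hN ha hab hb hloc hf hs) (fun x hx => psi_deriv hN ha hab hb hloc hf ⟨by linarith [hs.1, hx.1], hx.2⟩)
    ?_ ⟨hs.2, le_rfl⟩
  intro x hx
  have := hN.fin
  apply integral_nonneg_of_ae
  filter_upwards [ae_prod_pos (hN.pos x)] with p hp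
  have h := hf0 (p.1 + p.2) (by linarith [hp.1, hp.2])
  have h2 := Real.exp_pos (-(th N b x) * (p.1 + p.2))
  have := hp.1
  have := hp.2
  simp only [Pi.zero_apply]
  positivity

lemma L2case1 {Θ : ℝ} (hΘ : ∀ s ∈ Ioc a b, th N b s ≤ Θ) : mm N b ≤ mm N a := by
  have := hN.fin
  have haI : a ∈ Ico (0:ℝ) 1 := ⟨ha, by linarith⟩
  have hΘ0 : 0 ≤ Θ := (th_nonneg hN ha hab hb hloc ⟨hab, le_rfl⟩).trans (hΘ b ⟨hab, le_rfl⟩)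
  have key : ∀ k : ℕ, 0 < k → ∫ x, chi k x ∂(N b) ≤ mm N a + Real.exp (2 * Θ) * (∫ x, (chi k x - kap k x) ∂(N b)) := by
    intro k hk
    have hk1 : (1:ℝ) ≤ k := by exact_mod_cast hk
    have hlim : Tendsto (fun s => ∫ x, kap k x ∂(N s)) (𝓝[>] a) (𝓝 (∫ x, kap k x ∂(N a))) := by
      refine (TF_cont hN (kap_TF' hN hk) haI).mono_left (nhdsWithin_le_iff.2 ?_)
      filter_upwards [Ioo_mem_nhdsGT hab] with r hr
      exact ⟨by linarith [hr.1], by linarith [hr.2]⟩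
    have hRD : RD (fun x => chi k x - kap k x) := by
      have := (chi_RD k).mul_bdd (f := fun x => 1 - rho k x) (contDiff_const.sub (rho_smooth k)) (B := 1) ?_
      · convert this using 2
        simp only [kap]; ring
      · intro x _
        rw [abs_le]; constructor <;> linarith [rho_nonneg k x, rho_le k x]
    have hnn : ∀ x, 0 ≤ chi k x - kap k x := by
      intro x; unfold kap; nlinarith [rho_le k x, chi_nonneg k x]
    have hle : ∀ᶠ s in 𝓝[>] a, ∫ x, chi k x ∂(N b) ≤ ∫ x, kap k x ∂(N s) + Real.exp (2 * Θ) * (∫ x, (chi k x - kap k x) ∂(N b)) := by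
      filter_upwards [Ioo_mem_nhdsGT hab] with s hs
      have hs' : s ∈ Ioc a b := ⟨hs.1, hs.2.le⟩
      have h1 := chi_antitone hN (convex_Icc s b) (sb_sub hN ha hab hb hloc hs') (mm_bd_sb hN ha hab hb hloc hs') k
        ⟨le_rfl, hs.2.le⟩ ⟨hs.2.le, le_rfl⟩ hs.2.le
      have i1 := (chi_RD k).int (hN.pos s)
      have i2 := (kap_TF' hN hk).RD.int (hN.pos s)
      have h2 : ∫ x, chi k x ∂(N s) = ∫ x, kap k x ∂(N s) + ∫ x, (chi k x - kap k x) ∂(N s) := by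
        rw [integral_sub i1 i2]; ring
      have h3 : ∫ x, (chi k x - kap k x) ∂(N s) ≤ Real.exp (2 * Θ) * psi N b (fun x => chi k x - kap k x) s := by
        unfold psi
        rw [← integral_const_mul]
        refine integral_mono_ae (hRD.int (hN.pos s)) (((hRD.expmul (th_nonneg hN ha hab hb hloc hs')).int (hN.pos s)).const_mul _) ?_
        filter_upwards [ae_pos_of (hN.pos s)] with x hx
        beta_reduce
        by_cases h2x : 2 ≤ k * x
        · have : chi k x - kap k x = 0 := by rw [kap, rho_one h2x]; ring
          rw [this]; simp
        · push Not at h2x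
          rw [← mul_assoc, ← Real.exp_add]
          apply le_mul_of_one_le_left (hnn x)
          rw [Real.one_le_exp_iff]
          have t1 := hΘ s hs'
          have t2 := th_nonneg hN ha hab hb hloc hs'
          have : x ≤ 2 := by nlinarith
          nlinarith
      have h4 := psi_le hN ha hab hb hloc hRD (fun x _ => hnn x) hs'
      have h5 := mul_le_mul_of_nonneg_left h4 (Real.exp_pos (2 * Θ)).le
      simp only at h1
      linarith
    have := le_of_tendsto_of_tendsto tendsto_const_nhds (hlim.add_const _) hle
    linarith [kap_le_mm hN k a]
  have l1 := chi_lim1 (hN.pos b)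
  have l2 := kap_lim1 (hN.pos b)
  have l3 : Tendsto (fun k : ℕ => mm N a + Real.exp (2 * Θ) * (∫ x, (chi k x - kap k x) ∂(N b))) atTop (𝓝 (mm N a + Real.exp (2*Θ) * 0)) := by
    refine (Tendsto.const_mul _ ?_).const_add _
    have := l1.sub l2
    rw [sub_self] at this
    refine this.congr' ?_
    filter_upwards [eventually_gt_atTop 0] with k hk
    rw [integral_sub ((chi_RD k).int (hN.pos b)) ((kap_TF' hN hk).RD.int (hN.pos b))]
  have := le_of_tendsto_of_tendsto l1 l3 (by filter_upwards [eventually_gt_atTop 0] with k hk; exact key k hk)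
  rw [mul_zero, add_zero] at this
  exact this

lemma L2case2 (hΘ : ∀ Θ, ∃ s ∈ Ioc a b, Θ < th N b s) : mm N b ≤ mm N a := by
  have := hN.fin
  have haI : a ∈ Ico (0:ℝ) 1 := ⟨ha, by linarith⟩
  set ζ := 2 * (b - a) * mm N b + 1 with hζ
  have hmb := mm_nonneg N b
  have hζ0 : 0 < ζ := by nlinarith
  have hRe := RD_exp hζ0
  set G := ∫ x, Real.exp (-ζ * x) ∂(N b) with hG
  have hG0 : 0 ≤ G := integral_nonneg fun x => (Real.exp_pos _).le
  have hθt : Tendsto (th N b) (𝓝[>] a) atTop := by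
    rw [tendsto_atTop]
    intro Θ
    obtain ⟨s, hs, hs2⟩ := hΘ Θ
    filter_upwards [Ioo_mem_nhdsGT hs.1] with r hr
    exact hs2.le.trans (th_anti hN ha hab hb hloc ⟨hr.1, by linarith [hr.2, hs.2]⟩ hs hr.2.le)
  have key : ∀ k : ℕ, 0 < k → ∫ x, kap k x * Real.exp (-ζ * x) ∂(N b) ≤ G / 2 := by
    intro k hk
    have hk0 : (0:ℝ) < k := by exact_mod_cast hk
    set f := fun x => kap k x * Real.exp (-ζ * x) with hf
    have hTF : TF f := TF_of_kap hRe.1 hk0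
    have hf0 : ∀ x, 0 ≤ f x := fun x => mul_nonneg (kap_nonneg _ _) (Real.exp_pos _).le
    have hfle : ∀ x, f x ≤ Real.exp (-ζ * x) := fun x => mul_le_of_le_one_left (Real.exp_pos _).le (kap_le _ _)
    have hlim : Tendsto (fun s => ∫ x, f x ∂(N s)) (𝓝[>] a) (𝓝 (∫ x, f x ∂(N a))) := by
      refine (TF_cont hN hTF haI).mono_left (nhdsWithin_le_iff.2 ?_)
      filter_upwards [Ioo_mem_nhdsGT hab] with r hr
      exact ⟨by linarith [hr.1], by linarith [hr.2]⟩
    have hlim2 : Tendsto (fun s => Real.exp (-(th N b s / k)) * ∫ x, f x ∂(N s) + G/2) (𝓝[>] a) (𝓝 (0 * (∫ x, f x ∂(N a)) + G/2)) := by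
      refine (Tendsto.mul ?_ hlim).add_const _
      exact Real.tendsto_exp_neg_atTop_nhds_zero.comp (hθt.atTop_div_const hk0)
    rw [zero_mul, zero_add] at hlim2
    refine ge_of_tendsto hlim2 ?_
    filter_upwards [Ioo_mem_nhdsGT hab] with s hs
    have hs' : s ∈ Ioc a b := ⟨hs.1, hs.2.le⟩
    -- derivative bound
    have hder : ∀ r ∈ Ico s b, (∫ p : ℝ × ℝ, (1/2) * ((p.1 + p.2) * (Real.exp (-(th N b r) * (p.1 + p.2)) * f (p.1 + p.2)))
      ∂((N r).prod (N r))) ≤ G * (mm N b / ζ) := by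
      intro r hr
      have hr' : r ∈ Ioc a b := ⟨by linarith [hs.1, hr.1], hr.2.le⟩
      have hθr := th_nonneg hN ha hab hb hloc hr'
      set e := fun x => Real.exp (-(th N b r) * x) * Real.exp (-ζ * x) with he
      have he1 : RD e := hRe.expmul hθr
      have ie := he1.int (hN.pos r)
      have ixe := he1.mulx.int (hN.pos r)
      have p1 : (∫ x, e x ∂(N r)) ≤ G := psi_le hN ha hab hb hloc hRe (fun x _ => (Real.exp_pos _).le) hr'
      have p2 : (∫ x, x * e x ∂(N r)) ≤ mm N b / ζ := by
        have := psi_le hN ha hab hb hloc hRe.mulx (fun x hx => mul_nonneg hx.le (Real.exp_pos _).le) hr'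
        have e2 : psi N b (fun x => x * Real.exp (-ζ * x)) r = (∫ x, x * e x ∂(N r)) := by
          unfold psi; congr 1; ext x; simp only [he]; ring
        rw [e2] at this
        refine this.trans ?_
        have h3 : ∫ x, x * Real.exp (-ζ * x) ∂(N b) ≤ ∫ x, (1/ζ) ∂(N b) := by
          refine integral_mono_ae (hRe.mulx.int (hN.pos b)) (integrable_const _) ?_
          filter_upwards [ae_pos_of (hN.pos b)] with x hx
          have := Real.add_one_le_exp (ζ * x)
          beta_reduce
          rw [neg_mul, Real.exp_neg, mul_inv_le_iff₀ (Real.exp_pos _), div_mul_eq_mul_div, le_div_iff₀ hζ0]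
          nlinarith
        refine h3.trans (le_of_eq ?_)
        simp only [integral_const, smul_eq_mul, mm]; ring
      have n1 : 0 ≤ ∫ x, e x ∂(N r) := integral_nonneg fun x => by positivity
      have n2 : 0 ≤ ∫ x, x * e x ∂(N r) := by
        apply integral_nonneg_of_ae
        filter_upwards [ae_pos_of (hN.pos r)] with x hx
        simp only [Pi.zero_apply, he]; positivity
      have hprod : (∫ p : ℝ × ℝ, (1/2) * ((p.1 * e p.1) * e p.2 + e p.1 * (p.2 * e p.2)) ∂((N r).prod (N r)))
          = (∫ x, e x ∂(N r)) * (∫ x, x * e x ∂(N r)) := by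
        rw [integral_const_mul, integral_add (ixe.mul_prod ie) (ie.mul_prod ixe),
          integral_prod_mul (fun x => x * e x) e, integral_prod_mul e (fun x => x * e x)]
        ring
      refine le_trans (integral_mono_ae ?_ (((ixe.mul_prod ie).add (ie.mul_prod ixe)).const_mul (1/2)) ?_) (hprod.le.trans ?_)
      · obtain ⟨C, hC0, hC⟩ := (hTF.RD.expmul hθr).bdd012
        have hc := hTF.1.continuous
        refine int2_of_bdd (hN.pos r) (by fun_prop) (C := (1/2) * C) ?_
        intro x hx y hy
        rw [abs_mul, abs_of_pos (by norm_num : (0:ℝ) < 1/2)]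
        have := (hC (x+y) (by linarith)).2.1
        simp only at this ⊢
        linarith
      · filter_upwards [ae_prod_pos (hN.pos r)] with p hp
        have h1 := hfle (p.1 + p.2)
        have h2 : Real.exp (-(th N b r) * (p.1 + p.2)) * f (p.1 + p.2) ≤ e p.1 * e p.2 := by
          refine (mul_le_mul_of_nonneg_left h1 (Real.exp_pos _).le).trans (le_of_eq ?_)
          simp only [he, ← Real.exp_add]
          congr 1; ring
        have h3 : (0:ℝ) ≤ p.1 + p.2 := by linarith [hp.1, hp.2]
        have h4 := mul_le_mul_of_nonneg_left h2 h3
        simp only [Pi.add_apply]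
        linarith
      · exact mul_le_mul p1 p2 n2 hG0
    have hb1 : psi N b f b ≤ psi N b f s + G * (mm N b / ζ) * (b - s) := by
      refine image_le_of_deriv_right_le_deriv_boundary (f := psi N b f) (a := s) (b := b)
        (f' := fun r => ∫ p : ℝ × ℝ, (1/2) * ((p.1 + p.2) * (Real.exp (-(th N b r) * (p.1 + p.2)) * f (p.1 + p.2))) ∂((N r).prod (N r)))
        (B := fun r => psi N b f s + G * (mm N b / ζ) * (r - s)) (B' := fun r => G * (mm N b / ζ))
        (psi_cont hN ha hab hb hloc hTF.RD hs') (fun x hx => psi_deriv hN ha hab hb hloc hTF.RD ⟨by linarith [hs.1, hx.1], hx.2⟩) (by simp)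
        (by fun_prop) (fun x hx => ?_)
        hder ⟨hs.2.le, le_rfl⟩
      have := (((hasDerivAt_id x).sub_const s).const_mul (G * (mm N b / ζ))).const_add (psi N b f s)
      simp only [mul_one] at this
      exact this.hasDerivWithinAt
    rw [psi_b hN ha hab hb hloc] at hb1
    have hb2 : G * (mm N b / ζ) * (b - s) ≤ G / 2 := by
      have h1 : mm N b / ζ * (b - s) ≤ 1/2 := by
        rw [div_mul_eq_mul_div, div_le_iff₀ hζ0]
        nlinarith [hs.1, hs.2]
      nlinarith
    have hb3 : psi N b f s ≤ Real.exp (-(th N b s / k)) * ∫ x, f x ∂(N s) := by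
      unfold psi
      rw [← integral_const_mul]
      have hθs := th_nonneg hN ha hab hb hloc hs'
      refine integral_mono_ae ((hTF.RD.expmul hθs).int (hN.pos s)) ((hTF.RD.int (hN.pos s)).const_mul _) ?_
      filter_upwards [ae_pos_of (hN.pos s)] with x hx
      beta_reduce
      by_cases h1 : k * x ≤ 1
      · have : f x = 0 := by simp only [hf, kap, rho_zero h1, zero_mul]
        rw [this]; simp
      · push Not at h1
        apply mul_le_mul_of_nonneg_right _ (hf0 x)
        rw [Real.exp_le_exp, neg_mul, neg_le_neg_iff, div_le_iff₀ hk0]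
        nlinarith
    linarith
  have hl := kap_lim (hN.pos b) hRe
  have : G ≤ G/2 := le_of_tendsto hl (by filter_upwards [eventually_gt_atTop 0] with k hk; exact key k hk)
  have hGz : G = 0 := by linarith
  have : mm N b = 0 := by
    rw [hG, integral_eq_zero_iff_of_nonneg (fun x => (Real.exp_pos _).le) (hRe.int (hN.pos b))] at hGz
    have : ∀ᵐ x ∂(N b), False := by
      filter_upwards [hGz] with x hx
      exact (Real.exp_pos _).ne' hx
    rw [Filter.eventually_false_iff_eq_bot, ae_eq_bot] at this
    simp [mm, this]
  rw [this]; exact mm_nonneg _ _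

lemma L2 : mm N b ≤ mm N a := by
  by_cases h : ∃ Θ, ∀ s ∈ Ioc a b, th N b s ≤ Θ
  · obtain ⟨Θ, hΘ⟩ := h
    exact L2case1 hN ha hab hb hloc hΘ
  · push Not at h
    exact L2case2 hN ha hab hb hloc h

end

open MeasureTheory Set Filter Topology

def Good (N : ℝ → Measure ℝ) (t : ℝ) : Prop := ∃ K, ∃ ε > 0, ∀ r ∈ Ico (0:ℝ) 1, |r - t| < ε → mm N r ≤ K

lemma good_open (N : ℝ → Measure ℝ) : IsOpen {t | Good N t} := by
  rw [Metric.isOpen_iff]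
  rintro t ⟨K, ε, hε, h⟩
  refine ⟨ε/2, by positivity, fun t' ht' => ⟨K, ε/2, by positivity, fun r hr hr' => h r hr ?_⟩⟩
  rw [Metric.mem_ball, Real.dist_eq] at ht'
  have : r - t = (r - t') + (t' - t) := by ring
  rw [this]
  exact (abs_add_le _ _).trans_lt (by linarith)

set_option linter.unusedSectionVars false
section
variable {N : ℝ → Measure ℝ} (hN : Sys N)
include hN

lemma good_bdd {s b : ℝ} (hs : 0 ≤ s) (hb : b < 1) (hg : ∀ t ∈ Icc s b, Good N t) : ∃ K, ∀ r ∈ Icc s b, mm N r ≤ K := by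
  refine isCompact_Icc.induction_on (p := fun S => ∃ K, ∀ r ∈ S, mm N r ≤ K) ⟨0, by simp⟩ ?_ ?_ ?_
  · rintro S T hST ⟨K, h⟩
    exact ⟨K, fun r hr => h r (hST hr)⟩
  · rintro S T ⟨K, h⟩ ⟨K', h'⟩
    refine ⟨max K K', fun r hr => ?_⟩
    rcases hr with hr | hr
    · exact (h r hr).trans (le_max_left _ _)
    · exact (h' r hr).trans (le_max_right _ _)
  · intro t ht
    obtain ⟨K, ε, hε, h⟩ := hg t ht
    refine ⟨Metric.ball t ε ∩ Icc s b, ?_, K, fun r hr => ?_⟩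
    · exact inter_mem (mem_nhdsWithin_of_mem_nhds (Metric.ball_mem_nhds _ hε)) self_mem_nhdsWithin
    · refine h r ⟨by linarith [hr.2.1], by linarith [hr.2.2]⟩ ?_
      have := hr.1
      rwa [Metric.mem_ball, Real.dist_eq] at this

lemma L2' {a b : ℝ} (ha : 0 ≤ a) (hab : a < b) (hb : b < 1) (hg : ∀ t ∈ Ioc a b, Good N t) : mm N b ≤ mm N a := by
  refine L2 hN ha hab hb ?_
  intro s hs
  exact good_bdd hN (by linarith [hs.1]) hb (fun t ht => hg t ⟨by linarith [hs.1, ht.1], ht.2⟩)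

lemma all_good : ∀ t ∈ Ico (0:ℝ) 1, Good N t := by
  by_contra hcon
  push Not at hcon
  obtain ⟨t0, ht0, hbad⟩ := hcon
  let B : Set ℝ := Ico 0 1 ∩ {t | Good N t}ᶜ
  have hBlc : IsLocallyClosed B :=
    (isLocallyClosed_Ico).inter (good_open N).isClosed_compl.isLocallyClosed
  have : LocallyCompactSpace B := hBlc.locallyCompactSpace
  have : Nonempty B := ⟨⟨t0, ht0, hbad⟩⟩
  have hclosed : ∀ K : ℕ, IsClosed {β : B | mm N β ≤ K} := by
    intro K
    rw [← isOpen_compl_iff, isOpen_iff_mem_nhds]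
    intro β hβ
    have hβ' : (K:ℝ) < mm N β := by simpa using hβ
    have h1 := mm_lsc hN β.2.1 hβ'
    have h2 : Tendsto (fun x : B => (x:ℝ)) (𝓝 β) (𝓝[Ico 0 1] (β:ℝ)) := by
      refine tendsto_nhdsWithin_iff.2 ⟨continuous_subtype_val.continuousAt, Eventually.of_forall fun x => x.2.1⟩
    filter_upwards [h2.eventually h1] with x hx
    simpa using hx
  have hcov : (⋃ K : ℕ, {β : B | mm N β ≤ K}) = univ := by
    rw [eq_univ_iff_forall]
    intro β
    obtain ⟨K, hK⟩ := exists_nat_ge (mm N β)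
    exact mem_iUnion.2 ⟨K, hK⟩
  obtain ⟨K, β, hβ⟩ := nonempty_interior_of_iUnion_of_closed hclosed hcov
  rw [mem_interior_iff_mem_nhds, Metric.mem_nhds_iff] at hβ
  obtain ⟨δ, hδ, hball⟩ := hβ
  have hBK : ∀ r ∈ B, |r - β| < δ → mm N r ≤ K := by
    intro r hr hrd
    have : (⟨r, hr⟩ : B) ∈ Metric.ball β δ := by
      rw [Metric.mem_ball, Subtype.dist_eq, Real.dist_eq]; exact hrd
    exact hball this
  apply β.2.2
  set s0 := max ((β:ℝ) - δ/2) 0 with hs0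
  have hs00 : 0 ≤ s0 := le_max_right _ _
  have hs01 : (β:ℝ) - δ/2 ≤ s0 := le_max_left _ _
  refine ⟨max K (mm N s0), δ/2, by positivity, fun t ht htd => ?_⟩
  rw [abs_lt] at htd
  by_cases htB : t ∈ B
  · exact (hBK t htB (by rw [abs_lt]; constructor <;> linarith [htd.1, htd.2])).trans (le_max_left _ _)
  have hst : s0 ≤ t := max_le (by linarith [htd.1]) ht.1
  by_cases hA : (Icc s0 t ∩ {t | Good N t}ᶜ).Nonempty
  · have hAc : IsCompact (Icc s0 t ∩ {t | Good N t}ᶜ) := isCompact_Icc.inter_right (good_open N).isClosed_compl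
    obtain ⟨a, ha, hmax⟩ := hAc.exists_isGreatest hA
    have haB : a ∈ B := ⟨⟨by linarith [ha.1.1], by linarith [ha.1.2, ht.2]⟩, ha.2⟩
    have hat : a < t := by
      rcases lt_or_eq_of_le ha.1.2 with h | h
      · exact h
      · exact absurd (h ▸ haB) htB
    refine (L2' hN haB.1.1 hat ht.2 ?_).trans ((hBK a haB ?_).trans (le_max_left _ _))
    · intro r hr
      by_contra hrg
      have := hmax ⟨⟨by linarith [ha.1.1, hr.1], hr.2⟩, hrg⟩
      linarith [hr.1]
    · rw [abs_lt]; constructor <;> linarith [ha.1.1, ha.1.2, htd.2]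
  · refine le_trans ?_ (le_max_right _ _)
    rcases lt_or_eq_of_le hst with h | h
    · refine L2' hN hs00 h ht.2 ?_
      intro r hr
      by_contra hrg
      exact hA ⟨r, ⟨hr.1.le, hr.2⟩, hrg⟩
    · rw [h]

theorem partB : ∀ t ∈ Ico (0:ℝ) 1, mm N t ≤ mm N 0 := by
  intro t ht
  rcases lt_or_eq_of_le ht.1 with h | h
  · refine L2' hN le_rfl h ht.2 (fun r hr => all_good hN r ⟨hr.1.le, by linarith [hr.2, ht.2]⟩)
  · rw [h]
end

open MeasureTheory Set Filter Topology

lemma toIci {f : ℝ → ℝ} {f' x : ℝ} (hx : x ∈ Ico (0:ℝ) 1) (h : HasDerivWithinAt f f' (Ico 0 1) x) :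
    HasDerivWithinAt f f' (Ici x) x := by
  refine HasDerivWithinAt.mono_of_mem_nhdsWithin (s := Ici x) h ?_
  filter_upwards [Ico_mem_nhdsGE hx.2] with r hr
  exact ⟨hx.1.trans hr.1, hr.2⟩

lemma fatou_x {μ : Measure ℝ} [IsFiniteMeasure μ] (h0 : μ (Iic 0) = 0) {C : ℝ} (hC0 : 0 ≤ C)
    (h : ∀ η > 0, ∫ x, x * Real.exp (-η * x) ∂μ ≤ C) :
    Integrable (fun x => x) μ ∧ ∫ x, x ∂μ ≤ C := by
  have hb : ∫⁻ x, ENNReal.ofReal x ∂μ ≤ ENNReal.ofReal C := by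
    have h1 : ∀ x : ℝ, Tendsto (fun k : ℕ => ENNReal.ofReal (x * Real.exp (-(1/((k:ℝ)+1)) * x))) atTop (𝓝 (ENNReal.ofReal x)) := by
      intro x
      apply (ENNReal.continuous_ofReal.tendsto _).comp
      have h2 : Tendsto (fun k : ℕ => -(1/((k:ℝ)+1)) * x) atTop (𝓝 (-0 * x)) :=
        (tendsto_one_div_add_atTop_nhds_zero_nat.neg).mul_const x
      have h3 := (Real.continuous_exp.tendsto _).comp h2
      have h4 := h3.const_mul x
      simpa using h4
    calc ∫⁻ x, ENNReal.ofReal x ∂μ = ∫⁻ x, liminf (fun k : ℕ => ENNReal.ofReal (x * Real.exp (-(1/((k:ℝ)+1)) * x))) atTop ∂μ := by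
          congr 1; ext x; exact ((h1 x).liminf_eq).symm
      _ ≤ liminf (fun k : ℕ => ∫⁻ x, ENNReal.ofReal (x * Real.exp (-(1/((k:ℝ)+1)) * x)) ∂μ) atTop :=
          lintegral_liminf_le (fun k => by fun_prop)
      _ ≤ ENNReal.ofReal C := by
          refine liminf_le_of_frequently_le' (Frequently.of_forall fun k => ?_)
          have hp : (0:ℝ) < 1/((k:ℝ)+1) := by positivity
          rw [← ofReal_integral_eq_lintegral_ofReal ((RD_exp hp).mulx.int h0)]
          · exact ENNReal.ofReal_le_ofReal (h _ hp)
          · filter_upwards [ae_pos_of h0] with x hx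
            simp only [Pi.zero_apply]; positivity
  have hi : Integrable (fun x : ℝ => x) μ := by
    refine ⟨aestronglyMeasurable_id, ?_⟩
    rw [hasFiniteIntegral_iff_norm]
    refine lt_of_le_of_lt (le_of_eq_of_le (lintegral_congr_ae ?_) hb) ENNReal.ofReal_lt_top
    filter_upwards [ae_pos_of h0] with x hx
    rw [Real.norm_eq_abs, abs_of_pos hx]
  refine ⟨hi, ?_⟩
  rw [← ofReal_integral_eq_lintegral_ofReal hi] at hb
  · exact (ENNReal.ofReal_le_ofReal_iff hC0).1 hb
  · filter_upwards [ae_pos_of h0] with x hx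
    exact hx.le

lemma exp_lim_mass {μ : Measure ℝ} [IsFiniteMeasure μ] (h0 : μ (Iic 0) = 0) :
    Tendsto (fun k : ℕ => ∫ x, Real.exp (-(1/((k:ℝ)+1)) * x) ∂μ) atTop (𝓝 (μ.real univ)) := by
  have : μ.real univ = ∫ x, (1:ℝ) ∂μ := by simp
  rw [this]
  refine tendsto_integral_of_dominated_convergence (fun x => 1) ?_ (integrable_const _) ?_ ?_
  · intro k; exact (contDiff_expneg _).continuous.aestronglyMeasurable
  · intro k
    filter_upwards [ae_pos_of h0] with x hx
    exact expneg_abs_le (by positivity) hx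
  · refine Eventually.of_forall fun x => ?_
    have h2 : Tendsto (fun k : ℕ => -(1/((k:ℝ)+1)) * x) atTop (𝓝 (-0 * x)) :=
      (tendsto_one_div_add_atTop_nhds_zero_nat.neg).mul_const x
    have h3 := (Real.continuous_exp.tendsto _).comp h2
    simpa [Function.comp_def] using h3

section
variable {N : ℝ → Measure ℝ} (hN : Sys N) (hi0 : Integrable (fun x : ℝ => x) (N 0)) (hm0 : ∫ x, x ∂(N 0) = 1)
include hN

lemma lemE' {g : ℝ → ℝ} (hg : RD g) :
    ∀ t ∈ Ico (0:ℝ) 1, HasDerivWithinAt (fun r => ∫ x, g x ∂(N r)) (∫ p, PP g p ∂((N t).prod (N t))) (Ico 0 1) t :=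
  lemE hN (convex_Ico 0 1) subset_rfl (partB hN) hg

include hi0 hm0

lemma C1 {η : ℝ} (hη : 0 < η) {t : ℝ} (ht : t ∈ Ico (0:ℝ) 1) : ∫ x, x * Real.exp (-η * x) ∂(N t) ≤ 1 / (1 - t) := by
  have := hN.fin
  have hR := (RD_exp hη).mulx
  set f := fun s => ∫ x, x * Real.exp (-η * x) ∂(N s) with hf
  set f' := fun s => ∫ p, PP (fun x => x * Real.exp (-η * x)) p ∂((N s).prod (N s)) with hf'
  have hd := lemE' hN hR
  have hf0 : ∀ s, 0 ≤ f s := fun s => by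
    apply integral_nonneg_of_ae
    filter_upwards [ae_pos_of (hN.pos s)] with x hx
    simp only [Pi.zero_apply]; positivity
  have hf1 : f 0 ≤ 1 := by
    rw [← hm0]
    refine integral_mono_ae (hR.int (hN.pos 0)) hi0 ?_
    filter_upwards [ae_pos_of (hN.pos 0)] with x hx
    have := expneg_abs_le hη.le hx
    rw [Real.abs_exp] at this
    exact mul_le_of_le_one_right hx.le this
  have hle : ∀ s, f' s ≤ f s ^ 2 := by
    intro s
    have ix := hR.int (hN.pos s)
    have : f s ^ 2 = ∫ p : ℝ × ℝ, (p.1 * Real.exp (-η * p.1)) * (p.2 * Real.exp (-η * p.2)) ∂((N s).prod (N s)) := by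
      rw [integral_prod_mul (fun x => x * Real.exp (-η * x)) (fun x => x * Real.exp (-η * x)), sq]
    rw [this]
    refine integral_mono_ae (PP_int (hN.pos s) hR) (ix.mul_prod ix) ?_
    filter_upwards [ae_prod_pos (hN.pos s)] with p hp
    simp only [PP]
    have e : Real.exp (-η * (p.1 + p.2)) = Real.exp (-η * p.1) * Real.exp (-η * p.2) := by
      rw [← Real.exp_add]; congr 1; ring
    rw [e]
    have a1 := expneg_abs_le hη.le hp.1
    have a2 := expneg_abs_le hη.le hp.2
    rw [Real.abs_exp] at a1 a2
    have b1 := Real.exp_pos (-η * p.1)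
    have b2 := Real.exp_pos (-η * p.2)
    generalize Real.exp (-η * p.1) = E1 at *
    generalize Real.exp (-η * p.2) = E2 at *
    have c1 : 0 ≤ p.1^2 * E1 * (1 - E2) := mul_nonneg (by positivity) (by linarith)
    have c2 : 0 ≤ p.2^2 * E2 * (1 - E1) := mul_nonneg (by positivity) (by linarith)
    nlinarith
  have hδ : ∀ δ > 0, (f t + δ) * (1/(1+δ) - t) ≤ 1 := by
    intro δ hδ
    have h1 : -(f t + δ)⁻¹ ≤ -(f 0 + δ)⁻¹ + t := by
      refine image_le_of_deriv_right_le_deriv_boundary (f := fun s => -(f s + δ)⁻¹) (a := 0) (b := t)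
        (f' := fun s => -(-(f' s) / (f s + δ)^2)) (B := fun s => -(f 0 + δ)⁻¹ + s) (B' := fun _ => 1)
        ?_ ?_ (by simp) (by fun_prop) ?_ ?_ ⟨ht.1, le_rfl⟩
      · intro s hs
        have hs' : s ∈ Ico (0:ℝ) 1 := ⟨hs.1, hs.2.trans_lt ht.2⟩
        have := ((hd s hs').continuousWithinAt.add_const δ).inv₀ (by have := hf0 s; positivity)
        exact this.neg.mono (fun r hr => ⟨hr.1, hr.2.trans_lt ht.2⟩)
      · intro s hs
        have hs' : s ∈ Ico (0:ℝ) 1 := ⟨hs.1, hs.2.trans ht.2⟩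
        exact (((toIci hs' (hd s hs')).add_const δ).inv (by have := hf0 s; positivity)).neg
      · intro s hs
        exact ((hasDerivAt_id s).const_add _).hasDerivWithinAt
      · intro s hs
        have h0 := hf0 s
        rw [neg_div, neg_neg, div_le_one (by positivity)]
        refine (hle s).trans ?_
        gcongr; linarith
    have h2 : 1/(1+δ) ≤ (f 0 + δ)⁻¹ := by
      rw [one_div]
      have := hf0 0
      gcongr
    have h3 : 1/(1+δ) - t ≤ (f t + δ)⁻¹ := by linarith
    have h4 : 0 < f t + δ := by have := hf0 t; positivity
    calc (f t + δ) * (1/(1+δ) - t) ≤ (f t + δ) * (f t + δ)⁻¹ := by gcongr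
      _ = 1 := mul_inv_cancel₀ h4.ne'
  have hlim : Tendsto (fun δ => (f t + δ) * (1/(1+δ) - t)) (𝓝[>] 0) (𝓝 ((f t + 0) * (1/(1+0) - t))) := by
    have : ContinuousAt (fun δ => (f t + δ) * (1/(1+δ) - t)) 0 := by
      have : (1:ℝ) + 0 ≠ 0 := by norm_num
      fun_prop (disch := assumption)
    exact this.tendsto.mono_left nhdsWithin_le_nhds
  have := le_of_tendsto hlim (by filter_upwards [self_mem_nhdsWithin] with δ h; exact hδ δ h)
  rw [le_div_iff₀ (by linarith [ht.2])]
  have this : f t * (1-t) ≤ 1 := by simpa using this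
  exact this

lemma C2 {t : ℝ} (ht : t ∈ Ico (0:ℝ) 1) : Integrable (fun x => x) (N t) ∧ ∫ x, x ∂(N t) ≤ 1 / (1 - t) := by
  have := hN.fin
  exact fatou_x (hN.pos t) (by have := ht.2; exact div_nonneg zero_le_one (by linarith))
    (fun η hη => C1 hN hi0 hm0 hη ht)

lemma C3 {t : ℝ} (ht : t ∈ Ico (0:ℝ) 1) : mm N t = mm N 0 := by
  have := hN.fin
  apply le_antisymm (partB hN t ht)
  have ht1 : 0 < 1 - t := by linarith [ht.2]
  have key : ∀ η > 0, ∫ x, Real.exp (-η * x) ∂(N 0) ≤ ∫ x, Real.exp (-η * x) ∂(N t) + η * (t * (1/(1-t))^2) := by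
    intro η hη
    have hR := RD_exp hη
    have hd := lemE' hN hR
    have := image_le_of_deriv_right_le_deriv_boundary (f := fun s => -∫ x, Real.exp (-η * x) ∂(N s)) (a := 0) (b := t)
        (f' := fun s => -∫ p, PP (fun x => Real.exp (-η * x)) p ∂((N s).prod (N s)))
        (B := fun s => -∫ x, Real.exp (-η * x) ∂(N 0) + η * (1/(1-t))^2 * s) (B' := fun _ => η * (1/(1-t))^2)
        ?_ ?_ (by simp) (by fun_prop) ?_ ?_ ⟨ht.1, le_rfl⟩
    · linarith
    · intro s hs
      exact (hd s ⟨hs.1, hs.2.trans_lt ht.2⟩).continuousWithinAt.neg.mono (fun r hr => ⟨hr.1, hr.2.trans_lt ht.2⟩)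
    · intro s hs
      have hs' : s ∈ Ico (0:ℝ) 1 := ⟨hs.1, hs.2.trans ht.2⟩
      exact (toIci hs' (hd s hs')).neg
    · intro s hs
      have := ((hasDerivAt_id s).const_mul (η * (1/(1-t))^2)).const_add (-∫ x, Real.exp (-η * x) ∂(N 0))
      simp only [mul_one] at this
      exact this.hasDerivWithinAt
    · intro s hs
      have hs' : s ∈ Ico (0:ℝ) 1 := ⟨hs.1, hs.2.trans ht.2⟩
      obtain ⟨ix, hx⟩ := C2 hN hi0 hm0 hs'
      have hx0 : 0 ≤ ∫ x, x ∂(N s) := by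
        apply integral_nonneg_of_ae
        filter_upwards [ae_pos_of (hN.pos s)] with x hx
        exact hx.le
      have h2 : ∫ x, x ∂(N s) ≤ 1/(1-t) := by
        refine hx.trans ?_
        have : 1 - t ≤ 1 - s := by linarith [hs.2]
        gcongr
      have h3 : ∫ p : ℝ × ℝ, η * (p.1 * p.2) ∂((N s).prod (N s)) ≤ η * (1/(1-t))^2 := by
        rw [integral_const_mul, integral_prod_mul (fun x => x) (fun x => x), ← sq]
        gcongr
      refine le_trans ?_ h3
      rw [← integral_neg]
      refine integral_mono_ae (PP_int (hN.pos s) hR).neg ((ix.mul_prod ix).const_mul η) ?_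
      filter_upwards [ae_prod_pos (hN.pos s)] with p hp
      simp only [PP]
      have e : Real.exp (-η * (p.1 + p.2)) = Real.exp (-η * p.1) * Real.exp (-η * p.2) := by
        rw [← Real.exp_add]; congr 1; ring
      rw [e]
      have a1 := expneg_abs_le hη.le hp.1
      have a2 := expneg_abs_le hη.le hp.2
      rw [Real.abs_exp] at a1 a2
      have b1 := Real.exp_pos (-η * p.1)
      have b2 := Real.exp_pos (-η * p.2)
      have d1 := Real.add_one_le_exp (-η * p.1)
      have d2 := Real.add_one_le_exp (-η * p.2)
      generalize Real.exp (-η * p.1) = E1 at *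
      generalize Real.exp (-η * p.2) = E2 at *
      have c1 : p.1 * E1 * (1 - E2) ≤ p.1 * 1 * (η * p.2) := by
        have := hp.1; gcongr <;> linarith
      have c2 : p.2 * E2 * (1 - E1) ≤ p.2 * 1 * (η * p.1) := by
        have := hp.2; gcongr <;> linarith
      nlinarith
  have l1 := exp_lim_mass (hN.pos 0)
  have l2 := exp_lim_mass (hN.pos t)
  have l3 := l2.add ((tendsto_one_div_add_atTop_nhds_zero_nat (𝕜 := ℝ)).mul_const (t * (1/(1-t))^2))
  rw [zero_mul, add_zero] at l3
  exact le_of_tendsto_of_tendsto' l1 l3 (fun k => key _ (by positivity))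

lemma C4 {t : ℝ} (ht : t ∈ Ico (0:ℝ) 1) {η : ℝ} (hη : 0 < η) {v : ℝ} (hv : v = mm N 0 - ∫ x, Real.exp (-η * x) ∂(N t)) :
    mm N 0 - ∫ x, Real.exp (-(η + t * v) * x) ∂(N 0) = v := by
  have := hN.fin
  have hsub : Icc 0 t ⊆ Ico (0:ℝ) 1 := fun r hr => ⟨hr.1, hr.2.trans_lt ht.2⟩
  have hv0 : 0 ≤ v := by
    rw [hv, ← C3 hN hi0 hm0 ht]
    have : ∫ x, Real.exp (-η * x) ∂(N t) ≤ mm N t :=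
      int_le_mass (hN.pos t) (contDiff_expneg η).continuous (fun x hx => expneg_abs_le hη.le hx)
    linarith
  set M := mm N 0 with hM
  have hφ := RD_exp hη
  set θ := fun s => (t - s) * v with hθ
  have hθ0 : ∀ s ∈ Icc 0 t, 0 ≤ θ s := fun s hs => mul_nonneg (by linarith [hs.2]) hv0
  set A := fun s => ∫ x, x * (Real.exp (-θ s * x) * Real.exp (-η * x)) ∂(N s) with hA
  set h := fun s => (∫ x, Real.exp (-θ s * x) * Real.exp (-η * x) ∂(N s)) - (M - v) with hh
  have hA0 : ∀ s, 0 ≤ A s := by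
    intro s
    apply integral_nonneg_of_ae
    filter_upwards [ae_pos_of (hN.pos s)] with x hx
    simp only [Pi.zero_apply]; positivity
  have hder : ∀ s ∈ Icc 0 t, HasDerivWithinAt h (A s * h s) (Icc 0 t) s := by
    intro s hs
    have hR := hφ.expmul (hθ0 s hs)
    have hdθ : HasDerivWithinAt θ (-v) (Icc 0 t) s := by
      have := (((hasDerivAt_id s).const_sub t).mul_const v).hasDerivWithinAt (s := Icc 0 t)
      simpa using this
    have h3 := lemPR hN (S := Icc 0 t) (K := M) (fun r hr => partB hN r (hsub hr)) hs hθ0 hdθ hφ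
      ((lemE' hN hR s (hsub hs)).mono hsub) ((lemE' hN hR.mulx s (hsub hs)).continuousWithinAt.mono hsub)
    have h4 := h3.sub_const (M - v)
    refine h4.congr_deriv ?_
    rw [PP_split hN hR, C3 hN hi0 hm0 (hsub hs)]
    set E := fun x => Real.exp (-θ s * x) * Real.exp (-η * x) with hE
    have hprod : (∫ p : ℝ × ℝ, (1/2) * ((p.1 + p.2) * E (p.1 + p.2)) ∂((N s).prod (N s)))
          = (∫ x, E x ∂(N s)) * (∫ x, x * E x ∂(N s)) := by
      have ie := hR.int (hN.pos s)
      have ixe := hR.mulx.int (hN.pos s)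
      have : ∀ p : ℝ × ℝ, (1/2) * ((p.1 + p.2) * E (p.1 + p.2)) = (1/2) * ((p.1 * E p.1) * E p.2 + E p.1 * (p.2 * E p.2)) := by
        intro p
        have : E (p.1 + p.2) = E p.1 * E p.2 := by
          simp only [hE, ← Real.exp_add]; congr 1; ring
        rw [this]; ring
      simp_rw [this]
      rw [integral_const_mul, integral_add (ixe.mul_prod ie) (ie.mul_prod ixe),
        integral_prod_mul (fun x => x * E x) E, integral_prod_mul E (fun x => x * E x)]
      ring
    rw [hprod]
    simp only [hA, hh]
    ring
  have hmono : MonotoneOn (fun s => h s ^ 2) (Icc 0 t) := by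
    refine monotoneOn_of_hasDerivWithinAt_nonneg (convex_Icc 0 t)
      (f' := fun s => 2 * h s * (A s * h s)) (fun s hs => ((hder s hs).continuousWithinAt).pow 2) ?_ ?_
    · intro s hs
      have := ((hder s (interior_subset hs)).mono interior_subset).pow 2
      refine HasDerivWithinAt.congr_deriv (f := fun s => h s ^ 2) this (by simp)
    · intro s hs
      have := hA0 s
      have : 2 * h s * (A s * h s) = 2 * A s * (h s)^2 := by ring
      rw [this]; positivity
  have h0t := hmono (left_mem_Icc.2 ht.1) (right_mem_Icc.2 ht.1) ht.1
  have htz : h t = 0 := by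
    simp only [hh, hθ, sub_self, zero_mul, neg_zero, Real.exp_zero, one_mul]
    rw [hv]; ring
  have h00 : h 0 = 0 := by
    simp only [htz] at h0t
    have : h 0 ^ 2 = 0 := le_antisymm (by simpa using h0t) (sq_nonneg _)
    simpa using this
  simp only [hh, hθ, sub_zero, ← Real.exp_add] at h00
  have e : ∀ x, -(t * v) * x + -η * x = -(η + t * v) * x := fun x => by ring
  simp only [e] at h00
  linarith
end

open MeasureTheory Set Filter Topology

/-- `∫ (1 - e^{-ηx}) dP`. -/
noncomputable def LA (P : Measure ℝ) (η : ℂ) : ℂ := ∫ x, (1 - Complex.exp (-η * (x:ℂ))) ∂P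
/-- `∫ x e^{-ηx} dP`. -/
noncomputable def LB (P : Measure ℝ) (η : ℂ) : ℂ := ∫ x, (x:ℂ) * Complex.exp (-η * (x:ℂ)) ∂P

lemma norm_cexp_le {η : ℂ} (h : 0 ≤ η.re) {x : ℝ} (hx : 0 < x) : ‖Complex.exp (-η * (x:ℂ))‖ ≤ 1 := by
  rw [Complex.norm_exp, Real.exp_le_one_iff]
  simp
  positivity

section
variable {P : Measure ℝ} [IsFiniteMeasure P] (hP : P (Iic 0) = 0)
include hP

lemma LA_int {η : ℂ} (h : 0 ≤ η.re) : Integrable (fun x : ℝ => 1 - Complex.exp (-η * (x:ℂ))) P := by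
  refine Integrable.of_bound (C := 2) (by fun_prop) ?_
  filter_upwards [ae_pos_of hP] with x hx
  calc _ ≤ ‖(1:ℂ)‖ + ‖Complex.exp (-η * (x:ℂ))‖ := norm_sub_le _ _
    _ ≤ 2 := by have := norm_cexp_le h hx; rw [norm_one]; linarith

lemma LA_re {η : ℂ} (h : 0 ≤ η.re) : 0 ≤ (LA P η).re := by
  unfold LA
  have := integral_re (𝕜 := ℂ) (LA_int hP h)
  simp only [RCLike.re_to_complex] at this
  rw [← this]
  refine integral_nonneg_of_ae ?_
  filter_upwards [ae_pos_of hP] with x hx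
  have h1 := (Complex.re_le_norm (Complex.exp (-η * (x:ℂ)))).trans (norm_cexp_le h hx)
  simp only [Complex.sub_re, Complex.one_re, Pi.zero_apply]
  linarith

lemma LA_ofReal (η : ℝ) (h : 0 ≤ η) : LA P (η:ℂ) = ((P.real univ - ∫ x, Real.exp (-η * x) ∂P : ℝ) : ℂ) := by
  unfold LA
  have e : ∀ x : ℝ, (1:ℂ) - Complex.exp (-(η:ℂ) * (x:ℂ)) = ((1 - Real.exp (-η * x) : ℝ) : ℂ) := by intro x; push_cast; rfl
  simp_rw [e]
  rw [integral_complex_ofReal, integral_sub (integrable_const _)]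
  · simp
  · refine Integrable.of_bound (C := 1) (by fun_prop) ?_
    filter_upwards [ae_pos_of hP] with x hx
    rw [Real.norm_eq_abs]
    rw [abs_of_pos (Real.exp_pos _), Real.exp_le_one_iff]
    nlinarith

lemma LA_cont : ContinuousOn (LA P) {η : ℂ | 0 ≤ η.re} := by
  refine continuousOn_of_dominated (bound := fun x => 2) (fun η _ => by fun_prop) (fun η h => ?_) (integrable_const _) ?_
  · filter_upwards [ae_pos_of hP] with x hx
    calc _ ≤ ‖(1:ℂ)‖ + ‖Complex.exp (-η * (x:ℂ))‖ := norm_sub_le _ _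
      _ ≤ 2 := by have := norm_cexp_le h hx; rw [norm_one]; linarith
  · exact Eventually.of_forall fun x => by fun_prop

variable (hx : Integrable (fun x => x) P)
include hx

lemma LB_bound {η : ℂ} (h : 0 ≤ η.re) : ∀ᵐ x : ℝ ∂P, ‖(x:ℂ) * Complex.exp (-η * (x:ℂ))‖ ≤ x := by
  filter_upwards [ae_pos_of hP] with x hx
  rw [norm_mul, Complex.norm_real, Real.norm_eq_abs, abs_of_pos hx]
  have := norm_cexp_le h hx
  nlinarith

lemma LB_int {η : ℂ} (h : 0 ≤ η.re) : Integrable (fun x : ℝ => (x:ℂ) * Complex.exp (-η * (x:ℂ))) P :=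
  hx.mono' (by fun_prop) (LB_bound hP hx h)

lemma LB_norm {η : ℂ} (h : 0 ≤ η.re) : ‖LB P η‖ ≤ ∫ x, x ∂P :=
  norm_integral_le_of_norm_le hx (LB_bound hP hx h)

lemma LB_cont : ContinuousOn (LB P) {η : ℂ | 0 ≤ η.re} := by
  refine continuousOn_of_dominated (bound := fun x => x) (fun η _ => by fun_prop) (fun η h => LB_bound hP hx h) hx ?_
  exact Eventually.of_forall fun x => by fun_prop

lemma LA_deriv {η : ℂ} (h : 0 < η.re) : HasDerivAt (LA P) (LB P η) η := by
  have hn : {z : ℂ | 0 < z.re} ∈ 𝓝 η := (isOpen_lt continuous_const Complex.continuous_re).mem_nhds h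
  refine (hasDerivAt_integral_of_dominated_loc_of_deriv_le (F := fun (η:ℂ) (x:ℝ) => 1 - Complex.exp (-η * (x:ℂ))) (F' := fun η x => (x:ℂ) * Complex.exp (-η * (x:ℂ)))
    (bound := fun x => x) hn ?_ (LA_int hP h.le) ?_ ?_ hx ?_).2
  · exact Eventually.of_forall fun z => by fun_prop
  · fun_prop
  · filter_upwards [ae_pos_of hP] with x hx z hz
    rw [norm_mul, Complex.norm_real, Real.norm_eq_abs, abs_of_pos hx]
    have := norm_cexp_le (le_of_lt hz) hx
    nlinarith
  · refine Eventually.of_forall fun x z _ => ?_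
    have h1 : HasDerivAt (fun z : ℂ => -z * (x:ℂ)) (-1 * x) z := (hasDerivAt_id z).neg.mul_const _
    have h2 := (h1.cexp).const_sub 1
    refine h2.congr_deriv ?_
    ring
end

/-- Complex version of the characteristics identity. -/
lemma C5 {P Q : Measure ℝ} [IsFiniteMeasure P] [IsFiniteMeasure Q] (hP : P (Iic 0) = 0) (hQ : Q (Iic 0) = 0)
    (hxP : Integrable (fun x => x) P) (hxQ : Integrable (fun x => x) Q) {t : ℝ} (ht : 0 ≤ t)
    (hreal : ∀ η : ℝ, 0 < η → LA P ((η:ℂ) + t * LA Q η) = LA Q η) :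
    ∀ η : ℂ, 0 ≤ η.re → 0 ≤ (η + t * LA Q η).re ∧ LA P (η + t * LA Q η) = LA Q η ∧
      LB Q η * (1 - t * LB P (η + t * LA Q η)) = LB P (η + t * LA Q η) := by
  have hre : ∀ η : ℂ, 0 ≤ η.re → η.re ≤ (η + t * LA Q η).re := by
    intro η h
    have := LA_re hQ h
    simp only [Complex.add_re, Complex.mul_re, Complex.ofReal_re, Complex.ofReal_im, zero_mul, sub_zero]
    nlinarith
  set U : Set ℂ := {z : ℂ | 0 < z.re} with hU
  have hUo : IsOpen U := isOpen_lt continuous_const Complex.continuous_re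
  have hξd : ∀ z ∈ U, HasDerivAt (fun z => z + t * LA Q z) (1 + t * LB Q z) z := by
    intro z hz
    exact (hasDerivAt_id z).add ((LA_deriv hQ hxQ hz).const_mul _)
  have hcd : ∀ z ∈ U, HasDerivAt (fun z => LA P (z + t * LA Q z)) (LB P (z + t * LA Q z) * (1 + t * LB Q z)) z := by
    intro z hz
    have h1 := LA_deriv hP hxP (η := z + t * LA Q z) (lt_of_lt_of_le hz (hre z (le_of_lt hz)))
    exact HasDerivAt.comp z h1 (hξd z hz)
  have hid : EqOn (fun z => LA P (z + t * LA Q z)) (LA Q) U := by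
    refine AnalyticOnNhd.eqOn_of_preconnected_of_frequently_eq (z₀ := 1) ?_ ?_ ?_ (by simp [hU]) ?_
    · exact DifferentiableOn.analyticOnNhd (fun z hz => (hcd z hz).differentiableAt.differentiableWithinAt) hUo
    · exact DifferentiableOn.analyticOnNhd (fun z hz => (LA_deriv hQ hxQ hz).differentiableAt.differentiableWithinAt) hUo
    · exact (convex_halfSpace_re_gt 0).isPreconnected
    · have h1 : Tendsto (fun k : ℕ => (((1:ℝ) + 1/((k:ℝ)+1) : ℝ) : ℂ)) atTop (𝓝[≠] 1) := by
        refine tendsto_nhdsWithin_iff.2 ⟨?_, Eventually.of_forall fun k => ?_⟩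
        · have := (tendsto_one_div_add_atTop_nhds_zero_nat (𝕜 := ℝ)).const_add 1
          have := (Complex.continuous_ofReal.tendsto _).comp this
          simpa [Function.comp_def] using this
        · intro h
          have h := congrArg Complex.re h
          rw [Complex.ofReal_re, Complex.one_re] at h
          have : 0 < 1/((k:ℝ)+1) := by positivity
          linarith
      exact h1.frequently (Frequently.of_forall fun k => hreal _ (by positivity))
  have hid2 : EqOn (fun η => LB Q η * (1 - t * LB P (η + t * LA Q η))) (fun η => LB P (η + t * LA Q η)) U := by
    intro z hz
    have h1 := hcd z hz
    have h2 := LA_deriv hQ hxQ hz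
    have h3 : (fun z => LA P (z + t * LA Q z)) =ᶠ[𝓝 z] LA Q := by
      filter_upwards [hUo.mem_nhds hz] with w hw using hid hw
    have h4 := h1.unique (h2.congr_of_eventuallyEq h3)
    simp only
    linear_combination -h4
  set V : Set ℂ := {z : ℂ | 0 ≤ z.re} with hV
  have hcl : V ⊆ closure U := by rw [hU, Complex.closure_setOfPred_lt_re]
  have hUV : U ⊆ V := fun z hz => le_of_lt (show 0 < z.re from hz)
  have hmap : MapsTo (fun z => z + t * LA Q z) V V := fun z hz => le_trans hz (hre z hz)
  have cA := LA_cont hQ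
  have cξ : ContinuousOn (fun z => z + t * LA Q z) V := by
    exact continuousOn_id.add (continuousOn_const.mul cA)
  have c1 : ContinuousOn (fun z => LA P (z + t * LA Q z)) V := (LA_cont hP).comp cξ hmap
  have c2 : ContinuousOn (fun z => LB P (z + t * LA Q z)) V := (LB_cont hP hxP).comp cξ hmap
  have e1 := hid.of_subset_closure c1 cA hUV hcl
  have e2 := hid2.of_subset_closure ((LB_cont hQ hxQ).mul (continuousOn_const.sub (continuousOn_const.mul c2))) c2 hUV hcl
  exact fun η h => ⟨hmap h, e1 h, e2 h⟩

open MeasureTheory Set Filter Topology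

lemma mv_aux {f f' : ℂ → ℂ} {z : ℂ} (hz : 0 ≤ z.re) {C : ℝ} (hd : ∀ w, HasDerivAt f (f' w) w) (h0 : f 0 = 0)
    (hb : ∀ w : ℂ, 0 ≤ w.re → ‖w‖ ≤ ‖z‖ → ‖f' w‖ ≤ C) : ‖f z‖ ≤ C * ‖z‖ := by
  have hc : Convex ℝ ({w : ℂ | 0 ≤ w.re} ∩ Metric.closedBall 0 ‖z‖) :=
    (convex_halfSpace_re_ge 0).inter (convex_closedBall _ _)
  have := hc.norm_image_sub_le_of_norm_hasDerivWithin_le (f := f) (f' := f') (C := C) (x := 0) (y := z)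
    (fun w _ => (hd w).hasDerivWithinAt) (fun w hw => hb w hw.1 (by simpa using hw.2)) ⟨by simp, by simp⟩ ⟨hz, by simp⟩
  simpa [h0] using this

lemma expd (w : ℂ) : HasDerivAt (fun w : ℂ => Complex.exp (-w)) (-Complex.exp (-w)) w := by
  have := (hasDerivAt_id w).neg.cexp
  simpa using this

lemma norm_expneg_le {w : ℂ} (hw : 0 ≤ w.re) : ‖Complex.exp (-w)‖ ≤ 1 := by
  rw [Complex.norm_exp]; simpa using hw

lemma tay1 {z : ℂ} (hz : 0 ≤ z.re) : ‖1 - Complex.exp (-z)‖ ≤ ‖z‖ := by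
  have := mv_aux (f := fun w => 1 - Complex.exp (-w)) (f' := fun w => Complex.exp (-w)) hz (C := 1)
    (fun w => ((expd w).const_sub 1).congr_deriv (by ring)) (by simp) (fun w hw _ => norm_expneg_le hw)
  simpa using this

lemma tay2 {z : ℂ} (hz : 0 ≤ z.re) : ‖Complex.exp (-z) - (1 - z)‖ ≤ ‖z‖ ^ 2 := by
  have := mv_aux (f := fun w => Complex.exp (-w) - (1 - w)) (f' := fun w => 1 - Complex.exp (-w)) hz (C := ‖z‖)
    (fun w => ((expd w).sub ((hasDerivAt_id w).const_sub 1)).congr_deriv (by ring)) (by simp) (fun w hw h => (tay1 hw).trans h)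
  simpa [sq] using this

lemma tay3 {z : ℂ} (hz : 0 ≤ z.re) : ‖(1 - Complex.exp (-z)) - (z - z ^ 2 / 2)‖ ≤ ‖z‖ ^ 3 := by
  have := mv_aux (f := fun w => (1 - Complex.exp (-w)) - (w - w ^ 2 / 2)) (f' := fun w => Complex.exp (-w) - (1 - w)) hz (C := ‖z‖ ^ 2)
    (fun w => (((expd w).const_sub 1).sub ((hasDerivAt_id w).sub (((hasDerivAt_id w).pow 2).div_const 2))).congr_deriv (by simp))
    (by simp) (fun w hw h => (tay2 hw).trans (by gcongr))
  calc _ ≤ _ := this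
    _ = _ := by ring

section
variable {P : Measure ℝ} [IsFiniteMeasure P] (hP : P (Iic 0) = 0)
  (hx : Integrable (fun x => x) P)
include hP hx

lemma LA_le {ξ : ℂ} (h : 0 ≤ ξ.re) : ‖LA P ξ‖ ≤ ‖ξ‖ * ∫ x, x ∂P := by
  rw [← integral_const_mul]
  refine norm_integral_le_of_norm_le (hx.const_mul _) ?_
  filter_upwards [ae_pos_of hP] with x hx
  have hr : 0 ≤ (ξ * x).re := by simp; positivity
  have := tay1 hr
  rw [norm_mul, Complex.norm_real, Real.norm_eq_abs, abs_of_pos hx] at this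
  simpa using this

variable (hm : ∫ x, x ∂P = 1) (hx2 : Integrable (fun x => x ^ 2) P) (hm2 : ∫ x, x ^ 2 ∂P = 1)
include hm hx2 hm2

lemma LB_tay1 {ξ : ℂ} (h : 0 ≤ ξ.re) : ‖LB P ξ - 1‖ ≤ ‖ξ‖ := by
  have e : LB P ξ - 1 = ∫ x, ((x:ℂ) * Complex.exp (-ξ * (x:ℂ)) - (x:ℂ)) ∂P := by
    have i1 : Integrable (fun x : ℝ => (x : ℂ)) P := hx.ofReal
    rw [integral_sub (LB_int hP hx h) i1, integral_complex_ofReal, hm]; simp [LB]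
  rw [e]
  have e2 : ‖ξ‖ = ∫ x, ‖ξ‖ * x ^ 2 ∂P := by rw [integral_const_mul, hm2, mul_one]
  rw [e2]
  refine norm_integral_le_of_norm_le (hx2.const_mul _) ?_
  filter_upwards [ae_pos_of hP] with x hx
  have hr : 0 ≤ (ξ * x).re := by simp; positivity
  have h1 := tay1 hr
  have e3 : (x:ℂ) * Complex.exp (-ξ * (x:ℂ)) - (x:ℂ) = -(x:ℂ) * (1 - Complex.exp (-(ξ * x))) := by
    rw [neg_mul ξ]; ring
  rw [norm_mul, Complex.norm_real, Real.norm_eq_abs, abs_of_pos hx] at h1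
  rw [e3, norm_mul, norm_neg, Complex.norm_real, Real.norm_eq_abs, abs_of_pos hx]
  calc _ ≤ x * (‖ξ‖ * x) := by gcongr
    _ = _ := by ring

variable {M : ℝ} (hx3 : Integrable (fun x => x ^ 3) P) (hm3 : ∫ x, x ^ 3 ∂P ≤ M)
include hx3 hm3

lemma LB_tay2 {ξ : ℂ} (h : 0 ≤ ξ.re) : ‖LB P ξ - (1 - ξ)‖ ≤ M * ‖ξ‖ ^ 2 := by
  have i2 : Integrable (fun x : ℝ => ξ * ((x ^ 2 : ℝ) : ℂ)) P := (hx2.ofReal).const_mul ξ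
  have i1 : Integrable (fun x : ℝ => (x : ℂ)) P := hx.ofReal
  have i12 : Integrable (fun x : ℝ => (x : ℂ) - ξ * ((x ^ 2 : ℝ) : ℂ)) P := i1.sub i2
  have e : LB P ξ - (1 - ξ) = ∫ x, ((x:ℂ) * Complex.exp (-ξ * (x:ℂ)) - ((x:ℂ) - ξ * ((x ^ 2 : ℝ) : ℂ))) ∂P := by
    rw [integral_sub (LB_int hP hx h) i12, integral_sub i1 i2, integral_const_mul, integral_complex_ofReal, integral_complex_ofReal, hm, hm2]; simp [LB]
  rw [e]
  have e2 : ‖ξ‖^2 * ∫ x, x ^ 3 ∂P = ∫ x, ‖ξ‖^2 * x ^ 3 ∂P := by rw [integral_const_mul]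
  refine le_trans ?_ (show ‖ξ‖^2 * ∫ x, x ^ 3 ∂P ≤ _ by rw [mul_comm M]; gcongr)
  rw [e2]
  refine norm_integral_le_of_norm_le (hx3.const_mul _) ?_
  filter_upwards [ae_pos_of hP] with x hx
  have hr : 0 ≤ (ξ * x).re := by simp; positivity
  have h1 := tay2 hr
  have e3 : (x:ℂ) * Complex.exp (-ξ * (x:ℂ)) - ((x:ℂ) - ξ * ((x ^ 2 : ℝ) : ℂ)) = (x:ℂ) * (Complex.exp (-(ξ * x)) - (1 - ξ * x)) := by
    rw [neg_mul ξ]; push_cast; ring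
  rw [norm_mul ξ, Complex.norm_real, Real.norm_eq_abs, abs_of_pos hx] at h1
  rw [e3, norm_mul, Complex.norm_real, Real.norm_eq_abs, abs_of_pos hx]
  calc _ ≤ x * (‖ξ‖ * x)^2 := by gcongr
    _ = _ := by ring

lemma LA_tay3 {ξ : ℂ} (h : 0 ≤ ξ.re) : ‖LA P ξ - (ξ - ξ ^ 2 / 2)‖ ≤ M * ‖ξ‖ ^ 3 := by
  have i2 : Integrable (fun x : ℝ => ξ^2/2 * ((x ^ 2 : ℝ) : ℂ)) P := (hx2.ofReal).const_mul _
  have i1 : Integrable (fun x : ℝ => ξ * (x : ℂ)) P := hx.ofReal.const_mul _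
  have i12 : Integrable (fun x : ℝ => ξ * (x : ℂ) - ξ^2/2 * ((x ^ 2 : ℝ) : ℂ)) P := i1.sub i2
  have e : LA P ξ - (ξ - ξ^2/2) = ∫ x, ((1 - Complex.exp (-ξ * (x:ℂ))) - (ξ * (x:ℂ) - ξ^2/2 * ((x ^ 2 : ℝ) : ℂ))) ∂P := by
    rw [integral_sub (LA_int hP h) i12, integral_sub i1 i2, integral_const_mul, integral_const_mul, integral_complex_ofReal, integral_complex_ofReal, hm, hm2]; simp [LA]
  rw [e]
  have e2 : ‖ξ‖^3 * ∫ x, x ^ 3 ∂P = ∫ x, ‖ξ‖^3 * x ^ 3 ∂P := by rw [integral_const_mul]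
  refine le_trans ?_ (show ‖ξ‖^3 * ∫ x, x ^ 3 ∂P ≤ _ by rw [mul_comm M]; gcongr)
  rw [e2]
  refine norm_integral_le_of_norm_le (hx3.const_mul _) ?_
  filter_upwards [ae_pos_of hP] with x hx
  have hr : 0 ≤ (ξ * x).re := by simp; positivity
  have h1 := tay3 hr
  have e3 : (1 - Complex.exp (-ξ * (x:ℂ))) - (ξ * (x:ℂ) - ξ^2/2 * ((x ^ 2 : ℝ) : ℂ)) = (1 - Complex.exp (-(ξ * x))) - (ξ * x - (ξ * x)^2/2) := by
    rw [neg_mul ξ]; push_cast; ring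
  rw [norm_mul ξ, Complex.norm_real, Real.norm_eq_abs, abs_of_pos hx] at h1
  rw [e3]
  calc _ ≤ (‖ξ‖ * x)^3 := h1
    _ = _ := by ring
end

open MeasureTheory Set Filter Topology

set_option maxHeartbeats 2000000 in
/-- The purely algebraic core of the Fourier bound. -/
lemma alg_small {ε t k M : ℝ} {ξ p v S : ℂ} (hε : 0 < ε) (ht : t = 1 - ε) (hε2 : ε ≤ 1/2) (hM : 1 ≤ M)
    (hξ : 0 ≤ ξ.re) (hSre : 0 ≤ S.re) (hS : S ^ 2 = ε ^ 2 + 2 * k * Complex.I)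
    (hv : ξ = k * Complex.I + t * v) (hp1 : ‖p - 1‖ ≤ ‖ξ‖) (hp2 : ‖p - (1 - ξ)‖ ≤ M * ‖ξ‖ ^ 2)
    (hv3 : ‖v - (ξ - ξ ^ 2 / 2)‖ ≤ M * ‖ξ‖ ^ 3)
    (hr : ‖ξ‖ ≤ 1 / (16 * M)) : ‖ξ‖ ^ 2 ≤ 8 * ‖S‖ ^ 2 ∧
      (ε ^ 2 + 2 * |k| ≤ 1 / (50000 * M ^ 2) → ∀ q : ℂ, q * (1 - t * p) = p → ‖q - 1 / S‖ ≤ 6 + 212 * M) := by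
  have ht0 : 1/2 ≤ t := by linarith
  have ht1 : t ≤ 1 := by linarith
  set R3 := v - (ξ - ξ ^ 2 / 2) with hR3
  set R2 := p - (1 - ξ) with hR2
  set A : ℂ := ε + t * ξ with hA
  have htc : (t:ℂ) = 1 - ε := by rw [ht]; push_cast; ring
  have hveq : v = R3 + (ξ - ξ^2/2) := by rw [hR3]; ring
  have hA2 : A ^ 2 = ε ^ 2 + 2 * t * k * Complex.I + 2 * t ^ 2 * R3 := by
    have h1 : ξ = k * Complex.I + t * (R3 + (ξ - ξ^2/2)) := by rw [← hveq]; exact hv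
    have he : (ε:ℂ) = 1 - t := by rw [htc]; ring
    rw [hA, he]
    linear_combination (2 * t) * h1
  have hnS : ‖S‖ ^ 2 = ‖(ε:ℂ) ^ 2 + 2 * k * Complex.I‖ := by rw [← norm_pow, hS]
  have hreS : ε ^ 2 ≤ ‖S‖ ^ 2 := by
    rw [hnS]
    have := Complex.re_le_norm ((ε:ℂ) ^ 2 + 2 * k * Complex.I)
    have e : ((ε:ℂ) ^ 2 + 2 * k * Complex.I).re = ε ^ 2 := by
      simp [← Complex.ofReal_pow]
    rw [e] at this; exact this
  have himS : 2 * |k| ≤ ‖S‖ ^ 2 := by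
    rw [hnS]
    have := Complex.abs_im_le_norm ((ε:ℂ) ^ 2 + 2 * k * Complex.I)
    have e : ((ε:ℂ) ^ 2 + 2 * k * Complex.I).im = 2 * k := by
      simp [← Complex.ofReal_pow]
    rw [e, abs_mul, abs_two] at this; exact this
  have hεS : ε ≤ ‖S‖ := by
    apply le_of_sq_le_sq hreS (norm_nonneg _) |> fun h => h
  have hs0 : 0 < ‖S‖ := hε.trans_le hεS
  have hup : ‖S‖ ^ 2 ≤ ε ^ 2 + 2 * |k| := by
    rw [hnS]
    refine (norm_add_le _ _).trans ?_
    simp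
  -- first claim
  have hAre : t * ‖ξ‖ ≤ ‖A‖ := by
    have h1 : A.re = ε + t * ξ.re := by simp [hA]
    have h2 : A.im = t * ξ.im := by simp [hA]
    have h3 : (t * ‖ξ‖) ^ 2 ≤ ‖A‖ ^ 2 := by
      rw [mul_pow, Complex.sq_norm, Complex.sq_norm, Complex.normSq_apply, Complex.normSq_apply, h1, h2]
      have : 0 ≤ t * ξ.re := by positivity
      nlinarith [mul_nonneg hε.le this]
    exact le_of_sq_le_sq h3 (norm_nonneg _)
  have hAn : ‖A‖ ^ 2 ≤ ‖S‖ ^ 2 + 2 * M * ‖ξ‖ ^ 3 := by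
    rw [← norm_pow, hA2]
    refine (norm_add_le _ _).trans ?_
    have h1 : ‖(ε:ℂ) ^ 2 + 2 * t * k * Complex.I‖ ≤ ‖S‖ ^ 2 := by
      rw [hnS]
      have e1 : ∀ a : ℝ, ‖(ε:ℂ) ^ 2 + 2 * a * Complex.I‖ ^ 2 = ε^4 + 4 * a^2 := by
        intro a
        rw [Complex.sq_norm, Complex.normSq_apply]
        simp [← Complex.ofReal_pow]; ring
      refine le_of_sq_le_sq ?_ (norm_nonneg _)
      have := e1 (t * k)
      rw [e1 k]
      push_cast at this
      rw [show (2:ℂ) * t * k * Complex.I = 2 * (t * k) * Complex.I by ring, this, mul_pow]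
      have : t ^ 2 ≤ 1 := by nlinarith
      nlinarith [sq_nonneg k]
    have h2 : ‖2 * (t:ℂ) ^ 2 * R3‖ ≤ 2 * M * ‖ξ‖ ^ 3 := by
      rw [norm_mul, norm_mul, norm_pow, Complex.norm_real, Real.norm_eq_abs, abs_of_nonneg (by linarith : 0 ≤ t), Complex.norm_ofNat]
      have : t ^ 2 ≤ 1 := by nlinarith
      calc 2 * t^2 * ‖R3‖ ≤ 2 * 1 * (M * ‖ξ‖^3) := by gcongr
        _ = _ := by ring
    linarith
  have hMr : M * ‖ξ‖ ≤ 1/16 := by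
    rw [le_div_iff₀ (by positivity)] at hr; linarith
  have hc1 : ‖ξ‖ ^ 2 ≤ 8 * ‖S‖ ^ 2 := by
    have h1 : (1/2 * ‖ξ‖)^2 ≤ ‖A‖ ^ 2 := by
      apply pow_le_pow_left₀ (by positivity)
      refine le_trans ?_ hAre
      gcongr
    have h2 : M * ‖ξ‖ ^ 3 ≤ 1/16 * ‖ξ‖^2 := by
      calc M * ‖ξ‖ ^ 3 = (M * ‖ξ‖) * ‖ξ‖^2 := by ring
        _ ≤ _ := by gcongr
    nlinarith
  refine ⟨hc1, fun hκ q hq => ?_⟩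
  set s := ‖S‖ with hs
  have hξs : ‖ξ‖ ≤ 3 * s := by
    refine le_of_sq_le_sq (hc1.trans ?_) (by positivity)
    nlinarith [sq_nonneg s]
  have hξs2 : ‖ξ‖ ^ 3 ≤ 24 * s ^ 3 := by
    calc ‖ξ‖ ^ 3 = ‖ξ‖ ^ 2 * ‖ξ‖ := by ring
      _ ≤ (8 * s ^ 2) * (3 * s) := by gcongr
      _ = _ := by ring
  have hSA2 : ‖S ^ 2 - A ^ 2‖ ≤ (1 + 48 * M) * s ^ 3 := by
    have e : S ^ 2 - A ^ 2 = 2 * ε * k * Complex.I - 2 * t ^ 2 * R3 := by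
      rw [hS, hA2, htc]; ring
    rw [e]
    refine (norm_sub_le _ _).trans ?_
    have h1 : ‖2 * (ε:ℂ) * k * Complex.I‖ ≤ s ^ 3 := by
      simp only [norm_mul, Complex.norm_real, Complex.norm_I, Complex.norm_ofNat, Real.norm_eq_abs, abs_of_pos hε, mul_one]
      calc 2 * ε * |k| = ε * (2 * |k|) := by ring
        _ ≤ s * s ^ 2 := by gcongr
        _ = _ := by ring
    have h2 : ‖2 * (t:ℂ) ^ 2 * R3‖ ≤ 48 * M * s ^ 3 := by
      rw [norm_mul, norm_mul, norm_pow, Complex.norm_real, Real.norm_eq_abs, abs_of_nonneg (by linarith : 0 ≤ t), Complex.norm_ofNat]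
      have : t ^ 2 ≤ 1 := by nlinarith
      calc 2 * t^2 * ‖R3‖ ≤ 2 * 1 * (M * (24 * s ^ 3)) := by gcongr; exact hv3.trans (by gcongr)
        _ = _ := by ring
    linarith
  have hSre2 : s ≤ 2 * S.re := by
    refine le_of_sq_le_sq ?_ (by positivity)
    rw [hs, Complex.sq_norm, Complex.normSq_apply]
    have h1 := congrArg Complex.re hS
    have e : ((ε:ℂ) ^ 2 + 2 * k * Complex.I).re = ε ^ 2 := by
      simp [← Complex.ofReal_pow]
    rw [e, sq, Complex.mul_re] at h1
    nlinarith [sq_nonneg ε, sq_nonneg S.re]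
  have hSpA : s / 2 ≤ ‖S + A‖ := by
    have h1 : 0 ≤ A.re := by
      have h1 : A.re = ε + t * ξ.re := by simp [hA]
      rw [h1]; positivity
    have := Complex.re_le_norm (S + A)
    rw [Complex.add_re] at this
    linarith
  have hSA : ‖S - A‖ ≤ 2 * (1 + 48 * M) * s ^ 2 := by
    have h1 : ‖S - A‖ * ‖S + A‖ ≤ (1 + 48 * M) * s ^ 3 := by
      rw [← norm_mul]; convert hSA2 using 2; ring
    have h2 : ‖S - A‖ * (s/2) ≤ (1 + 48 * M) * s ^ 3 := le_trans (by gcongr) h1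
    have h3 : ‖S - A‖ * (s/2) ≤ (2 * (1 + 48 * M) * s ^ 2) * (s/2) := h2.trans (le_of_eq (by ring))
    exact le_of_mul_le_mul_right h3 (by positivity)
  set B : ℂ := 1 - t * p with hB
  have hBA : B = A - t * R2 := by rw [hB, hA, hR2, htc]; ring
  have hSB : ‖S - B‖ ≤ 106 * M * s ^ 2 := by
    have e : S - B = (S - A) + t * R2 := by rw [hBA]; ring
    rw [e]
    refine (norm_add_le _ _).trans ?_
    have h2 : ‖(t:ℂ) * R2‖ ≤ 8 * M * s ^ 2 := by
      rw [norm_mul, Complex.norm_real, Real.norm_eq_abs, abs_of_nonneg (by linarith : 0 ≤ t)]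
      calc t * ‖R2‖ ≤ 1 * (M * (8 * s ^ 2)) := by gcongr; exact hp2.trans (by gcongr)
        _ = _ := by ring
    nlinarith [sq_nonneg s]
  have hsmall : 106 * M * s ≤ 1/2 := by
    refine le_of_sq_le_sq ?_ (by positivity)
    have h1 : s ^ 2 ≤ 1 / (50000 * M ^ 2) := hup.trans hκ
    rw [le_div_iff₀ (by positivity)] at h1
    nlinarith
  have hBs : s / 2 ≤ ‖B‖ := by
    have h1 : s ≤ ‖S - B‖ + ‖B‖ := by
      calc s = ‖(S - B) + B‖ := by rw [sub_add_cancel]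
        _ ≤ _ := norm_add_le _ _
    nlinarith
  have hB0 : B ≠ 0 := by
    intro h; rw [h, norm_zero] at hBs; linarith
  have hS0 : S ≠ 0 := by
    intro h; rw [hs, h, norm_zero] at hs0; exact lt_irrefl _ hs0
  have hqe : q - 1 / S = (p - 1) / B + (S - B) / (B * S) := by
    have : q = p / B := by rw [eq_div_iff hB0]; exact hq
    rw [this]; field_simp; ring
  rw [hqe]
  refine (norm_add_le _ _).trans ?_
  have h1 : ‖(p - 1) / B‖ ≤ 6 := by
    rw [norm_div, div_le_iff₀ (by linarith)]
    linarith
  have h2 : ‖(S - B) / (B * S)‖ ≤ 212 * M := by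
    rw [norm_div, norm_mul, div_le_iff₀ (by positivity)]
    calc ‖S - B‖ ≤ 106 * M * s ^ 2 := hSB
      _ = 212 * M * (s / 2 * s) := by ring
      _ ≤ _ := by gcongr
  linarith

open MeasureTheory Set Filter Topology

set_option maxHeartbeats 1000000 in
lemma Dbd {P Q : Measure ℝ} [IsFiniteMeasure P] [IsFiniteMeasure Q] (hP : P (Iic 0) = 0) (hQ : Q (Iic 0) = 0)
    (hxP : Integrable (fun x => x) P) (hm : ∫ x, x ∂P = 1)
    (hx2 : Integrable (fun x => x ^ 2) P) (hm2 : ∫ x, x ^ 2 ∂P = 1)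
    {M : ℝ} (hx3 : Integrable (fun x => x ^ 3) P) (hm3 : ∫ x, x ^ 3 ∂P ≤ M) (hM : 1 ≤ M)
    {t ε : ℝ} (ht : 0 ≤ t) (hε : 0 < ε) (htε : t = 1 - ε)
    (hxQ : Integrable (fun x => x) Q) (hmQ : ∫ x, x ∂Q ≤ 1 / ε)
    (hreal : ∀ η : ℝ, 0 < η → LA P ((η:ℂ) + t * LA Q η) = LA Q η)
    {k : ℝ} {S : ℂ} (hSre : 0 ≤ S.re) (hS : S ^ 2 = ε ^ 2 + 2 * k * Complex.I) :
    ‖LB Q (k * Complex.I) - 1 / S‖ ≤ 4 * |k| / ε ^ 3 ∧ ‖LB Q (k * Complex.I) - 1 / S‖ ≤ 2 / ε ∧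
    (ε ^ 2 + 2 * |k| ≤ 1 / (50000 * M ^ 2) → ‖LB Q (k * Complex.I) - 1 / S‖ ≤ 6 + 212 * M) := by
  have hC5 := C5 hP hQ hxP hxQ ht hreal
  have hre0 : ∀ k : ℝ, 0 ≤ ((k:ℂ) * Complex.I).re := fun k => by simp
  have hnS : ‖S‖ ^ 2 = ‖(ε:ℂ) ^ 2 + 2 * k * Complex.I‖ := by rw [← norm_pow, hS]
  have hεS : ε ≤ ‖S‖ := by
    refine le_of_sq_le_sq ?_ (norm_nonneg _)
    rw [hnS]
    have := Complex.re_le_norm ((ε:ℂ) ^ 2 + 2 * k * Complex.I)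
    have e : ((ε:ℂ) ^ 2 + 2 * k * Complex.I).re = ε ^ 2 := by
      simp [← Complex.ofReal_pow]
    rw [e] at this; exact this
  have hs0 : 0 < ‖S‖ := hε.trans_le hεS
  have hS0 : S ≠ 0 := norm_pos_iff.1 hs0
  have hε1 : ε ≤ 1 := by linarith
  have ht1 : t ≤ 1 := by linarith
  have hεc : (ε:ℂ) ≠ 0 := by exact_mod_cast hε.ne'
  obtain ⟨hξ, hLA, hLB⟩ := hC5 (k * Complex.I) (hre0 k)
  refine ⟨?_, ?_, ?_⟩
  · set ξ := (k:ℂ) * Complex.I + t * LA Q (k * Complex.I) with hξd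
    set p := LB P ξ with hp
    have hpn : ‖p‖ ≤ 1 := (LB_norm hP hxP hξ).trans hm.le
    have hp1 : ‖p - 1‖ ≤ ‖ξ‖ := LB_tay1 hP hxP hm hx2 hm2 hξ
    have hξn : ‖ξ‖ ≤ 2 * |k| / ε := by
      have h1 : ‖LA Q (k * Complex.I)‖ ≤ |k| * (1/ε) := by
        refine (LA_le hQ hxQ (hre0 k)).trans ?_
        simp only [norm_mul, Complex.norm_real, Complex.norm_I, Real.norm_eq_abs, mul_one]
        gcongr
      rw [hξd]
      refine (norm_add_le _ _).trans ?_
      simp only [norm_mul, Complex.norm_real, Complex.norm_I, Real.norm_eq_abs, mul_one, abs_of_nonneg ht]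
      have h2 : |k| ≤ |k| * (1/ε) := le_mul_of_one_le_right (abs_nonneg _) (by rw [le_div_iff₀ hε]; linarith)
      have h3 : t * ‖LA Q (k * Complex.I)‖ ≤ 1 * (|k| * (1/ε)) := by gcongr
      calc _ ≤ |k| * (1/ε) + |k| * (1/ε) := by linarith
        _ = _ := by ring
    have hB : ε ≤ ‖1 - t * p‖ := by
      have h1 : ‖(t:ℂ) * p‖ ≤ t * 1 := by
        rw [norm_mul, Complex.norm_real, Real.norm_eq_abs, abs_of_nonneg ht]; gcongr
      have h2 := norm_sub_norm_le (1:ℂ) (t * p)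
      rw [norm_one] at h2; linarith
    have hB0 : 1 - t * p ≠ 0 := norm_pos_iff.1 (hε.trans_le hB)
    have hq : LB Q (k * Complex.I) = p / (1 - t * p) := by rw [eq_div_iff hB0]; exact hLB
    have e : LB Q (k * Complex.I) - 1 / S = (p - 1) / (ε * (1 - t * p)) + (S ^ 2 - ε ^ 2) / (ε * S * (S + ε)) := by
      have hSe : S + ε ≠ 0 := by
        intro h
        have := congrArg Complex.re h
        simp at this; linarith
      have htc : (t:ℂ) = 1 - ε := by rw [htε]; push_cast; ring
      rw [hq]
      rw [show S ^ 2 - (ε:ℂ) ^ 2 = (S + ε) * (S - ε) by ring]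
      rw [show ((S + ε) * (S - ε)) / (ε * S * (S + ε)) = 1/ε - 1/S by field_simp]
      have : p / (1 - t * p) = (p - 1) / (ε * (1 - t * p)) + 1/ε := by
        rw [div_add_div _ _ (mul_ne_zero hεc hB0) hεc, div_eq_div_iff hB0 (mul_ne_zero (mul_ne_zero hεc hB0) hεc)]
        rw [htc]; ring
      rw [this]; ring
    rw [e]
    refine (norm_add_le _ _).trans ?_
    have h1 : ‖(p - 1) / (ε * (1 - t * p))‖ ≤ 2 * |k| / ε ^ 3 := by
      rw [norm_div, norm_mul, Complex.norm_real, Real.norm_eq_abs, abs_of_pos hε]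
      calc _ ≤ (2 * |k| / ε) / (ε * ε) := by gcongr; exact hp1.trans hξn
        _ = _ := by field_simp
    have h2 : ‖(S ^ 2 - ε ^ 2) / (ε * S * (S + ε))‖ ≤ 2 * |k| / ε ^ 3 := by
      have hSe : ε ≤ ‖S + ε‖ := by
        have := Complex.re_le_norm (S + ε)
        simp at this; linarith
      rw [hS, norm_div, norm_mul, norm_mul, add_sub_cancel_left, Complex.norm_real, Real.norm_eq_abs, abs_of_pos hε]
      simp only [norm_mul, Complex.norm_real, Complex.norm_I, Real.norm_eq_abs, mul_one, Complex.norm_ofNat]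
      calc _ ≤ (2 * |k|) / (ε * ε * ε) := by gcongr
        _ = _ := by ring
    calc _ ≤ 2 * |k| / ε ^ 3 + 2 * |k| / ε ^ 3 := add_le_add h1 h2
      _ = _ := by ring
  · refine (norm_sub_le _ _).trans ?_
    have h1 := (LB_norm hQ hxQ (hre0 k)).trans hmQ
    have h2 : ‖1 / S‖ ≤ 1 / ε := by rw [norm_div, norm_one]; gcongr
    calc _ ≤ 1/ε + 1/ε := add_le_add h1 h2
      _ = _ := by ring
  · intro hκ
    have hM2 : 1 ≤ M ^ 2 := one_le_pow₀ hM
    have hκ' := hκ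
    rw [le_div_iff₀ (by positivity)] at hκ'
    have hε2 : ε ≤ 1/2 := by
      refine le_of_sq_le_sq ?_ (by norm_num)
      have := abs_nonneg k
      nlinarith [sq_nonneg ε]
    set ξ : ℝ → ℂ := fun a => (a:ℂ) * Complex.I + t * LA Q (a * Complex.I) with hξd
    have hcore : ∀ a : ℝ, ∀ S : ℂ, 0 ≤ S.re → S ^ 2 = ε ^ 2 + 2 * a * Complex.I → ‖ξ a‖ ≤ 1 / (16 * M) → ‖ξ a‖ ^ 2 ≤ 8 * ‖S‖ ^ 2 ∧
      (ε ^ 2 + 2 * |a| ≤ 1 / (50000 * M ^ 2) → ∀ q : ℂ, q * (1 - t * LB P (ξ a)) = LB P (ξ a) → ‖q - 1 / S‖ ≤ 6 + 212 * M) := by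
      intro a S hSre hS hr
      obtain ⟨hξ, hLA, hLB⟩ := hC5 (a * Complex.I) (hre0 a)
      have hv : ξ a = a * Complex.I + t * LA P (ξ a) := by
        show _ = (a:ℂ) * Complex.I + t * LA P ((a:ℂ) * Complex.I + t * LA Q (a * Complex.I))
        rw [hLA]
      exact alg_small hε htε hε2 hM hξ hSre hS hv (LB_tay1 hP hxP hm hx2 hm2 hξ) (LB_tay2 hP hxP hm hx2 hm2 hx3 hm3 hξ)
        (LA_tay3 hP hxP hm hx2 hm2 hx3 hm3 hξ) hr
    have hcont : Continuous (fun a : ℝ => ‖ξ (a * k)‖) := by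
      have h1 : Continuous (fun a : ℝ => LA Q (((a * k : ℝ) : ℂ) * Complex.I)) :=
        (LA_cont hQ).comp_continuous (by fun_prop) (fun a => hre0 _)
      simp only [hξd]
      fun_prop
    have hr0 : 0 < 1 / (16 * M) := by positivity
    have hle : ‖ξ k‖ ≤ 1 / (16 * M) := by
      by_contra hcon
      push Not at hcon
      have hz : ‖ξ (0 * k)‖ = 0 := by simp [hξd, LA]
      obtain ⟨a, ha, hae⟩ := intermediate_value_Icc (zero_le_one (α := ℝ)) hcont.continuousOn (show 1 / (16 * M) ∈ Icc _ _ from ⟨by rw [hz]; positivity, by simpa using hcon.le⟩)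
      simp only at hae
      -- choose a square root
      obtain ⟨S', hS're, hS'⟩ : ∃ S' : ℂ, 0 ≤ S'.re ∧ S' ^ 2 = ε ^ 2 + 2 * (a * k : ℝ) * Complex.I := by
        obtain ⟨z, hz⟩ := IsAlgClosed.exists_pow_nat_eq ((ε:ℂ) ^ 2 + 2 * (a * k : ℝ) * Complex.I) (n := 2) (by norm_num)
        rcases le_total 0 z.re with h | h
        · exact ⟨z, h, hz⟩
        · exact ⟨-z, by simpa using h, by rw [neg_sq]; exact hz⟩
      have h1 := (hcore (a * k) S' hS're hS' hae.le).1
      have h2 : ‖S'‖ ^ 2 ≤ ε ^ 2 + 2 * |k| := by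
        rw [← norm_pow, hS']
        refine (norm_add_le _ _).trans ?_
        simp only [norm_mul, norm_pow, Complex.norm_real, Complex.norm_I, Real.norm_eq_abs, mul_one, Complex.norm_ofNat, sq_abs, abs_mul, abs_of_nonneg ha.1]
        have : a * |k| ≤ 1 * |k| := by gcongr; exact ha.2
        linarith
      rw [hae] at h1
      have h3 : (1 / (16 * M)) ^ 2 ≤ 8 * (1 / (50000 * M ^ 2)) := by linarith
      have e1 : (1 / (16 * M)) ^ 2 = 1/256 * (1/M^2) := by field_simp; norm_num
      have e2 : 8 * (1 / (50000 * M ^ 2)) = 8/50000 * (1/M^2) := by field_simp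
      rw [e1, e2] at h3
      have : 0 < 1/M^2 := by positivity
      linarith
    exact (hcore k S hSre hS hle).2 hκ _ hLB

open MeasureTheory Set Filter Topology ProbabilityTheory

/-- `∫_Y^X e^{ikz} dz`. -/
noncomputable def JK (Y X k : ℝ) : ℂ := ∫ z in Ioc Y X, Complex.exp (Complex.I * k * z)

lemma norm_expI (a b : ℝ) : ‖Complex.exp (Complex.I * a * b)‖ = 1 := by
  rw [show Complex.I * a * b = ((a * b : ℝ) : ℂ) * Complex.I by push_cast; ring]
  exact Complex.norm_exp_ofReal_mul_I _

lemma JK_le1 {Y X : ℝ} (h : Y ≤ X) (k : ℝ) : ‖JK Y X k‖ ≤ X - Y := by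
  have := norm_setIntegral_le_of_norm_le_const (μ := volume) (s := Ioc Y X) (f := fun z : ℝ => Complex.exp (Complex.I * k * z)) (C := 1) (by simp)
    (fun z _ => (norm_expI k z).le)
  simpa [JK, h] using this

lemma JK_le2 {Y X : ℝ} (h : Y ≤ X) {k : ℝ} (hk : k ≠ 0) : ‖JK Y X k‖ ≤ 2 / |k| := by
  have hk' : Complex.I * k ≠ 0 := mul_ne_zero Complex.I_ne_zero (by exact_mod_cast hk)
  have e := integral_exp_mul_complex (a := Y) (b := X) hk'
  rw [intervalIntegral.integral_of_le h] at e
  unfold JK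
  rw [e, norm_div, norm_mul, Complex.norm_I, one_mul, Complex.norm_real, Real.norm_eq_abs]
  gcongr
  refine (norm_sub_le _ _).trans ?_
  rw [norm_expI, norm_expI]; norm_num

lemma JK_cont (Y X : ℝ) : Continuous (JK Y X) := by
  unfold JK
  refine continuous_of_dominated (bound := fun _ => 1) (fun k => by fun_prop) (fun k => ?_) (by simp) ?_
  · exact Eventually.of_forall fun z => (norm_expI k z).le
  · exact Eventually.of_forall fun z => by fun_prop

lemma gauss_int {v : ℝ} (hv : 0 < v) : Integrable (fun k : ℝ => Real.exp (-(v/2) * k ^ 2)) :=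
  integrable_exp_neg_mul_sq (by positivity)

lemma gauss_cast (v k : ℝ) : ‖Complex.exp (-((v/2 : ℝ) : ℂ) * k ^ 2)‖ = Real.exp (-(v/2) * k ^ 2) := by
  rw [show (-((v/2 : ℝ) : ℂ) * (k:ℂ) ^ 2) = ((-(v/2) * k ^ 2 : ℝ) : ℂ) by push_cast; ring, Complex.norm_exp_ofReal]

lemma psi_eq {v : NNReal} (hv : 0 < v) {Y X : ℝ} (x : ℝ) :
    ∫ k : ℝ, Complex.exp (-((v/2 : ℝ) : ℂ) * k ^ 2) * JK Y X k * Complex.exp (-(k * Complex.I) * x)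
      = ((2 * Real.pi * (gaussianReal x v).real (Ioc Y X) : ℝ) : ℂ) := by
  have hv' : (0:ℝ) < v := hv
  have e1 : ∀ k : ℝ, Complex.exp (-((v/2 : ℝ) : ℂ) * k ^ 2) * JK Y X k * Complex.exp (-(k * Complex.I) * x)
      = ∫ z in Ioc Y X, Complex.exp (Complex.I * ((z - x : ℝ) : ℂ) * k) * Complex.exp (-((v/2 : ℝ) : ℂ) * k ^ 2) := by
    intro k
    unfold JK
    rw [mul_right_comm, ← integral_const_mul]
    refine integral_congr_ae (Eventually.of_forall fun z => ?_)
    simp only [← Complex.exp_add]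
    congr 1
    push_cast; ring
  simp_rw [e1]
  rw [integral_integral_swap]
  · have e2 : ∀ z : ℝ, ∫ k : ℝ, Complex.exp (Complex.I * ((z - x : ℝ) : ℂ) * k) * Complex.exp (-((v/2 : ℝ) : ℂ) * k ^ 2)
        = ((2 * Real.pi * gaussianPDFReal x v z : ℝ) : ℂ) := by
      intro z
      rw [fourierIntegral_gaussian (by simpa using hv')]
      have h1 : ((Real.pi : ℂ) / ((v/2 : ℝ) : ℂ)) ^ (1/2 : ℂ) = ((Real.sqrt (Real.pi / (v/2)) : ℝ) : ℂ) := by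
        rw [← Complex.ofReal_div, Real.sqrt_eq_rpow, Complex.ofReal_cpow (by positivity)]
        push_cast; rfl
      have h2 : Complex.exp (-((z - x : ℝ) : ℂ) ^ 2 / (4 * ((v/2 : ℝ) : ℂ))) = ((Real.exp (-(z-x)^2 / (2 * v)) : ℝ) : ℂ) := by
        push_cast; congr 1; field_simp; ring
      rw [h1, h2, ← Complex.ofReal_mul]
      congr 1
      unfold gaussianPDFReal
      rw [← mul_assoc]
      congr 1
      rw [← div_eq_mul_inv, eq_div_iff (by positivity), ← Real.sqrt_mul (by positivity)]
      rw [show Real.pi / (v/2) * (2 * Real.pi * v) = (2 * Real.pi) ^ 2 by field_simp]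
      exact Real.sqrt_sq (by positivity)
    simp_rw [e2]
    rw [integral_complex_ofReal, integral_const_mul]
    congr 2
    rw [measureReal_def, gaussianReal_apply_eq_integral _ hv.ne', ENNReal.toReal_ofReal]
    exact integral_nonneg fun z => gaussianPDFReal_nonneg _ _ _
  · refine Integrable.mono' (g := fun p : ℝ × ℝ => Real.exp (-((v:ℝ)/2) * p.1 ^ 2) * 1) ?_ ?_ ?_
    · exact (gauss_int hv').mul_prod (integrable_const 1)
    · apply Continuous.aestronglyMeasurable; simp only [Function.uncurry_def]; fun_prop
    · refine Eventually.of_forall fun p => ?_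
      simp only [Function.uncurry_def]
      rw [norm_mul, norm_expI, gauss_cast, one_mul, mul_one]

lemma smooth_fourier {v : NNReal} (hv : 0 < v) {Y X : ℝ} (hYX : Y ≤ X) (α : Measure ℝ) [IsFiniteMeasure α] :
    Integrable (fun k : ℝ => Complex.exp (-((v/2 : ℝ) : ℂ) * k ^ 2) * JK Y X k * ∫ x : ℝ, Complex.exp (-(k * Complex.I) * x) ∂α) ∧
    ((2 * Real.pi * ∫ x, (gaussianReal x v).real (Ioc Y X) ∂α : ℝ) : ℂ)
      = ∫ k : ℝ, Complex.exp (-((v/2 : ℝ) : ℂ) * k ^ 2) * JK Y X k * ∫ x : ℝ, Complex.exp (-(k * Complex.I) * x) ∂α := by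
  have hv' : (0:ℝ) < v := hv
  have hI : Integrable (Function.uncurry fun (x:ℝ) (k:ℝ) => Complex.exp (-((v/2 : ℝ) : ℂ) * k ^ 2) * JK Y X k * Complex.exp (-(k * Complex.I) * x)) (α.prod volume) := by
    refine Integrable.mono' (g := fun p : ℝ × ℝ => 1 * (Real.exp (-((v:ℝ)/2) * p.2 ^ 2) * (X - Y))) ?_ ?_ ?_
    · exact (integrable_const (1:ℝ)).mul_prod ((gauss_int hv').mul_const _)
    · apply Continuous.aestronglyMeasurable; simp only [Function.uncurry_def]
      have := JK_cont Y X
      fun_prop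
    · refine Eventually.of_forall fun p => ?_
      simp only [Function.uncurry_def]
      rw [show -((p.2:ℂ) * Complex.I) * (p.1:ℂ) = Complex.I * ((-p.2 : ℝ) : ℂ) * (p.1 : ℂ) by push_cast; ring,
        norm_mul, norm_expI, norm_mul, gauss_cast, one_mul, mul_one]
      gcongr
      exact JK_le1 hYX _
  constructor
  · have := hI.integral_prod_right
    simpa [Function.uncurry_def, integral_const_mul] using this
  · have := integral_integral_swap hI
    simp_rw [psi_eq hv, integral_const_mul] at this
    rw [integral_complex_ofReal, integral_const_mul] at this
    exact this

lemma gauss_swap (v : NNReal) (Y X : ℝ) (α : Measure ℝ) [IsFiniteMeasure α] :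
    ∫ x, (gaussianReal x v).real (Ioc Y X) ∂α = ∫ u, α.real (Ioc (Y - u) (X - u)) ∂(gaussianReal 0 v) := by
  have hI : Integrable (Function.uncurry fun (x:ℝ) (u:ℝ) => (Ioc Y X).indicator (fun _ => (1:ℝ)) (x + u)) (α.prod (gaussianReal 0 v)) := by
    refine Integrable.of_bound (C := 1) ?_ ?_
    · apply Measurable.aestronglyMeasurable
      simp only [Function.uncurry_def]
      exact (measurable_const.indicator measurableSet_Ioc).comp (measurable_fst.add measurable_snd)
    · refine Eventually.of_forall fun p => ?_
      simp only [Function.uncurry_def, indicator]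
      split_ifs <;> simp
  have h := integral_integral_swap hI
  have e1 : ∀ x : ℝ, ∫ u, (Ioc Y X).indicator (fun _ => (1:ℝ)) (x + u) ∂(gaussianReal 0 v) = (gaussianReal x v).real (Ioc Y X) := by
    intro x
    have h2 := gaussianReal_map_const_add (μ := 0) (v := v) x
    rw [zero_add] at h2
    rw [← h2, map_measureReal_apply (by fun_prop) measurableSet_Ioc, ← integral_indicator_one (measurableSet_Ioc.preimage (by fun_prop))]
    rfl
  have e2 : ∀ u : ℝ, ∫ x, (Ioc Y X).indicator (fun _ => (1:ℝ)) (x + u) ∂α = α.real (Ioc (Y - u) (X - u)) := by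
    intro u
    rw [← integral_indicator_one measurableSet_Ioc]
    refine integral_congr_ae (Eventually.of_forall fun x => ?_)
    simp only [indicator, mem_Ioc, Pi.one_apply, sub_lt_iff_lt_add, le_sub_iff_add_le]
  simp_rw [e1, e2] at h
  exact h

open MeasureTheory Set Filter Topology ProbabilityTheory

section
variable (α : Measure ℝ) [IsFiniteMeasure α]

lemma cdf_mono : Monotone (fun X => α.real (Iic X)) := fun _ _ h => measureReal_mono (Iic_subset_Iic.2 h)

lemma cdf_le (X : ℝ) : α.real (Iic X) ≤ α.real univ := measureReal_mono (subset_univ _)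

lemma cdf_int (X : ℝ) (γ : Measure ℝ) [IsFiniteMeasure γ] : Integrable (fun u => α.real (Iic (X - u))) γ := by
  refine Integrable.of_bound (C := α.real univ) ?_ (Eventually.of_forall fun u => ?_)
  · exact ((cdf_mono α).measurable.comp (measurable_const.sub measurable_id)).aestronglyMeasurable
  · rw [Real.norm_eq_abs, abs_of_nonneg measureReal_nonneg]; exact cdf_le α _

lemma cdf_Ioc {Y X : ℝ} (h : Y ≤ X) : α.real (Ioc Y X) = α.real (Iic X) - α.real (Iic Y) := by
  rw [← Iic_sdiff_Iic, measureReal_sdiff (Iic_subset_Iic.2 h) measurableSet_Iic]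

variable (h0 : α (Iic 0) = 0)
include h0
lemma cdf_lim (γ : Measure ℝ) [IsFiniteMeasure γ] :
    Tendsto (fun j : ℕ => ∫ u, α.real (Iic (-(j:ℝ) - u)) ∂γ) atTop (𝓝 0) := by
  have : Tendsto (fun j : ℕ => ∫ u, α.real (Iic (-(j:ℝ) - u)) ∂γ) atTop (𝓝 (∫ _u, (0:ℝ) ∂γ)) := by
    refine tendsto_integral_of_dominated_convergence (fun _ => α.real univ) (fun j => (cdf_int α _ γ).aestronglyMeasurable) (integrable_const _) (fun j => Eventually.of_forall fun u => ?_) (Eventually.of_forall fun u => ?_)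
    · rw [Real.norm_eq_abs, abs_of_nonneg measureReal_nonneg]; exact cdf_le α _
    · refine tendsto_const_nhds.congr' ?_
      filter_upwards [tendsto_natCast_atTop_atTop.eventually_ge_atTop (-u)] with j hj
      symm
      rw [measureReal_def, measure_mono_null (Iic_subset_Iic.2 (by linarith)) h0]; rfl
  simpa using this
end

/-- Bound on the Gaussian-smoothed difference of distribution functions. -/
lemma smooth_bound {α β : Measure ℝ} [IsFiniteMeasure α] [IsFiniteMeasure β] (hα : α (Iic 0) = 0) (hβ : β (Iic 0) = 0)
    {v : NNReal} (hv : 0 < v) {b : ℝ → ℝ} (hb : Integrable b)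
    (hD : ∀ Y X k : ℝ, Y ≤ X → Real.exp (-((v:ℝ)/2) * k ^ 2) * ‖JK Y X k‖ *
      ‖(∫ x : ℝ, Complex.exp (-(k * Complex.I) * x) ∂α) - ∫ x : ℝ, Complex.exp (-(k * Complex.I) * x) ∂β‖ ≤ b k) (X : ℝ) :
    |∫ u, (α.real (Iic (X - u)) - β.real (Iic (X - u))) ∂(gaussianReal 0 v)| ≤ (∫ k, b k) / (2 * Real.pi) := by
  set γ := gaussianReal 0 v with hγ
  have key : ∀ Y, Y ≤ X → |(∫ u, (α.real (Iic (X - u)) - β.real (Iic (X - u))) ∂γ)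
      - (∫ u, α.real (Iic (Y - u)) ∂γ) + ∫ u, β.real (Iic (Y - u)) ∂γ| ≤ (∫ k, b k) / (2 * Real.pi) := by
    intro Y hY
    obtain ⟨iα, eα⟩ := smooth_fourier hv hY α
    obtain ⟨iβ, eβ⟩ := smooth_fourier hv hY β
    rw [gauss_swap] at eα eβ
    have e1 : ∀ (α : Measure ℝ) [IsFiniteMeasure α], ∫ u, α.real (Ioc (Y - u) (X - u)) ∂γ
        = (∫ u, α.real (Iic (X - u)) ∂γ) - ∫ u, α.real (Iic (Y - u)) ∂γ := by
      intro α _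
      rw [← integral_sub (cdf_int α X γ) (cdf_int α Y γ)]
      refine integral_congr_ae (Eventually.of_forall fun u => ?_)
      exact cdf_Ioc α (by linarith)
    rw [← hγ, e1] at eα eβ
    rw [integral_sub (cdf_int α X γ) (cdf_int β X γ)]
    have e2 := congrArg₂ (· - ·) eα eβ
    rw [← integral_sub iα iβ] at e2
    have e3 : ‖∫ k : ℝ, (Complex.exp (-((v/2 : ℝ) : ℂ) * k ^ 2) * JK Y X k * (∫ x : ℝ, Complex.exp (-(k * Complex.I) * x) ∂α)
       - Complex.exp (-((v/2 : ℝ) : ℂ) * k ^ 2) * JK Y X k * ∫ x : ℝ, Complex.exp (-(k * Complex.I) * x) ∂β)‖ ≤ ∫ k, b k := by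
      refine norm_integral_le_of_norm_le hb (Eventually.of_forall fun k => ?_)
      rw [← mul_sub, norm_mul, norm_mul, gauss_cast]
      exact hD Y X k hY
    rw [← e2, ← Complex.ofReal_sub, Complex.norm_real, Real.norm_eq_abs, ← mul_sub, abs_mul, abs_of_pos (by positivity)] at e3
    rw [le_div_iff₀ (by positivity), mul_comm]
    refine le_trans (le_of_eq ?_) e3
    congr 2
    ring
  have lim := ((tendsto_const_nhds (x := ∫ u, (α.real (Iic (X - u)) - β.real (Iic (X - u))) ∂γ)).sub (cdf_lim α hα γ)).add (cdf_lim β hβ γ)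
  have lim2 := lim.abs
  rw [sub_zero, add_zero] at lim2
  refine le_of_tendsto lim2 ?_
  filter_upwards [tendsto_natCast_atTop_atTop.eventually_ge_atTop (-X)] with j hj
  exact key _ (by linarith)

lemma gauss_tail {w : NNReal} (hw : 0 < w) : 3/4 ≤ (gaussianReal 0 (w^2)).real {u | |u| < 2 * w} := by
  have hm : MemLp id 2 (gaussianReal 0 (w^2)) := by
    have := memLp_id_gaussianReal (μ := 0) (v := w^2) 2
    simpa using this
  have hw' : (0:ℝ) < w := hw
  have h := meas_ge_le_variance_div_sq hm (c := 2 * w) (by positivity)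
  rw [variance_id_gaussianReal] at h
  simp only [id, integral_id_gaussianReal, sub_zero] at h
  have h2 : (gaussianReal 0 (w^2)).real {u | 2 * (w:ℝ) ≤ |u|} ≤ 1/4 := by
    rw [measureReal_def]
    refine ENNReal.toReal_le_of_le_ofReal (by norm_num) (h.trans ?_)
    apply ENNReal.ofReal_le_ofReal
    push_cast
    rw [div_le_iff₀ (by positivity)]
    nlinarith
  have h3 : {u : ℝ | |u| < 2 * w} = {u : ℝ | 2 * (w:ℝ) ≤ |u|}ᶜ := by ext u; simp
  have hms : MeasurableSet {u : ℝ | 2 * (w:ℝ) ≤ |u|} := measurableSet_le measurable_const (by fun_prop)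
  rw [h3, measureReal_compl hms]
  simp only [probReal_univ]; linarith

lemma deconv_aux {f : ℝ → ℝ} {w : NNReal} (hw : 0 < w) {δ ω E : ℝ} (hδ : ∀ x, |f x| ≤ δ) (hfm : Measurable f)
    (hω0 : 0 ≤ ω) (hω : ∀ x y : ℝ, x ≤ y → y ≤ x + 4 * w → f x - ω ≤ f y)
    (hE : ∀ X, |∫ u, f (X - u) ∂(gaussianReal 0 (w^2))| ≤ E) (X : ℝ) : |f X| ≤ ω + 4/3 * E + δ/3 := by
  have hδ0 : 0 ≤ δ := (abs_nonneg _).trans (hδ 0)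
  set γ := gaussianReal 0 (w^2)
  set T : Set ℝ := {u | |u| < 2 * w} with hT
  have hTm : MeasurableSet T := measurableSet_lt (by fun_prop) measurable_const
  have hg := gauss_tail hw
  have hE0 : 0 ≤ E := (abs_nonneg _).trans (hE 0)
  -- one-sided estimates
  have gen : ∀ (g : ℝ → ℝ), Measurable g → (∀ u, |g u| ≤ δ) → ∀ a, (0 ≤ a) → (∀ u ∈ T, a ≤ g u) →
      3/4 * a - δ / 4 ≤ ∫ u, g u ∂γ := by
    intro g hgm hgδ a ha hga
    have hi : Integrable g γ := Integrable.of_bound hgm.aestronglyMeasurable δ (Eventually.of_forall fun u => by rw [Real.norm_eq_abs]; exact hgδ u)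
    have i1 : Integrable (fun u => T.indicator (fun _ => a + δ) u) γ := (integrable_const _).indicator hTm
    have i2 : Integrable (fun u => T.indicator (fun _ => a + δ) u - δ) γ := i1.sub (integrable_const _)
    have h1 : ∫ u, (T.indicator (fun _ => a + δ) u - δ) ∂γ ≤ ∫ u, g u ∂γ := by
      refine integral_mono i2 hi fun u => ?_
      simp only [indicator]
      split_ifs with h
      · have := hga u h; linarith
      · have := (abs_le.1 (hgδ u)).1; linarith
    rw [integral_sub i1 (integrable_const _), integral_indicator_const _ hTm] at h1
    simp only [smul_eq_mul, integral_const, probReal_univ, one_mul] at h1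
    have : 3/4 * (a + δ) ≤ γ.real T * (a + δ) := by gcongr
    linarith
  have key : |f X| ≤ ω + 4/3 * E + δ/3 := by
    rw [abs_le]
    constructor
    · by_contra hc
      push Not at hc
      have := gen (fun u => -f ((X - 2 * w) - u)) (by fun_prop) (fun u => by rw [abs_neg]; exact hδ _) (-f X - ω) (by linarith)
        (fun u hu => by
          have hu : |u| < 2 * w := hu
          have := abs_lt.1 hu
          have := hω ((X - 2 * w) - u) X (by linarith) (by linarith)
          linarith)
      rw [integral_neg] at this
      have h2 := (abs_le.1 (hE (X - 2 * w))).1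
      linarith
    · by_contra hc
      push Not at hc
      have := gen (fun u => f ((X + 2 * w) - u)) (by fun_prop) (fun u => hδ _) (f X - ω) (by linarith)
        (fun u hu => by
          have hu : |u| < 2 * w := hu
          have := abs_lt.1 hu
          have := hω X ((X + 2 * w) - u) (by linarith) (by linarith)
          linarith)
      have h2 := (abs_le.1 (hE (X + 2 * w))).2
      linarith
  exact key

/-- Deconvolution for functions. -/
lemma deconv {f : ℝ → ℝ} {w : NNReal} (hw : 0 < w) {δ ω E : ℝ} (hδ : ∀ x, |f x| ≤ δ) (hfm : Measurable f)
    (hω0 : 0 ≤ ω) (hω : ∀ x y : ℝ, x ≤ y → y ≤ x + 4 * w → f x - ω ≤ f y)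
    (hE : ∀ X, |∫ u, f (X - u) ∂(gaussianReal 0 (w^2))| ≤ E) (X : ℝ) : |f X| ≤ 3/2 * ω + 2 * E := by
  have hbd : BddAbove (range fun x => |f x|) := ⟨δ, by rintro _ ⟨x, rfl⟩; exact hδ x⟩
  have hle : ∀ x, |f x| ≤ ⨆ x, |f x| := fun x => le_ciSup hbd x
  have h2 := ciSup_le (fun x => deconv_aux hw hle hfm hω0 hω hE x)
  have := hle X
  linarith

open MeasureTheory Set Filter Topology ProbabilityTheory

/-- density in the square-root variable -/
noncomputable def gst (ε u : ℝ) : ℝ := Real.sqrt (2 / Real.pi) * Real.exp (-(ε ^ 2 / 2) * u ^ 2)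

/-- The (rescaled) limiting second-moment measure. -/
noncomputable def bst (ε : ℝ) : Measure ℝ :=
  Measure.map (fun u => u ^ 2) ((volume.restrict (Ioi (0:ℝ))).withDensity (fun u => ENNReal.ofReal (gst ε u)))

lemma gst_nonneg (ε u : ℝ) : 0 ≤ gst ε u := by unfold gst; positivity
lemma gst_cont (ε : ℝ) : Continuous (gst ε) := by unfold gst; fun_prop
lemma gst_le (ε u : ℝ) : gst ε u ≤ 1 := by
  unfold gst
  have h1 : Real.sqrt (2 / Real.pi) ≤ 1 := by
    rw [Real.sqrt_le_one]
    rw [div_le_one Real.pi_pos]; exact Real.two_le_pi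
  have h2 : Real.exp (-(ε ^ 2 / 2) * u ^ 2) ≤ 1 := by
    rw [Real.exp_le_one_iff]
    nlinarith [mul_nonneg (sq_nonneg ε) (sq_nonneg u)]
  calc _ ≤ 1 * (1:ℝ) := by gcongr
    _ = 1 := one_mul 1
lemma gst_int {ε : ℝ} (hε : 0 < ε) : Integrable (gst ε) :=
  (integrable_exp_neg_mul_sq (b := ε^2/2) (by positivity)).const_mul _

lemma bst_fin {ε : ℝ} (hε : 0 < ε) : IsFiniteMeasure (bst ε) := by
  have : IsFiniteMeasure ((volume.restrict (Ioi (0:ℝ))).withDensity (fun u => ENNReal.ofReal (gst ε u))) :=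
    isFiniteMeasure_withDensity_ofReal (gst_int hε).integrableOn.2
  unfold bst
  infer_instance

lemma bst_apply (ε : ℝ) {s : Set ℝ} (hs : MeasurableSet s) :
    bst ε s = ∫⁻ u in {u : ℝ | 0 < u ∧ u ^ 2 ∈ s}, ENNReal.ofReal (gst ε u) := by
  have hm : Measurable (fun u : ℝ => u ^ 2) := by fun_prop
  unfold bst
  rw [Measure.map_apply hm hs, withDensity_apply _ (hm hs), Measure.restrict_restrict (hm hs)]
  congr 2
  ext u; simp [and_comm]

lemma bst_zero (ε : ℝ) : bst ε (Iic 0) = 0 := by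
  rw [bst_apply ε measurableSet_Iic]
  have : {u : ℝ | 0 < u ∧ u ^ 2 ∈ Iic (0:ℝ)} = ∅ := by
    ext u
    simp only [mem_Iic, mem_ofPred_eq, mem_empty_iff_false, iff_false, not_and, not_le]
    intro h; positivity
  rw [this]; simp

lemma set_Iic (X : ℝ) : {u : ℝ | 0 < u ∧ u ^ 2 ∈ Iic X} = Ioc 0 (Real.sqrt X) := by
  ext u
  simp only [mem_Iic, mem_ofPred_eq, mem_Ioc]
  refine and_congr_right fun h => ?_
  exact (Real.le_sqrt' h).symm

lemma bst_Iic {ε : ℝ} (hε : 0 < ε) (X : ℝ) : (bst ε).real (Iic X) = ∫ u in Ioc 0 (Real.sqrt X), gst ε u := by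
  rw [measureReal_def, bst_apply ε measurableSet_Iic, set_Iic, ← ofReal_integral_eq_lintegral_ofReal (gst_int hε).integrableOn
    (Eventually.of_forall fun u => gst_nonneg ε u), ENNReal.toReal_ofReal (integral_nonneg fun u => gst_nonneg ε u)]

lemma bst_mod {ε : ℝ} (hε : 0 < ε) {X h : ℝ} (hh : 0 ≤ h) : (bst ε).real (Iic (X + h)) ≤ (bst ε).real (Iic X) + Real.sqrt h := by
  rw [bst_Iic hε, bst_Iic hε]
  have hs : Real.sqrt X ≤ Real.sqrt (X + h) := Real.sqrt_le_sqrt (by linarith)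
  have hu : Ioc 0 (Real.sqrt (X + h)) = Ioc 0 (Real.sqrt X) ∪ Ioc (Real.sqrt X) (Real.sqrt (X + h)) :=
    (Ioc_union_Ioc_eq_Ioc (Real.sqrt_nonneg X) hs).symm
  rw [hu, setIntegral_union (Ioc_disjoint_Ioc_of_le le_rfl) measurableSet_Ioc (gst_int hε).integrableOn (gst_int hε).integrableOn]
  gcongr
  have h1 : ∫ u in Ioc (Real.sqrt X) (Real.sqrt (X + h)), gst ε u ≤ ∫ u in Ioc (Real.sqrt X) (Real.sqrt (X + h)), (1:ℝ) :=
    integral_mono (gst_int hε).integrableOn (by simp) (fun u => gst_le ε u)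
  refine h1.trans ?_
  simp only [integral_const, smul_eq_mul, mul_one, measureReal_restrict_apply_univ, Real.volume_real_Ioc_of_le hs]
  rcases le_total 0 X with hX | hX
  · have : Real.sqrt (X + h) ≤ Real.sqrt X + Real.sqrt h := by
      rw [Real.sqrt_le_left (by positivity)]
      nlinarith [Real.sq_sqrt hX, Real.sq_sqrt hh, mul_nonneg (Real.sqrt_nonneg X) (Real.sqrt_nonneg h)]
    linarith
  · rw [Real.sqrt_eq_zero_of_nonpos hX, sub_zero]
    exact Real.sqrt_le_sqrt (by linarith)

lemma bst_F {ε : ℝ} (hε : 0 < ε) {X : ℝ} (hX : 0 < X) : ε * (bst ε).real (Iic X) =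
    ∫ y in Ioc (0 : ℝ) (ε ^ 2 * X), (Real.sqrt (2 * Real.pi))⁻¹ * y ^ (-(1 : ℝ) / 2) * Real.exp (-y / 2) := by
  have him : (fun u : ℝ => ε ^ 2 * u ^ 2) '' Ioc 0 (Real.sqrt X) = Ioc 0 (ε ^ 2 * X) := by
    ext y
    simp only [mem_image, mem_Ioc]
    constructor
    · rintro ⟨u, ⟨h1, h2⟩, rfl⟩
      refine ⟨by positivity, ?_⟩
      gcongr
      exact (Real.le_sqrt' h1).1 h2
    · rintro ⟨h1, h2⟩
      refine ⟨Real.sqrt (y / ε^2), ⟨by positivity, ?_⟩, ?_⟩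
      · apply Real.sqrt_le_sqrt
        rw [div_le_iff₀ (by positivity)]; linarith
      · rw [Real.sq_sqrt (by positivity)]; field_simp
  rw [← him, integral_image_eq_integral_abs_deriv_smul measurableSet_Ioc (f' := fun u => ε ^ 2 * (2 * u)), bst_Iic hε, ← integral_const_mul]
  · refine setIntegral_congr_fun measurableSet_Ioc fun u hu => ?_
    have hu0 : 0 < u := hu.1
    simp only [gst, smul_eq_mul]
    have e1 : (ε ^ 2 * u ^ 2) ^ (-(1:ℝ)/2) = (ε * u)⁻¹ := by
      rw [show ε ^ 2 * u ^ 2 = (ε * u) ^ (2:ℝ) by rw [Real.rpow_two]; ring, ← Real.rpow_mul (by positivity)]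
      norm_num
      rw [Real.rpow_neg_one, mul_inv, mul_comm]
    have e2 : Real.sqrt (2 / Real.pi) = 2 * (Real.sqrt (2 * Real.pi))⁻¹ := by
      rw [← div_eq_mul_inv, eq_div_iff (by positivity), ← Real.sqrt_mul (by positivity)]
      rw [show 2 / Real.pi * (2 * Real.pi) = 2 ^ 2 by field_simp]
      exact Real.sqrt_sq (by norm_num)
    rw [e1, e2, abs_of_pos (by positivity), show -(ε ^ 2 / 2) * u ^ 2 = -(ε ^ 2 * u ^ 2) / 2 by ring]
    field_simp
  · intro u hu
    exact ((((hasDerivAt_pow 2 u).const_mul (ε^2)).congr_deriv (by simp))).hasDerivWithinAt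
  · intro a ha b hb hab
    have h1 : a ^ 2 = b ^ 2 := by
      have : ε ^ 2 ≠ 0 := by positivity
      exact mul_left_cancel₀ this hab
    exact (pow_left_inj₀ ha.1.le hb.1.le (by norm_num)).1 h1

lemma cpow_half_re (z : ℂ) : 0 ≤ (z ^ (1/2 : ℂ)).re := by
  by_cases hz : z = 0
  · simp [hz]
  rw [Complex.cpow_def_of_ne_zero hz, Complex.exp_re]
  refine mul_nonneg (Real.exp_pos _).le (Real.cos_nonneg_of_mem_Icc ?_)
  have e : (Complex.log z * (1/2)).im = z.arg / 2 := by
    rw [show (1/2 : ℂ) = ((1/2 : ℝ) : ℂ) by push_cast; rfl, Complex.im_mul_ofReal, Complex.log_im]; ring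
  rw [e]
  have h1 := Complex.neg_pi_lt_arg z
  have h2 := Complex.arg_le_pi z
  exact ⟨by linarith, by linarith⟩

lemma bst_fourier {ε : ℝ} (hε : 0 < ε) (k : ℝ) : ∃ S : ℂ, 0 ≤ S.re ∧ S ^ 2 = ε ^ 2 + 2 * k * Complex.I ∧
    ∫ x : ℝ, Complex.exp (-(k * Complex.I) * x) ∂(bst ε) = 1 / S := by
  set b : ℂ := ((ε ^ 2 / 2 : ℝ) : ℂ) + k * Complex.I with hb
  have hbre : 0 < b.re := by simp only [hb, Complex.add_re, Complex.ofReal_re]; simp; positivity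
  have hb0 : b ≠ 0 := by intro h; rw [h] at hbre; simp at hbre
  have e1 : ∫ x : ℝ, Complex.exp (-(k * Complex.I) * x) ∂(bst ε) = (Real.sqrt (2 / Real.pi) : ℂ) * ((Real.pi / b) ^ (1/2 : ℂ) / 2) := by
    unfold bst
    rw [integral_map (by fun_prop) (by fun_prop), integral_withDensity_eq_integral_toReal_smul (by have := gst_cont ε; fun_prop) (by simp),
      ← integral_gaussian_complex_Ioi hbre, ← integral_const_mul]
    refine integral_congr_ae (Eventually.of_forall fun u => ?_)
    simp only [ENNReal.toReal_ofReal (gst_nonneg ε u)]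
    simp only [gst, Complex.real_smul]
    push_cast
    rw [mul_assoc, ← Complex.exp_add]
    congr 2
    rw [hb]; push_cast; ring
  set T := (Real.sqrt (2 / Real.pi) : ℂ) * ((Real.pi / b) ^ (1/2 : ℂ) / 2) with hT
  have hTre : 0 ≤ T.re := by
    rw [hT, Complex.re_ofReal_mul]
    have := cpow_half_re (Real.pi / b)
    have e : ((Real.pi / b) ^ (1/2 : ℂ) / 2).re = ((Real.pi / b) ^ (1/2 : ℂ)).re / 2 := by
      rw [show (2:ℂ) = ((2:ℝ):ℂ) by norm_num, Complex.div_ofReal_re]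
    rw [e]; positivity
  have hT2 : T ^ 2 = 1 / (2 * b) := by
    have h1 : ((Real.sqrt (2 / Real.pi) : ℝ) : ℂ) ^ 2 = 2 / Real.pi := by
      rw [← Complex.ofReal_pow, Real.sq_sqrt (by positivity)]; push_cast; rfl
    have h2 : ((Real.pi / b) ^ (1/2 : ℂ)) ^ 2 = Real.pi / b := by
      rw [← Complex.cpow_nat_mul]; norm_num
    have : (Real.pi : ℂ) ≠ 0 := by exact_mod_cast Real.pi_ne_zero
    rw [hT, mul_pow, div_pow, h1, h2]
    field_simp
  refine ⟨1 / T, ?_, ?_, ?_⟩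
  · rw [one_div, Complex.inv_re]
    exact div_nonneg hTre (Complex.normSq_nonneg _)
  · rw [div_pow, one_pow, hT2, one_div_one_div, hb]; push_cast; ring
  · rw [e1, one_div_one_div]

open MeasureTheory Set Filter Topology ProbabilityTheory

/-- multiply a measure by `x` -/
noncomputable def xm (Q : Measure ℝ) : Measure ℝ := Q.withDensity (fun x => ENNReal.ofReal x)

lemma xm_fin {Q : Measure ℝ} (hx : Integrable (fun x => x) Q) : IsFiniteMeasure (xm Q) :=
  isFiniteMeasure_withDensity_ofReal hx.2

lemma xm_zero (Q : Measure ℝ) : xm Q (Iic 0) = 0 := by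
  unfold xm
  rw [withDensity_apply _ measurableSet_Iic, setLIntegral_congr_fun measurableSet_Iic (g := fun _ => 0)]
  · simp
  · intro x hx; exact ENNReal.ofReal_of_nonpos hx

lemma xm_integral {Q : Measure ℝ} (hQ : Q (Iic 0) = 0) {F : Type*} [NormedAddCommGroup F] [NormedSpace ℝ F] (f : ℝ → F) :
    ∫ x, f x ∂(xm Q) = ∫ x, x • f x ∂Q := by
  unfold xm
  rw [integral_withDensity_eq_integral_toReal_smul (by fun_prop) (by simp)]
  refine integral_congr_ae ?_
  filter_upwards [ae_pos_of hQ] with x hx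
  rw [ENNReal.toReal_ofReal hx.le]

lemma xm_integrable {Q : Measure ℝ} (hQ : Q (Iic 0) = 0) {F : Type*} [NormedAddCommGroup F] [NormedSpace ℝ F] (f : ℝ → F) :
    Integrable f (xm Q) ↔ Integrable (fun x => x • f x) Q := by
  unfold xm
  rw [integrable_withDensity_iff_integrable_smul' (by fun_prop) (by simp)]
  refine integrable_congr ?_
  filter_upwards [ae_pos_of hQ] with x hx
  rw [ENNReal.toReal_ofReal hx.le]

lemma xm_real_Iic {Q : Measure ℝ} (hQ : Q (Iic 0) = 0) (hx : Integrable (fun x => x) Q) (X : ℝ) :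
    (xm Q).real (Iic X) = ∫ y in Ioc 0 X, y ∂Q := by
  have h1 : ∫ y in Ioc 0 X, y ∂Q = ∫ y in Iic X, y ∂Q := by
    refine setIntegral_congr_set ?_
    filter_upwards [ae_pos_of hQ] with x hx
    apply propext
    exact ⟨fun h => h.2, fun h => ⟨hx, h⟩⟩
  rw [h1, ← integral_indicator_one measurableSet_Iic, xm_integral hQ, ← integral_indicator measurableSet_Iic]
  refine integral_congr_ae (Eventually.of_forall fun x => ?_)
  simp [indicator]

lemma bfun_int {ε : ℝ} (hε : 0 < ε) (hε1 : ε ≤ 1) (L c : ℝ) {τ : ℝ} (hτ : ε = Real.exp (-τ)) (hL : 0 ≤ L) (hc : 0 < c) :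
    ∃ b : ℝ → ℝ, Integrable b ∧ (∀ k, b k = (Icc (-1:ℝ) 1).indicator (fun k => 4 * L / (ε ^ 3 + |k|)) k + 4 / c * Real.exp (-(1/4) * k ^ 2)) ∧
      ∫ k, b k ≤ 8 * L * (1 + 3 * τ) + 16 / c := by
  have hc1 : Continuous (fun k : ℝ => 4 * L / (ε ^ 3 + |k|)) := by
    refine continuous_const.div (by fun_prop) fun k => ?_
    have := abs_nonneg k; positivity
  have i1 : Integrable (fun k => (Icc (-1:ℝ) 1).indicator (fun k => 4 * L / (ε ^ 3 + |k|)) k) := by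
    rw [integrable_indicator_iff measurableSet_Icc]
    exact hc1.continuousOn.integrableOn_Icc
  have i2 : Integrable (fun k : ℝ => 4 / c * Real.exp (-(1/4) * k ^ 2)) := (integrable_exp_neg_mul_sq (by norm_num)).const_mul _
  refine ⟨_, i1.add i2, fun k => rfl, ?_⟩
  simp only [Pi.add_apply]
  rw [integral_add i1 i2, integral_const_mul, integral_gaussian]
  have h1 : Real.sqrt (Real.pi / (1/4)) ≤ 4 := by
    rw [Real.sqrt_le_left (by norm_num)]
    have := Real.pi_le_four
    linarith
  have h2 : 4 / c * Real.sqrt (Real.pi / (1/4)) ≤ 16 / c := by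
    calc _ ≤ 4 / c * 4 := by gcongr
      _ = _ := by ring
  have h3 : ∫ k, (Icc (-1:ℝ) 1).indicator (fun k => 4 * L / (ε ^ 3 + |k|)) k ≤ 8 * L * (1 + 3 * τ) := by
    have e1 : ∫ k, (Icc (-1:ℝ) 1).indicator (fun k => 4 * L / (ε ^ 3 + |k|)) k = ∫ k, (fun r => (Iic (1:ℝ)).indicator (fun k => 4 * L / (ε ^ 3 + k)) r) |k| := by
      congr 1; ext k
      simp only [indicator, mem_Icc, mem_Iic, abs_le]
    rw [e1, integral_comp_abs, integral_indicator measurableSet_Iic, Measure.restrict_restrict measurableSet_Iic, inter_comm, Ioi_inter_Iic,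
      ← intervalIntegral.integral_of_le zero_le_one]
    have e2 : ∫ k in (0:ℝ)..1, 4 * L / (ε ^ 3 + k) = 4 * L * Real.log ((ε^3 + 1) / ε^3) := by
      simp_rw [div_eq_mul_inv (4 * L)]
      rw [intervalIntegral.integral_const_mul]
      congr 1
      have := intervalIntegral.integral_comp_add_left (a := 0) (b := 1) (fun x : ℝ => x⁻¹) (ε^3)
      rw [this, add_zero, integral_inv_of_pos (by positivity) (by positivity)]
    rw [e2]
    have e3 : Real.log ((ε^3 + 1) / ε^3) ≤ 1 + 3 * τ := by
      rw [Real.log_div (by positivity) (by positivity), Real.log_pow, hτ, Real.log_exp]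
      have : Real.log (Real.exp (-τ) ^ 3 + 1) ≤ 1 := by
        have h := Real.log_le_sub_one_of_pos (show 0 < Real.exp (-τ) ^ 3 + 1 by positivity)
        have : Real.exp (-τ) ^ 3 ≤ 1 := pow_le_one₀ (Real.exp_pos _).le (hτ ▸ hε1)
        linarith
      push_cast
      linarith
    calc 2 * (4 * L * Real.log ((ε^3 + 1) / ε^3)) ≤ 2 * (4 * L * (1 + 3 * τ)) := by gcongr
      _ = _ := by ring
  linarith

set_option maxHeartbeats 1000000 in
lemma main_est {P Q : Measure ℝ} [IsFiniteMeasure P] [IsFiniteMeasure Q] (hP : P (Iic 0) = 0) (hQ : Q (Iic 0) = 0)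
    (hxP : Integrable (fun x => x) P) (hm : ∫ x, x ∂P = 1)
    (hx2 : Integrable (fun x => x ^ 2) P) (hm2 : ∫ x, x ^ 2 ∂P = 1)
    {M : ℝ} (hx3 : Integrable (fun x => x ^ 3) P) (hm3 : ∫ x, x ^ 3 ∂P ≤ M) (hM : 1 ≤ M)
    {t ε τ : ℝ} (ht : 0 ≤ t) (hε : ε = Real.exp (-τ)) (hτ : 0 ≤ τ) (htε : t = 1 - ε)
    (hxQ : Integrable (fun x => x) Q) (hmQ : ∫ x, x ∂Q ≤ 1 / ε)
    (hreal : ∀ η : ℝ, 0 < η → LA P ((η:ℂ) + t * LA Q η) = LA Q η)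
    {c : ℝ} (hc : c = 1 / (200000 * M ^ 2)) (hsm : ε ^ 2 ≤ 2 * c) (X : ℝ) :
    |(xm Q).real (Iic X) - (bst ε).real (Iic X)| ≤ (24 / c ^ 2 + 48 * (6 + 212 * M) + 32 / c) * (1 + τ) := by
  have hε0 : 0 < ε := hε ▸ Real.exp_pos _
  have hε1 : ε ≤ 1 := by linarith
  have hc0 : 0 < c := by rw [hc]; positivity
  have hM2 : 1 ≤ M ^ 2 := one_le_pow₀ hM
  have hc1 : c ≤ 1 := by rw [hc, div_le_one (by positivity)]; linarith
  have hfα := xm_fin hxQ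
  have hfβ := bst_fin hε0
  set α := xm Q with hα
  set β := bst ε with hβ
  set L := 6 + 212 * M with hL
  have hL0 : 0 ≤ L := by rw [hL]; positivity
  obtain ⟨b, hbi, hb, hbI⟩ := bfun_int hε0 hε1 L c hε hL0 hc0
  set w : NNReal := NNReal.sqrt (Real.toNNReal (1 + 4 * τ / c ^ 2)) with hw
  have hV1 : 1 ≤ 1 + 4 * τ / c ^ 2 := by have : 0 ≤ 4 * τ / c ^ 2 := by positivity
                                         linarith
  have hw2 : ((w ^ 2 : NNReal) : ℝ) = 1 + 4 * τ / c ^ 2 := by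
    rw [hw, NNReal.sq_sqrt, Real.coe_toNNReal _ (by linarith)]
  have hw2' : (w:ℝ) ^ 2 = 1 + 4 * τ / c ^ 2 := by rw [← hw2]; push_cast; rfl
  have hw1 : (1:ℝ) ≤ w := by
    refine le_of_sq_le_sq ?_ w.2
    rw [hw2']; linarith
  have hwpos : 0 < w := by exact_mod_cast (zero_lt_one.trans_le hw1)
  have hFα : ∀ k : ℝ, ∫ x : ℝ, Complex.exp (-(k * Complex.I) * x) ∂α = LB Q (k * Complex.I) := by
    intro k
    rw [hα, xm_integral hQ]
    simp only [Complex.real_smul]; rfl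
  have hD : ∀ Y X k : ℝ, Y ≤ X → Real.exp (-(((w ^ 2 : NNReal) : ℝ)/2) * k ^ 2) * ‖JK Y X k‖ *
      ‖(∫ x : ℝ, Complex.exp (-(k * Complex.I) * x) ∂α) - ∫ x : ℝ, Complex.exp (-(k * Complex.I) * x) ∂β‖ ≤ b k := by
    intro Y X k hYX
    obtain ⟨S, hSre, hS, hSe⟩ := bst_fourier hε0 k
    rw [hFα, hSe, hw2]
    obtain ⟨d1, d2, d3⟩ := Dbd hP hQ hxP hm hx2 hm2 hx3 hm3 hM ht hε0 htε hxQ hmQ hreal hSre hS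
    set D := ‖LB Q (k * Complex.I) - 1 / S‖ with hDdef
    have hD0 : 0 ≤ D := norm_nonneg _
    have hb1 : 0 ≤ (Icc (-1:ℝ) 1).indicator (fun k => 4 * L / (ε ^ 3 + |k|)) k := by
      refine indicator_nonneg (fun k _ => ?_) k
      have := abs_nonneg k; positivity
    have hb2 : 0 ≤ 4 / c * Real.exp (-(1/4) * k ^ 2) := by positivity
    rw [hb]
    by_cases hk : k = 0
    · have : D = 0 := le_antisymm (by simpa [hk] using d1) hD0
      rw [this, mul_zero]; linarith
    have hka : 0 < |k| := abs_pos.2 hk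
    have hJ := JK_le2 hYX hk
    rcases le_or_gt |k| c with hkc | hkc
    · have hkm : k ∈ Icc (-1:ℝ) 1 := abs_le.1 (hkc.trans hc1)
      rw [indicator_of_mem hkm]
      refine le_trans ?_ (le_add_of_nonneg_right hb2)
      have d3' := d3 (by
        have : 1 / (50000 * M ^ 2) = 4 * c := by rw [hc]; field_simp; norm_num
        rw [this]; linarith)
      have hexp : Real.exp (-((1 + 4 * τ / c ^ 2)/2) * k ^ 2) ≤ 1 := by
        rw [Real.exp_le_one_iff]
        have : 0 ≤ (1 + 4 * τ / c ^ 2)/2 * k ^ 2 := by positivity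
        linarith
      calc Real.exp (-((1 + 4 * τ / c ^ 2)/2) * k ^ 2) * ‖JK Y X k‖ * D ≤ 1 * (2 / |k|) * D := by gcongr
        _ = 2 * D / |k| := by ring
        _ ≤ 4 * L / (ε ^ 3 + |k|) := by
          rw [div_le_div_iff₀ hka (by positivity)]
          rw [le_div_iff₀ (by positivity)] at d1
          have h5 : D * |k| ≤ L * |k| := by gcongr
          have h6 : 4 * |k| ≤ L * |k| := by gcongr; rw [hL]; linarith
          nlinarith
    · refine le_trans ?_ (le_add_of_nonneg_left hb1)
      have hk2 : c ^ 2 ≤ k ^ 2 := by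
        rw [← sq_abs k]; gcongr
      have hexp : Real.exp (-((1 + 4 * τ / c ^ 2)/2) * k ^ 2) ≤ Real.exp (-τ) * Real.exp (-(1/4) * k ^ 2) := by
        rw [← Real.exp_add, Real.exp_le_exp]
        have h7 : τ ≤ τ / c ^ 2 * k ^ 2 := by
          rw [div_mul_eq_mul_div, le_div_iff₀ (by positivity)]; gcongr
        have e8 : -((1 + 4 * τ / c ^ 2)/2) * k ^ 2 = -(1/2) * k^2 - 2 * (τ / c ^ 2 * k ^ 2) := by ring
        rw [e8]
        nlinarith [sq_nonneg k]
      have hJ2 : ‖JK Y X k‖ ≤ 2 / c := hJ.trans (by gcongr)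
      calc Real.exp (-((1 + 4 * τ / c ^ 2)/2) * k ^ 2) * ‖JK Y X k‖ * D
          ≤ (Real.exp (-τ) * Real.exp (-(1/4) * k ^ 2)) * (2 / c) * (2 / ε) := by gcongr
        _ = 4 / c * Real.exp (-(1/4) * k ^ 2) := by rw [hε]; field_simp; norm_num
  have hE := smooth_bound (xm_zero Q) (bst_zero ε) (v := w ^ 2) (by positivity) hbi hD
  have hω := Real.sqrt_nonneg (4 * (w:ℝ))
  have hdec := deconv (f := fun X => α.real (Iic X) - β.real (Iic X)) hwpos (δ := α.real univ + β.real univ)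
    (ω := Real.sqrt (4 * w)) (E := (∫ k, b k) / (2 * Real.pi)) ?_ ?_ hω ?_ hE X
  · refine hdec.trans ?_
    have hI0 : 0 ≤ ∫ k, b k := by
      refine integral_nonneg fun k => ?_
      have := hD 0 0 k le_rfl
      refine le_trans (by positivity) this
    have h1 : (∫ k, b k) / (2 * Real.pi) ≤ 8 * L * (1 + 3 * τ) + 16 / c := by
      refine (div_le_self hI0 ?_).trans hbI
      have := Real.two_le_pi; linarith
    have h2 : Real.sqrt (4 * w) ≤ 16 / c ^ 2 * (1 + τ) := by
      have h3 : Real.sqrt (4 * w) ≤ 4 * w := by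
        rw [Real.sqrt_le_left (by positivity)]; nlinarith
      have h4 : (w:ℝ) ≤ 1 + 4 * τ / c ^ 2 := by rw [← hw2']; nlinarith
      have h5 : 1 ≤ 4 / c ^ 2 := by
        rw [le_div_iff₀ (by positivity)]; nlinarith
      have e6 : 16 / c ^ 2 * (1 + τ) = 4 * (4 / c ^ 2 + 4 * τ / c ^ 2) := by ring
      rw [e6]; linarith
    have h3 : 16 / c ≤ 16 / c * (1 + τ) := le_mul_of_one_le_right (by positivity) (by linarith)
    have h4 : 8 * L * (1 + 3 * τ) ≤ 24 * L * (1 + τ) := by nlinarith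
    have e : (24 / c ^ 2 + 48 * L + 32 / c) * (1 + τ) = 3/2 * (16 / c ^ 2 * (1 + τ)) + 2 * (24 * L * (1 + τ) + 16 / c * (1 + τ)) := by ring
    rw [e]; linarith
  · intro x
    refine (abs_sub _ _).trans ?_
    rw [abs_of_nonneg measureReal_nonneg, abs_of_nonneg measureReal_nonneg]
    exact add_le_add (cdf_le α x) (cdf_le β x)
  · exact (cdf_mono α).measurable.sub (cdf_mono β).measurable
  · intro x y hxy hyx
    have h1 := cdf_mono α hxy
    have h2 := cdf_mono β hyx
    have h3 := bst_mod hε0 (X := x) (h := 4 * w) (by positivity)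
    simp only at h1 h2
    linarith

open MeasureTheory Set Filter Topology ProbabilityTheory

lemma bst_le {ε : ℝ} (hε : 0 < ε) (X : ℝ) : ε * (bst ε).real (Iic X) ≤ 2 := by
  rw [bst_Iic hε]
  have h1 : ∫ u in Ioc 0 (Real.sqrt X), gst ε u ≤ ∫ u, gst ε u :=
    setIntegral_le_integral (gst_int hε) (Eventually.of_forall fun u => gst_nonneg ε u)
  have h2 : ∫ u, gst ε u = 2 / ε := by
    unfold gst
    rw [integral_const_mul, integral_gaussian, ← Real.sqrt_mul (by positivity)]
    rw [show 2 / Real.pi * (Real.pi / (ε ^ 2 / 2)) = (2 / ε) ^ 2 by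
      have := Real.pi_pos.ne'
      field_simp]
    exact Real.sqrt_sq (by positivity)
  calc _ ≤ ε * (2 / ε) := by gcongr; exact h1.trans h2.le
    _ = 2 := by field_simp

/-- mass-weighted family -/
noncomputable def Nn (n : ℝ → Measure ℝ) (t : ℝ) : Measure ℝ := open Classical in if t ∈ Ico (0:ℝ) 1 then xm (n t) else 0

lemma Nn_eq {n : ℝ → Measure ℝ} {t : ℝ} (ht : t ∈ Ico (0:ℝ) 1) : Nn n t = xm (n t) := by
  unfold Nn; exact if_pos ht

section bridge
variable {n : ℝ → Measure ℝ} (hfin : ∀ t ∈ Ico (0:ℝ) 1, IsFiniteMeasure (n t))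
  (hpos : ∀ t ∈ Ico (0:ℝ) 1, n t (Iic 0) = 0)
  (hweak : ∀ φ : ℝ → ℝ, ContDiff ℝ (⊤ : ℕ∞) φ → HasCompactSupport φ → tsupport φ ⊆ Ioi 0 →
    ∀ t ∈ Ico (0:ℝ) 1, HasDerivWithinAt (fun r => ∫ x, φ x ∂(n r))
      ((1 / 2) * ∫ x, ∫ y, (φ (x + y) - φ x - φ y) * (x * y) ∂(n t) ∂(n t)) (Ico (0:ℝ) 1) t)
include hfin hpos hweak

lemma br_int {t : ℝ} (ht : t ∈ Ico (0:ℝ) 1) : Integrable (fun x : ℝ => x) (n t) := by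
  have := hfin t ht
  refine partA (n t) (hpos t ht) ?_
  intro φ ψ hφ hψ
  have h1 := hweak φ hφ.1 hφ.2.1 hφ.2.2 t ht
  have h2 := hweak ψ hψ.1 hψ.2.1 hψ.2.2 t ht
  have hs := hφ.add hψ
  have h3 := hweak _ hs.1 hs.2.1 hs.2.2 t ht
  have h4 : HasDerivWithinAt (fun r => ∫ x, (φ x + ψ x) ∂(n r)) _ (Ico (0:ℝ) 1) t :=
    (h1.add h2).congr_of_mem (fun r hr => by
      have := hfin r hr
      exact integral_add (hφ.RD.int (hpos r hr)) (hψ.RD.int (hpos r hr))) ht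
  have h5 := (uniqueDiffOn_Ico (0:ℝ) 1 t ht).eq_deriv _ h3 h4
  unfold JJ
  linarith

lemma Nn_sys : Sys (Nn n) := by
  have fin : ∀ t, IsFiniteMeasure (Nn n t) := by
    intro t
    by_cases ht : t ∈ Ico (0:ℝ) 1
    · rw [Nn_eq ht]; exact xm_fin (br_int hfin hpos hweak ht)
    · unfold Nn; rw [if_neg ht]; infer_instance
  have pos : ∀ t, Nn n t (Iic 0) = 0 := by
    intro t
    by_cases ht : t ∈ Ico (0:ℝ) 1
    · rw [Nn_eq ht]; exact xm_zero _
    · unfold Nn; rw [if_neg ht]; rfl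
  refine ⟨fin, pos, ?_⟩
  intro g hg t ht
  have hs : TF (fun x => x * g x) := hg.mul_smooth contDiff_id
  have h := hweak _ hs.1 hs.2.1 hs.2.2 t ht
  have e : (∫ p, PP g p ∂((Nn n t).prod (Nn n t))) =
      (1 / 2) * ∫ x, ∫ y, ((x + y) * g (x + y) - x * g x - y * g y) * (x * y) ∂(n t) ∂(n t) := by
    have hft := fin t
    rw [integral_prod _ (PP_int (pos t) hg.RD), Nn_eq ht, xm_integral (hpos t ht), ← integral_const_mul]
    refine integral_congr_ae (Eventually.of_forall fun x => ?_)
    simp only [PP]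
    rw [xm_integral (hpos t ht), smul_eq_mul, ← integral_const_mul, ← integral_const_mul]
    refine integral_congr_ae (Eventually.of_forall fun y => ?_)
    simp only [smul_eq_mul]
    ring
  rw [e]
  refine h.congr_of_mem (fun r hr => ?_) ht
  rw [Nn_eq hr, xm_integral (hpos r hr)]
  rfl

theorem final_est {μ4 : ℝ} (h2i : Integrable (fun x => x ^ 2) (n 0)) (h2 : (∫ x, x ^ 2 ∂(n 0)) = 1)
    (h3i : Integrable (fun x => x ^ 3) (n 0)) (h3 : (∫ x, x ^ 3 ∂(n 0)) = 1)
    (h4i : Integrable (fun x => x ^ 4) (n 0)) (h4 : (∫ x, x ^ 4 ∂(n 0)) = μ4) {M c : ℝ}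
    (hM : M = |μ4| + 1) (hc : c = 1/(200000*M^2)) {τ : ℝ} (hτ : 0 ≤ τ) {xh : ℝ} (hxh : 0 < xh) :
    |Real.exp (-τ) * (∫ y in Ioc 0 (Real.exp (2 * τ) * xh), y ^ 2 ∂(n (1 - Real.exp (-τ))))
            - ∫ y in Ioc (0 : ℝ) xh,
                (Real.sqrt (2 * Real.pi))⁻¹ * y ^ (-(1 : ℝ) / 2) * Real.exp (-y / 2)|
          ≤ (24/c^2+48*(6+212*M)+32/c) * (1 + τ) * Real.exp (-τ) := by
  have hN := Nn_sys hfin hpos hweak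
  set ε := Real.exp (-τ) with hε
  have hε0 : 0 < ε := Real.exp_pos _
  have hε1 : ε ≤ 1 := by rw [hε, Real.exp_le_one_iff]; linarith
  set t := 1 - ε with htε
  have ht : t ∈ Ico (0:ℝ) 1 := ⟨by linarith, by linarith⟩
  have h00 : (0:ℝ) ∈ Ico (0:ℝ) 1 := ⟨le_rfl, one_pos⟩
  have hM1 : 1 ≤ M := by rw [hM]; linarith [abs_nonneg μ4]
  have hc0 : 0 < c := by rw [hc]; positivity
  have hc1 : c ≤ 1 := by
    rw [hc, div_le_one (by positivity)]; nlinarith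
  have p0 := hpos 0 h00
  have eP : Nn n 0 = xm (n 0) := Nn_eq h00
  have eQ : Nn n t = xm (n t) := Nn_eq ht
  have hi0 : Integrable (fun x => x) (Nn n 0) := by
    rw [eP, xm_integrable p0]; simpa [smul_eq_mul, ← pow_two] using h2i
  have hm0 : ∫ x, x ∂(Nn n 0) = 1 := by
    rw [eP, xm_integral p0]; simpa [smul_eq_mul, ← pow_two] using h2
  have hi2 : Integrable (fun x => x ^ 2) (Nn n 0) := by
    rw [eP, xm_integrable p0]; simpa [smul_eq_mul, ← pow_succ'] using h3i
  have hm2 : ∫ x, x ^ 2 ∂(Nn n 0) = 1 := by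
    rw [eP, xm_integral p0]; simpa [smul_eq_mul, ← pow_succ'] using h3
  have hi3 : Integrable (fun x => x ^ 3) (Nn n 0) := by
    rw [eP, xm_integrable p0]; simpa [smul_eq_mul, ← pow_succ'] using h4i
  have hm3 : ∫ x, x ^ 3 ∂(Nn n 0) ≤ M := by
    rw [eP, xm_integral p0]
    have : ∫ x, x • x ^ 3 ∂(n 0) = μ4 := by simpa [smul_eq_mul, ← pow_succ'] using h4
    rw [this, hM]; linarith [le_abs_self μ4]
  have i1 := hN.fin 0
  have i2 := hN.fin t
  obtain ⟨hxQ, hmQ⟩ := C2 hN hi0 hm0 ht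
  have hmQ' : ∫ x, x ∂(Nn n t) ≤ 1 / ε := by
    have : 1 - t = ε := by rw [htε]; ring
    rwa [this] at hmQ
  have hreal : ∀ η : ℝ, 0 < η → LA (Nn n 0) ((η:ℂ) + t * LA (Nn n t) η) = LA (Nn n t) η := by
    intro η hη
    have hv := C4 hN hi0 hm0 ht hη rfl
    have hv0 := LA_re (hN.pos t) (η := (η:ℂ)) (by simpa using hη.le)
    have e1 := LA_ofReal (hN.pos t) η hη.le
    have e2 : (Nn n t).real univ = mm (Nn n) 0 := C3 hN hi0 hm0 ht
    rw [e2] at e1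
    set v := mm (Nn n) 0 - ∫ x, Real.exp (-η * x) ∂(Nn n t) with hvd
    rw [e1, Complex.ofReal_re] at hv0
    rw [e1]
    have := LA_ofReal (hN.pos 0) (η + t * v) (by have := mul_nonneg ht.1 hv0; linarith)
    rw [show ((η:ℂ) + t * (v:ℂ)) = ((η + t * v : ℝ) : ℂ) by push_cast; rfl, this]
    congr 1
  set X := Real.exp (2 * τ) * xh with hX
  have hX0 : 0 < X := by positivity
  have hεX : ε ^ 2 * X = xh := by
    rw [hX, ← mul_assoc, hε, pow_two, ← Real.exp_add, ← Real.exp_add]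
    rw [show -τ + -τ + 2 * τ = 0 by ring]; simp
  have hF : ∫ y in Ioc 0 X, y ^ 2 ∂(n t) = (xm (Nn n t)).real (Iic X) := by
    rw [xm_real_Iic (hN.pos t) hxQ, eQ, ← integral_indicator measurableSet_Ioc, ← integral_indicator measurableSet_Ioc,
      xm_integral (hpos t ht)]
    refine integral_congr_ae (Eventually.of_forall fun y => ?_)
    simp only [indicator, smul_eq_mul]
    split_ifs <;> ring
  have hG := bst_F hε0 hX0
  rw [hεX] at hG
  rw [hF, ← hG, ← mul_sub, abs_mul, abs_of_pos hε0]
  by_cases hsm : ε ^ 2 ≤ 2 * c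
  · have := main_est (hN.pos 0) (hN.pos t) hi0 hm0 hi2 hm2 hi3 hm3 hM1 ht.1 hε hτ htε hxQ hmQ' hreal hc hsm X
    calc _ ≤ ε * ((24/c^2+48*(6+212*M)+32/c)*(1+τ)) := by gcongr
      _ = _ := by ring
  · push Not at hsm
    have hcε : c ≤ ε := by nlinarith
    have f1 : ε * (xm (Nn n t)).real (Iic X) ≤ 1 := by
      rw [xm_real_Iic (hN.pos t) hxQ]
      have : ∫ y in Ioc 0 X, y ∂(Nn n t) ≤ ∫ y, y ∂(Nn n t) := by
        refine setIntegral_le_integral hxQ ?_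
        filter_upwards [ae_pos_of (hN.pos t)] with x hx
        exact hx.le
      calc _ ≤ ε * (1 / ε) := by gcongr; exact this.trans hmQ'
        _ = 1 := by field_simp
    have f0 : 0 ≤ ε * (xm (Nn n t)).real (Iic X) := by positivity
    have g1 := bst_le hε0 X
    have g0 : 0 ≤ ε * (bst ε).real (Iic X) := by positivity
    have h1 : ε * |(xm (Nn n t)).real (Iic X) - (bst ε).real (Iic X)| ≤ 2 := by
      rw [← abs_of_pos hε0, ← abs_mul, abs_of_pos hε0, mul_sub, abs_le]
      constructor <;> linarith
    have h5 : 32 / c ≤ (24/c^2+48*(6+212*M)+32/c) := by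
      have : 0 ≤ 24/c^2+48*(6+212*M) := by positivity
      linarith
    calc _ ≤ (2:ℝ) := h1
      _ ≤ 32 / c * (1 + 0) * c := by field_simp; norm_num
      _ ≤ _ := by gcongr
end bridge

/-- Rate of convergence to self-similarity for Smoluchowski's equation with
multiplicative kernel `K = xy`: if `n₀` has second and third moments equal to `1` and
finite fourth moment `μ₄`, then with `τ = log(1-t)⁻¹` (i.e. `t = 1 - e^{-τ}`) the
rescaled distribution function
`F(τ,xh) = (1-t) ∫_{(0,(1-t)^{-2}xh]} y² n(t,dy)` satisfies
`sup_{xh>0} |F(τ,xh) - F_*(xh)| ≤ C(μ₄)(1+τ)e^{-τ}` for all `τ ≥ 0`, where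
`F_*(xh) = ∫_0^xh (2π)^{-1/2} y^{-1/2} e^{-y/2} dy` and `C` depends only on `μ₄`. -/
theorem multiplicative_kernel_rate (μ4 : ℝ) :
    ∃ C : ℝ, ∀ (n0 : Measure ℝ) (n : ℝ → Measure ℝ),
      n0 (Iic 0) = 0 →
      Integrable (fun x => x ^ 2) n0 → (∫ x, x ^ 2 ∂n0) = 1 →
      Integrable (fun x => x ^ 3) n0 → (∫ x, x ^ 3 ∂n0) = 1 →
      Integrable (fun x => x ^ 4) n0 → (∫ x, x ^ 4 ∂n0) = μ4 →
      IsWeakSolution (fun x y => x * y) (Ico 0 1) n {2, 3, 4} →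
      n 0 = n0 →
      ∀ τ ≥ (0 : ℝ), ∀ xh > (0 : ℝ),
        |Real.exp (-τ) * (∫ y in Ioc 0 (Real.exp (2 * τ) * xh), y ^ 2 ∂(n (1 - Real.exp (-τ))))
            - ∫ y in Ioc (0 : ℝ) xh,
                (Real.sqrt (2 * Real.pi))⁻¹ * y ^ (-(1 : ℝ) / 2) * Real.exp (-y / 2)|
          ≤ C * (1 + τ) * Real.exp (-τ) := by
  refine ⟨24 / (1 / (200000 * (|μ4| + 1) ^ 2)) ^ 2 + 48 * (6 + 212 * (|μ4| + 1)) + 32 / (1 / (200000 * (|μ4| + 1) ^ 2)), ?_⟩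
  intro n0 n _ h2i h2 h3i h3 h4i h4 hw h0 τ hτ xh hxh
  subst h0
  obtain ⟨hfin, hpos, hweak, _⟩ := hw
  exact final_est hfin hpos hweak h2i h2 h3i h3 h4i h4 rfl rfl hτ hxh
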